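/- Let r be an integer with r ≢ 0 (mod p−1) and r ≢ 1 (mod p−1), and let t be the smallest positive integer with t ≡ 2−r (mod p−1). Let x ∈ F^r with x ∉ F^{×p}. Then for every integer m with 1 ≤ m ≤ n, the conductor satisfies f_m(x) = p^{m−1}·t. -/

import Mathlib

/-- Membership in the group `F^r`: `x ∈ F^×` such that for every `σ ∈ Gal(F/E)`,
`σ(x)·x^{-c_σ^r} ∈ F^{×p^n}`, where `c_σ` is the cyclotomic character value of `σ`
(encoded as a unit of `ZMod (p^n)`). -/
def memFr (p n : ℕ) (E : Type) {F : Type} [Field E] [Field F] [Algebra E F]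
    (ζ : F) (r : ℤ) (x : F) : Prop :=
  x ≠ 0 ∧ ∀ (σ : F ≃ₐ[E] F) (u : (ZMod (p ^ n))ˣ),
    σ ζ = ζ ^ ((u : ZMod (p ^ n)).val) →
      ∃ w : F, σ x * (x ^ (((u ^ r : (ZMod (p ^ n))ˣ) : ZMod (p ^ n)).val))⁻¹ = w ^ (p ^ n)

/-- `b` is a norm from `F(y)` down to `F`. -/
def isNormFrom {F : Type} [Field F] (y : AlgebraicClosure F) (b : F) : Prop :=
  ∃ z : IntermediateField.adjoin F {y}, Algebra.norm F z = b

/-- The set of integers `f ≥ 0` such that every unit `u` of `F` with `v(u-1) ≥ f`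
is a norm from `F(y)`; its least element is the conductor of `F(y)/F`. -/
def condSet {F : Type} [Field F] (v : AddValuation F (WithTop ℤ))
    (y : AlgebraicClosure F) : Set ℕ :=
  {f : ℕ | ∀ u : F, v u = 0 → ((f : ℤ) : WithTop ℤ) ≤ v (u - 1) → isNormFrom y u}

/-- Index identity behind `Subgroup.relIndex_range_ker_comm`. -/
theorem Subgroup.index_eq_of_acyclic {A : Type*} [CommGroup A] (f d : A →* A)
    (hfd : ∀ a, f (d a) = 1) (hdf : ∀ a, d (f a) = 1) (V : Subgroup A)
    (hdV : ∀ a ∈ V, d a ∈ V)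
    (hd : ∀ a ∈ V, d a = 1 → ∃ b ∈ V, f b = a) (hf : ∀ a ∈ V, f a = 1 → ∃ b ∈ V, d b = a) :
    V.index = V.relIndex f.range * f.range.relIndex d.ker * V.relIndex d.range := by
  have hle : f.range ≤ d.ker := by
    rintro _ ⟨a, rfl⟩; exact hdf a
  have h1 : V.comap d = d.ker ⊔ V := by
    ext a
    rw [Subgroup.mem_comap, Subgroup.mem_sup]
    constructor
    · intro ha
      obtain ⟨b, hb, hba⟩ := hf _ ha (hfd a)
      refine ⟨a * b⁻¹, ?_, b, hb, by simp⟩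
      rw [MonoidHom.mem_ker, map_mul, map_inv, hba, mul_inv_cancel]
    · rintro ⟨k, hk, b, hb, rfl⟩
      rw [MonoidHom.mem_ker] at hk
      rw [map_mul, hk, one_mul]
      exact hdV b hb
  have h2 : (f.range ⊔ V).relIndex (d.ker ⊔ V) = f.range.relIndex d.ker := by
    have e1 : d.ker ⊔ V = d.ker ⊔ (f.range ⊔ V) := by
      rw [← sup_assoc, sup_eq_left.mpr hle]
    rw [e1, Subgroup.relIndex_sup_right, ← Subgroup.inf_relIndex_right, sup_inf_assoc_of_le _ hle]
    congr 1
    rw [sup_eq_left]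
    rintro a ⟨ha, ha'⟩
    obtain ⟨b, -, hb⟩ := hd a ha ha'
    exact ⟨b, hb⟩
  have h3 : (d.ker ⊔ V).index = V.relIndex d.range := by
    rw [← h1, Subgroup.index_comap]
  have h4 : V.relIndex (f.range ⊔ V) = V.relIndex f.range := Subgroup.relIndex_sup_right _ _
  rw [← h4, ← h2, ← h3, Subgroup.relIndex_mul_relIndex _ _ _ le_sup_right
    (sup_le_sup_right hle V), Subgroup.relIndex_mul_index le_sup_right]

/-- Equality of the two Tate cohomology indices of a cyclic group acting on `A`, in the presence of
a cohomologically trivial subgroup of finite index. -/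
theorem Subgroup.relIndex_range_ker_comm {A : Type*} [CommGroup A] (f d : A →* A)
    (hfd : ∀ a, f (d a) = 1) (hdf : ∀ a, d (f a) = 1) (V : Subgroup A) [V.FiniteIndex]
    (hdV : ∀ a ∈ V, d a ∈ V) (hfV : ∀ a ∈ V, f a ∈ V)
    (hd : ∀ a ∈ V, d a = 1 → ∃ b ∈ V, f b = a) (hf : ∀ a ∈ V, f a = 1 → ∃ b ∈ V, d b = a) :
    f.range.relIndex d.ker ≠ 0 ∧ f.range.relIndex d.ker = d.range.relIndex f.ker := by
  have e1 := Subgroup.index_eq_of_acyclic f d hfd hdf V hdV hd hf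
  have e2 := Subgroup.index_eq_of_acyclic d f hdf hfd V hfV hf hd
  have h0 : V.index ≠ 0 := Subgroup.FiniteIndex.index_ne_zero
  have h1 := h0
  rw [e1] at h1
  have h2 : V.relIndex f.range ≠ 0 := fun h => h1 (by simp [h])
  have h3 : V.relIndex d.range ≠ 0 := fun h => h1 (by simp [h])
  refine ⟨fun h => h1 (by simp [h]), ?_⟩
  have : (V.relIndex f.range * V.relIndex d.range) * f.range.relIndex d.ker =
      (V.relIndex f.range * V.relIndex d.range) * d.range.relIndex f.ker := by
    rw [e2] at e1
    linarith
  exact Nat.eq_of_mul_eq_mul_left (Nat.pos_of_ne_zero (mul_ne_zero h2 h3)) this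

/-- Hilbert 90 for a cyclic group of automorphisms acting on a subfield. -/
theorem exists_div_eq_of_prod_eq_one {L : Type*} [Field L] (g : L ≃+* L) (S : Subfield L) {N : ℕ}
    (hN : 0 < N) (hS : ∀ x ∈ S, g x ∈ S) (hgN : ∀ x ∈ S, (g ^ N) x = x)
    (hg : ∀ i, 0 < i → i < N → ∃ x ∈ S, (g ^ i) x ≠ x) (a : L) (ha : a ∈ S)
    (hprod : ∏ i ∈ Finset.range N, (g ^ i) a = 1) : ∃ c ∈ S, c ≠ 0 ∧ a = g c / c := by
  have hSi : ∀ i : ℕ, ∀ x ∈ S, (g ^ i) x ∈ S := by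
    intro i
    induction i with
    | zero => intro x hx; simpa using hx
    | succ i ih => intro x hx; rw [pow_succ, RingAut.mul_apply]; exact ih _ (hS _ hx)
  -- the restrictions of the powers of `g` to `S` are distinct characters
  let χ : Fin N → (S →* L) := fun i => ((g ^ (i : ℕ)).toRingHom.comp S.subtype : S →+* L)
  have hχ : ∀ (i : Fin N) (x : S), χ i x = (g ^ (i : ℕ)) x := fun _ _ => rfl
  have hinj : Function.Injective χ := by
    have aux : ∀ i j : Fin N, (i : ℕ) < j → χ i ≠ χ j := by
      intro i j hij h
      obtain ⟨x, hx, hne⟩ := hg (j - i) (by omega) (by omega)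
      have := DFunLike.congr_fun h ⟨x, hx⟩
      rw [hχ, hχ] at this
      have e : (g ^ (j : ℕ)) x = (g ^ (i : ℕ)) ((g ^ ((j : ℕ) - i)) x) := by
        rw [← RingAut.mul_apply, ← pow_add]; congr 2; omega
      simp only at this
      rw [e] at this
      exact hne ((g ^ (i : ℕ)).injective this.symm)
    intro i j h
    by_contra hne
    rcases lt_or_gt_of_ne (fun h => hne (Fin.ext h)) with h1 | h1
    · exact aux i j h1 h
    · exact aux j i h1 h.symm
  have hlin := (linearIndependent_monoidHom S L).comp χ hinj
  rw [Fintype.linearIndependent_iff] at hlin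
  let b : ℕ → L := fun i => ∏ j ∈ Finset.range i, (g ^ j) a
  have hb1 : ∀ i, b (i + 1) = a * g (b i) := by
    intro i
    simp only [b, Finset.prod_range_succ', map_prod, pow_zero, RingAut.one_apply]
    rw [mul_comm]
    congr 1
    refine Finset.prod_congr rfl fun j _ => ?_
    rw [pow_succ', RingAut.mul_apply]
  have hbS : ∀ i, b i ∈ S := fun i => S.prod_mem fun j _ => hSi j a ha
  have hne : ∃ x ∈ S, ∑ i ∈ Finset.range N, b i * (g ^ i) x ≠ 0 := by
    by_contra! hcon
    have := hlin (fun i => b i) (by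
      ext x
      have := hcon x x.2
      rw [Finset.sum_range] at this
      simpa [hχ] using this) ⟨0, hN⟩
    simp [b] at this
  obtain ⟨x, hx, hne⟩ := hne
  set c := ∑ i ∈ Finset.range N, b i * (g ^ i) x with hc
  have hcS : c ∈ S := S.sum_mem fun i _ => S.mul_mem (hbS i) (hSi i x hx)
  have hac : a * g c = c := by
    have e1 : a * g c = ∑ i ∈ Finset.range N, b (i + 1) * (g ^ (i + 1)) x := by
      rw [hc, map_sum, Finset.mul_sum]
      refine Finset.sum_congr rfl fun i _ => ?_
      rw [hb1, map_mul, pow_succ', RingAut.mul_apply, mul_assoc]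
    have e2 := Finset.sum_range_succ (fun i => b i * (g ^ i) x) N
    have e3 := Finset.sum_range_succ' (fun i => b i * (g ^ i) x) N
    have hbN : b N = 1 := hprod
    have hb0 : b 0 = 1 := by simp [b]
    rw [e3, hbN, hb0, hgN x hx, pow_zero, RingAut.one_apply] at e2
    rw [e1, hc]
    exact add_right_cancel e2
  refine ⟨c⁻¹, S.inv_mem hcS, inv_ne_zero hne, ?_⟩
  have hgc : g c ≠ 0 := by simpa using hne
  rw [map_inv₀]
  field_simp
  exact hac

section

open Finset in
/-- A decreasing filtration by open lattices, stable under `g`, with trivial Tate cohomology for the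
cyclic group of order `N` generated by `g`. -/
structure AcyclicFiltration {S : Type*} [NormedField S] (g : S ≃+* S) (N : ℕ)
    (Λ : ℕ → AddSubgroup S) : Prop where
  succ_le : ∀ j, Λ (j + 1) ≤ Λ j
  map_mem : ∀ j, ∀ x ∈ Λ j, g x ∈ Λ j
  mul_mem : ∀ i j, ∀ x ∈ Λ i, ∀ y ∈ Λ j, x * y ∈ Λ (i + j + 1)
  isOpen : IsOpen (Λ 0 : Set S)
  isClosed : IsClosed (Λ 0 : Set S)
  small : ∀ ε > 0, ∃ k, ∀ x ∈ Λ k, ‖x‖ < ε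
  norm_lt : ∀ x ∈ Λ 0, ‖x‖ < 1
  fixed : ∀ j, ∀ x ∈ Λ j, g x = x → ∃ y ∈ Λ j, ∑ i ∈ range N, (g ^ i) y = x
  traceless : ∀ j, ∀ x ∈ Λ j, ∑ i ∈ range N, (g ^ i) x = 0 → ∃ y ∈ Λ j, g y - y = x

section UnitMaps

variable {S : Type*} [NormedField S] (g : S ≃+* S) (hg : ∀ x, ‖g x‖ = ‖x‖)

include hg in
theorem norm_ringAut_pow (i : ℕ) (x : S) : ‖(g ^ i) x‖ = ‖x‖ := by
  induction i with
  | zero => simp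
  | succ i ih => rw [pow_succ', RingAut.mul_apply, hg, ih]

/-- The norm map `u ↦ ∏ gⁱ u` on elements of norm one. -/
def sphereNorm (N : ℕ) : Metric.sphere (0 : S) 1 →* Metric.sphere (0 : S) 1 where
  toFun u := ⟨∏ i ∈ Finset.range N, (g ^ i) (u : S), by
    rw [mem_sphere_zero_iff_norm, norm_prod]
    refine Finset.prod_eq_one fun i _ => ?_
    rw [norm_ringAut_pow g hg]
    exact mem_sphere_zero_iff_norm.mp u.2⟩
  map_one' := by ext; simp
  map_mul' a b := by ext; simp [Finset.prod_mul_distrib]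

/-- The map `u ↦ g u / u` on elements of norm one. -/
def sphereDiff : Metric.sphere (0 : S) 1 →* Metric.sphere (0 : S) 1 where
  toFun u := ⟨g (u : S) / u, by
    rw [mem_sphere_zero_iff_norm, norm_div, hg, mem_sphere_zero_iff_norm.mp u.2, div_one]⟩
  map_one' := by ext; simp
  map_mul' a b := by ext; simp [mul_div_mul_comm]

theorem coe_sphereNorm (N : ℕ) (u : Metric.sphere (0 : S) 1) :
    (sphereNorm g hg N u : S) = ∏ i ∈ Finset.range N, (g ^ i) (u : S) := rfl

theorem coe_sphereDiff (u : Metric.sphere (0 : S) 1) :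
    (sphereDiff g hg u : S) = g (u : S) / u := rfl

theorem sphere_ne_zero (u : Metric.sphere (0 : S) 1) : (u : S) ≠ 0 :=
  norm_ne_zero_iff.mp (by rw [mem_sphere_zero_iff_norm.mp u.2]; exact one_ne_zero)

theorem sphereDiff_eq_one_iff (u : Metric.sphere (0 : S) 1) :
    sphereDiff g hg u = 1 ↔ g (u : S) = u := by
  rw [← Subtype.coe_inj, coe_sphereDiff]
  exact div_eq_one_iff_eq (sphere_ne_zero u)

variable {N : ℕ} (hgN : g ^ N = 1)

include hgN in
theorem map_prod_ringAut_pow (x : S) :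
    g (∏ i ∈ Finset.range N, (g ^ i) x) = ∏ i ∈ Finset.range N, (g ^ i) x := by
  rcases eq_or_ne x 0 with rfl | hx
  · simp only [map_zero, Finset.prod_const, map_pow]
  have e2 := Finset.prod_range_succ (fun i => (g ^ i) x) N
  have e3 := Finset.prod_range_succ' (fun i => (g ^ i) x) N
  rw [e3, hgN, pow_zero] at e2
  have := mul_right_cancel₀ (by simpa using hx) e2
  rw [map_prod]
  refine Eq.trans ?_ this
  exact Finset.prod_congr rfl fun i _ => by rw [pow_succ', RingAut.mul_apply]

include hgN in
theorem map_sum_ringAut_pow (x : S) :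
    g (∑ i ∈ Finset.range N, (g ^ i) x) = ∑ i ∈ Finset.range N, (g ^ i) x := by
  have e2 := Finset.sum_range_succ (fun i => (g ^ i) x) N
  have e3 := Finset.sum_range_succ' (fun i => (g ^ i) x) N
  rw [e3, hgN, pow_zero] at e2
  have := add_right_cancel e2
  rw [map_sum]
  refine Eq.trans ?_ this
  exact Finset.sum_congr rfl fun i _ => by rw [pow_succ', RingAut.mul_apply]

include hgN in
theorem sphereDiff_sphereNorm (u : Metric.sphere (0 : S) 1) :
    sphereDiff g hg (sphereNorm g hg N u) = 1 := by
  rw [sphereDiff_eq_one_iff, coe_sphereNorm]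
  exact map_prod_ringAut_pow g hgN _

include hgN in
theorem sphereNorm_sphereDiff (u : Metric.sphere (0 : S) 1) :
    sphereNorm g hg N (sphereDiff g hg u) = 1 := by
  ext
  rw [coe_sphereNorm, coe_sphereDiff]
  simp only [map_div₀, Finset.prod_div_distrib]
  have : ∏ i ∈ Finset.range N, (g ^ i) (g (u : S)) = ∏ i ∈ Finset.range N, (g ^ i) (u : S) := by
    rw [← map_prod_ringAut_pow g hgN (u : S), map_prod]
    exact Finset.prod_congr rfl fun i _ => by
      rw [← RingAut.mul_apply, ← RingAut.mul_apply, ← pow_succ, ← pow_succ']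
  rw [this]
  exact div_self (Finset.prod_ne_zero_iff.mpr fun i _ =>
    (map_ne_zero (g ^ i)).mpr (sphere_ne_zero u))

end UnitMaps

namespace AcyclicFiltration

variable {S : Type*} [NormedField S] [IsUltrametricDist S] {g : S ≃+* S} (hg : ∀ x, ‖g x‖ = ‖x‖)
  {N : ℕ} {Λ : ℕ → AddSubgroup S} (h : AcyclicFiltration g N Λ)

include h

omit [IsUltrametricDist S] in
theorem mono {i j : ℕ} (hij : i ≤ j) : Λ j ≤ Λ i := by
  induction j, hij using Nat.le_induction with
  | base => exact le_rfl
  | succ j _ ih => exact (h.succ_le j).trans ih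

omit [IsUltrametricDist S] in
theorem mul_mem' {i j : ℕ} {x y : S} (hx : x ∈ Λ i) (hy : y ∈ Λ j) : x * y ∈ Λ (i + 1) :=
  h.mono (by omega) (h.mul_mem i j x hx y hy)

omit [IsUltrametricDist S] in
theorem pow_map_mem (i j : ℕ) {x : S} (hx : x ∈ Λ j) : (g ^ i) x ∈ Λ j := by
  induction i with
  | zero => simpa using hx
  | succ i ih => rw [pow_succ', RingAut.mul_apply]; exact h.map_mem _ _ ih

theorem norm_one_add {j : ℕ} {x : S} (hx : x ∈ Λ j) : ‖1 + x‖ = 1 := by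
  have h1 := h.norm_lt x (h.mono (Nat.zero_le j) hx)
  have := IsUltrametricDist.norm_add_eq_max_of_norm_ne_norm (x := (1 : S)) (y := x)
    (by rw [norm_one]; exact h1.ne')
  rw [this, norm_one, max_eq_left h1.le]

omit [IsUltrametricDist S] in
theorem eventually_mem : ∃ ε > 0, ∀ x : S, ‖x‖ < ε → x ∈ Λ 0 := by
  obtain ⟨ε, hε, hb⟩ := Metric.isOpen_iff.mp h.isOpen 0 (Λ 0).zero_mem
  exact ⟨ε, hε, fun x hx => hb (by simpa using hx)⟩

/-- The group of units congruent to `1` modulo the first lattice. -/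
def unitGroup [ProperSpace S] : Subgroup (Metric.sphere (0 : S) 1) where
  carrier := {u | (u : S) - 1 ∈ Λ 0}
  one_mem' := by simp
  mul_mem' {a b} ha hb := by
    have e : ((a * b : Metric.sphere (0 : S) 1) : S) - 1 =
        ((a : S) - 1) * ((b : S) - 1) + ((a : S) - 1) + ((b : S) - 1) := by
      simp; ring
    simp only [Set.mem_ofPred_eq] at *
    rw [e]
    exact (Λ 0).add_mem ((Λ 0).add_mem (h.mono (Nat.zero_le _) (h.mul_mem _ _ _ ha _ hb)) ha) hb
  inv_mem' {a} ha := by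
    -- a power of `a` is close to `1`, by compactness
    obtain ⟨ε, hε, hb⟩ := h.eventually_mem
    have hpow : ∀ k : ℕ, ((a : S) ^ k) - 1 ∈ Λ 0 := by
      intro k
      induction k with
      | zero => simp
      | succ k ih =>
        have e : (a : S) ^ (k + 1) - 1 =
            ((a : S) ^ k - 1) * ((a : S) - 1) + ((a : S) ^ k - 1) + ((a : S) - 1) := by ring
        rw [e]
        exact (Λ 0).add_mem ((Λ 0).add_mem (h.mono (Nat.zero_le _) (h.mul_mem _ _ _ ih _ ha)) ih) ha
    have hna : ‖(a : S)‖ = 1 := mem_sphere_zero_iff_norm.mp a.2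
    have ha0 := sphere_ne_zero a
    obtain ⟨z, -, φ, hφ, hlim⟩ := (isCompact_sphere (0 : S) 1).tendsto_subseq
      (x := fun k => (a : S) ^ k) (fun k => by simp [hna])
    have hc := hlim.cauchySeq
    obtain ⟨M, hM⟩ := Metric.cauchySeq_iff.mp hc ε hε
    have h1 := hM (M + 1) (Nat.le_succ M) M le_rfl
    have hlt : φ M < φ (M + 1) := hφ (Nat.lt_succ_self M)
    simp only [Function.comp_apply, dist_eq_norm] at h1
    set l := φ (M + 1) - φ M with hl
    have e1 : (a : S) ^ φ (M + 1) - (a : S) ^ φ M = (a : S) ^ φ M * ((a : S) ^ l - 1) := by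
      rw [mul_sub, ← pow_add, mul_one]; congr 2; omega
    rw [e1, norm_mul, norm_pow, hna, one_pow, one_mul] at h1
    have h2 : ‖(a : S) ^ (l - 1) - (a : S)⁻¹‖ < ε := by
      have e2 : (a : S) ^ l - 1 = a * ((a : S) ^ (l - 1) - (a : S)⁻¹) := by
        rw [mul_sub, mul_inv_cancel₀ ha0, ← pow_succ']; congr 2; omega
      rwa [e2, norm_mul, hna, one_mul] at h1
    have h3 := (Λ 0).sub_mem (hpow (l - 1)) (hb _ h2)
    simpa using h3

omit [IsUltrametricDist S] in
theorem mem_unitGroup [ProperSpace S] {u : Metric.sphere (0 : S) 1} :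
    u ∈ h.unitGroup ↔ (u : S) - 1 ∈ Λ 0 := Iff.rfl

theorem finiteIndex_unitGroup [ProperSpace S] : h.unitGroup.FiniteIndex := by
  have : CompactSpace (Metric.sphere (0 : S) 1) := inferInstance
  have ho : IsOpen (h.unitGroup : Set (Metric.sphere (0 : S) 1)) :=
    h.isOpen.preimage (continuous_subtype_val.sub continuous_const)
  have := Subgroup.quotient_finite_of_isOpen _ ho
  exact Subgroup.finiteIndex_of_finite_quotient

theorem isCompact_unitGroup [ProperSpace S] :
    IsCompact (h.unitGroup : Set (Metric.sphere (0 : S) 1)) :=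
  (h.isClosed.preimage (continuous_subtype_val.sub continuous_const)).isCompact

omit [IsUltrametricDist S] in
/-- The product of the conjugates of `1 + x` is `1 + ∑ gⁱ x` up to higher order. -/
theorem prod_sub_sum_mem {j : ℕ} {x : S} (hx : x ∈ Λ j) (M : ℕ) :
    ∏ i ∈ Finset.range M, (g ^ i) (1 + x) - (1 + ∑ i ∈ Finset.range M, (g ^ i) x) ∈ Λ (j + 1) := by
  induction M with
  | zero => simp
  | succ M ih =>
    rw [Finset.prod_range_succ, Finset.sum_range_succ]
    set P := ∏ i ∈ Finset.range M, (g ^ i) (1 + x)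
    set T := ∑ i ∈ Finset.range M, (g ^ i) x with hT
    have hTm : T ∈ Λ j := (Λ j).sum_mem fun i _ => h.pow_map_mem i j hx
    have hxm := h.pow_map_mem M j hx
    have e : P * (g ^ M) (1 + x) - (1 + (T + (g ^ M) x)) =
        (P - (1 + T)) + ((P - (1 + T)) * (g ^ M) x + T * (g ^ M) x) := by
      rw [map_add, map_one]; ring
    rw [e]
    exact (Λ _).add_mem ih ((Λ _).add_mem (h.succ_le _ (h.mul_mem' ih hxm)) (h.mul_mem' hTm hxm))

/-- A unit with first lattice congruence is approximated by the image of `F` as soon as one can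
improve approximations step by step. -/
theorem exists_map_eq_of_approx [ProperSpace S]
    (F : Metric.sphere (0 : S) 1 →* Metric.sphere (0 : S) 1) (hF : Continuous F)
    (P : Metric.sphere (0 : S) 1 → Prop) (hP : ∀ a b, P a → P (a / F b))
    (hstep : ∀ j, ∀ u : Metric.sphere (0 : S) 1, (u : S) - 1 ∈ Λ j → P u →
      ∃ w ∈ h.unitGroup, ((u / F w : Metric.sphere (0 : S) 1) : S) - 1 ∈ Λ (j + 1))
    (u : Metric.sphere (0 : S) 1) (hu : u ∈ h.unitGroup) (hPu : P u) :
    ∃ w ∈ h.unitGroup, F w = u := by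
  have happ : ∀ j, ∃ w ∈ h.unitGroup, ((u / F w : Metric.sphere (0 : S) 1) : S) - 1 ∈ Λ j := by
    intro j
    induction j with
    | zero => exact ⟨1, one_mem _, by simpa using h.mem_unitGroup.mp hu⟩
    | succ j ih =>
      obtain ⟨w, hw, hwj⟩ := ih
      obtain ⟨w', hw', hwj'⟩ := hstep j _ hwj (hP u w hPu)
      exact ⟨w * w', h.unitGroup.mul_mem hw hw', by rwa [map_mul, ← div_div]⟩
  have hcl : IsClosed (F '' h.unitGroup) := (h.isCompact_unitGroup.image hF).isClosed
  have : u ∈ closure (F '' h.unitGroup) := by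
    rw [Metric.mem_closure_iff]
    intro ε hε
    obtain ⟨k, hk⟩ := h.small ε hε
    obtain ⟨w, hw, hwk⟩ := happ k
    refine ⟨F w, ⟨w, hw, rfl⟩, ?_⟩
    have h1 := hk _ hwk
    have e : (u : S) - F w = F w * (((u / F w : Metric.sphere (0 : S) 1) : S) - 1) := by
      have := sphere_ne_zero (F w)
      simp; field_simp
    rw [Subtype.dist_eq, dist_eq_norm, e, norm_mul, mem_sphere_zero_iff_norm.mp (F w).2, one_mul]
    exact h1
  rw [hcl.closure_eq] at this
  exact this

omit [IsUltrametricDist S] in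
theorem div_sub_one_mem [ProperSpace S] {j : ℕ} {u w : Metric.sphere (0 : S) 1}
    (hw : w ∈ h.unitGroup) (huw : (u : S) - w ∈ Λ j) :
    ((u / w : Metric.sphere (0 : S) 1) : S) - 1 ∈ Λ j := by
  have hinv : ((w⁻¹ : Metric.sphere (0 : S) 1) : S) - 1 ∈ Λ 0 := h.unitGroup.inv_mem hw
  have e : ((u / w : Metric.sphere (0 : S) 1) : S) - 1 =
      ((u : S) - w) * (((w⁻¹ : Metric.sphere (0 : S) 1) : S) - 1) + ((u : S) - w) := by
    have := sphere_ne_zero w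
    simp; field_simp; ring
  rw [e]
  exact (Λ j).add_mem (h.succ_le _ (h.mul_mem' huw hinv)) huw

theorem relIndex_eq [ProperSpace S] (hgN : g ^ N = 1) :
    (sphereNorm g hg N).range.relIndex (sphereDiff g hg).ker ≠ 0 ∧
    (sphereNorm g hg N).range.relIndex (sphereDiff g hg).ker =
      (sphereDiff g hg).range.relIndex (sphereNorm g hg N).ker := by
  have hgc : Continuous g := (AddMonoidHomClass.isometry_of_norm g hg).continuous
  have hgic : ∀ i : ℕ, Continuous (g ^ i) := fun i =>
    (AddMonoidHomClass.isometry_of_norm (g ^ i) (norm_ringAut_pow g hg i)).continuous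
  have := h.finiteIndex_unitGroup
  have hnV : ∀ a ∈ h.unitGroup, sphereNorm g hg N a ∈ h.unitGroup := by
    intro a ha
    rw [mem_unitGroup] at ha ⊢
    have h1 := h.prod_sub_sum_mem ha N
    rw [add_sub_cancel] at h1
    have h2 : ∑ i ∈ Finset.range N, (g ^ i) ((a : S) - 1) ∈ Λ 0 :=
      (Λ 0).sum_mem fun i _ => h.pow_map_mem i 0 ha
    have := (Λ 0).add_mem (h.succ_le _ h1) h2
    rw [coe_sphereNorm]
    convert this using 1
    ring
  have hdV : ∀ a ∈ h.unitGroup, sphereDiff g hg a ∈ h.unitGroup := by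
    intro a ha
    have hga : (⟨g (a : S), by rw [mem_sphere_zero_iff_norm, hg]; simp⟩ :
        Metric.sphere (0 : S) 1) ∈ h.unitGroup := by
      rw [mem_unitGroup] at ha ⊢
      have := h.map_mem _ _ ha
      simpa using this
    exact h.unitGroup.div_mem hga ha
  refine Subgroup.relIndex_range_ker_comm (sphereNorm g hg N) (sphereDiff g hg)
    (sphereNorm_sphereDiff g hg hgN) (sphereDiff_sphereNorm g hg hgN) h.unitGroup hdV hnV ?_ ?_
  · refine h.exists_map_eq_of_approx (sphereNorm g hg N) ?_
      (fun u => sphereDiff g hg u = 1) ?_ ?_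
    · refine Continuous.subtype_mk ?_ _
      exact continuous_finsetProd _ fun i _ => (hgic i).comp continuous_subtype_val
    · intro a b ha
      rw [map_div, ha, sphereDiff_sphereNorm g hg hgN, div_one]
    · intro j u hu hfix
      rw [sphereDiff_eq_one_iff] at hfix
      obtain ⟨μ, hμ, hμx⟩ := h.fixed j _ hu (by rw [map_sub, hfix, map_one])
      let w : Metric.sphere (0 : S) 1 := ⟨1 + μ, by
        rw [mem_sphere_zero_iff_norm, h.norm_one_add hμ]⟩
      have hw : w ∈ h.unitGroup := by
        rw [mem_unitGroup]
        simpa [w] using h.mono (Nat.zero_le j) hμ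
      refine ⟨w, hw, h.div_sub_one_mem (hnV _ hw) ?_⟩
      have h1 := h.prod_sub_sum_mem hμ N
      rw [hμx] at h1
      have h2 := (Λ _).neg_mem h1
      rw [coe_sphereNorm]
      convert h2 using 1
      simp [w]
  · refine h.exists_map_eq_of_approx (sphereDiff g hg) ?_
      (fun u => sphereNorm g hg N u = 1) ?_ ?_
    · refine Continuous.subtype_mk ?_ _
      exact (hgc.comp continuous_subtype_val).div₀ continuous_subtype_val sphere_ne_zero
    · intro a b ha
      rw [map_div, ha, sphereNorm_sphereDiff g hg hgN, div_one]
    · intro j u hu hnorm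
      have h1 := h.prod_sub_sum_mem hu N
      have h0 : ∏ i ∈ Finset.range N, (g ^ i) (u : S) = 1 := by
        rw [← coe_sphereNorm g hg, hnorm]; rfl
      rw [add_sub_cancel, h0, sub_add_cancel_left] at h1
      have h2 := (Λ _).neg_mem h1
      rw [neg_neg] at h2
      obtain ⟨ν, hν, hνx⟩ := h.fixed _ _ h2 (map_sum_ringAut_pow g hgN _)
      obtain ⟨μ, hμ, hμx⟩ := h.traceless j ((u : S) - 1 - ν)
        ((Λ j).sub_mem hu (h.succ_le _ hν)) (by simp only [map_sub, Finset.sum_sub_distrib] at hνx ⊢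
                                                rw [hνx]; simp)
      let w : Metric.sphere (0 : S) 1 := ⟨1 + μ, by
        rw [mem_sphere_zero_iff_norm, h.norm_one_add hμ]⟩
      have hw : w ∈ h.unitGroup := by
        rw [mem_unitGroup]
        simpa [w] using h.mono (Nat.zero_le j) hμ
      have hgw : (⟨g (w : S), by rw [mem_sphere_zero_iff_norm, hg]; simp⟩ :
          Metric.sphere (0 : S) 1) ∈ h.unitGroup := by
        rw [mem_unitGroup] at hw ⊢
        have := h.map_mem _ _ hw
        simpa using this
      refine ⟨w, hw, ?_⟩
      have h3 := h.div_sub_one_mem (j := j + 1) (u := u * w) hgw (by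
        have e : ((u * w : Metric.sphere (0 : S) 1) : S) - g (w : S) = ν + ((u : S) - 1) * μ := by
          have : g μ = μ + ((u : S) - 1 - ν) := by rw [← hμx]; ring
          simp only [Metric.unitSphere.coe_mul, w, map_add, map_one, this]; ring
        rw [e]
        exact (Λ _).add_mem hν (h.mul_mem' hu hμ))
      convert h3 using 2
      simp [coe_sphereDiff, div_div_eq_mul_div]

end AcyclicFiltration

end

/-- Construction of an acyclic filtration from coordinates with respect to a normal basis
`θ, g θ, g² θ, …`: here `c` is the coordinate at `θ`. -/
theorem exists_acyclicFiltration_of_coord {S : Type*} [NormedField S] [IsUltrametricDist S]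
    (g : S ≃+* S) (hg : ∀ x, ‖g x‖ = ‖x‖) {N : ℕ}
    (c : S →+ S) (θ : S) {C : ℝ} (hC0 : 0 < C) (hC : ∀ x, ‖c x‖ ≤ C * ‖x‖)
    (hgc : ∀ x, g (c x) = c x) (hmul : ∀ a x, g a = a → c (a * x) = a * c x)
    (hθ : ∀ i : ℕ, ‖c ((g ^ i) θ)‖ ≤ 1)
    (hsum : ∀ x, ∑ i ∈ Finset.range N, c ((g ^ (N - i)) x) * (g ^ i) θ = x) :
    ∃ Λ, AcyclicFiltration g N Λ := by
  have hgp := norm_ringAut_pow g hg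
  let q : ℝ := 1 / 2
  have hq0 : 0 < q := by norm_num [q]
  have hq1 : q < 1 := by norm_num [q]
  set D : ℝ := ‖θ‖ with hD
  have hgfix : ∀ a, g a = a → ∀ i : ℕ, (g ^ i) a = a := by
    intro a ha i
    induction i with
    | zero => simp
    | succ i ih => rw [pow_succ', RingAut.mul_apply, ih, ha]
  have hDpos : 0 < D := by
    rw [hD, norm_pos_iff]
    rintro h0
    have := hsum 1
    simp [h0] at this
  obtain ⟨a, ha⟩ := exists_pow_lt_of_lt_one (x := min (q / (C * D ^ 2)) (1 / D))
    (lt_min (by positivity) (by positivity)) hq1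
  have ha1 : C * D ^ 2 * q ^ a ≤ q := by
    have := (lt_min_iff.mp ha).1
    rw [lt_div_iff₀ (by positivity)] at this
    linarith
  have ha2 : q ^ a * D < 1 := by
    have := (lt_min_iff.mp ha).2
    rwa [lt_div_iff₀ (by positivity)] at this
  let Λ : ℕ → AddSubgroup S := fun j =>
    { carrier := {x | ∀ i : ℕ, ‖c ((g ^ i) x)‖ ≤ q ^ (j + a)}
      zero_mem' := by
        intro i
        simp only [map_zero, norm_zero]
        positivity
      add_mem' := by
        intro x y hx hy i
        rw [map_add, map_add]
        exact (IsUltrametricDist.norm_add_le_max _ _).trans (max_le (hx i) (hy i))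
      neg_mem' := by
        intro x hx i
        rw [map_neg, map_neg, norm_neg]
        exact hx i }
  have hmem : ∀ j x, x ∈ Λ j ↔ ∀ i : ℕ, ‖c ((g ^ i) x)‖ ≤ q ^ (j + a) := fun _ _ => Iff.rfl
  have hnorm : ∀ j x, x ∈ Λ j → ‖x‖ ≤ q ^ (j + a) * D := by
    intro j x hx
    rw [← hsum x]
    refine IsUltrametricDist.norm_sum_le_of_forall_le_of_nonneg (by positivity) fun i _ => ?_
    rw [norm_mul, hgp]
    exact mul_le_mul_of_nonneg_right (hx _) (norm_nonneg _)
  have hqj : ∀ j, q ^ (j + a) ≤ q ^ a := fun j =>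
    pow_le_pow_of_le_one hq0.le hq1.le (by omega)
  have hopen : IsOpen (Λ 0 : Set S) := by
    refine AddSubgroup.isOpen_of_mem_nhds _ (g := 0) ?_
    refine Filter.mem_of_superset (Metric.ball_mem_nhds 0 (ε := q ^ (0 + a) / C) (by positivity)) ?_
    intro x hx i
    rw [mem_ball_zero_iff, lt_div_iff₀ hC0] at hx
    refine (hC _).trans ?_
    rw [hgp]
    linarith
  -- elements with prescribed coordinates
  have hcoord : ∀ j, ∀ s : ℕ → S, (∀ i, g (s i) = s i) → (∀ i, ‖s i‖ ≤ q ^ (j + a)) →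
      ∑ i ∈ Finset.range N, s i * (g ^ i) θ ∈ Λ j := by
    intro j s hs hsj
    refine AddSubgroup.sum_mem _ fun i _ => ?_
    intro k
    rw [map_mul, hgfix _ (hs i), hmul _ _ (hs i), norm_mul, ← RingAut.mul_apply, ← pow_add]
    exact (mul_le_of_le_one_right (norm_nonneg _) (hθ _)).trans (hsj i)
  refine ⟨Λ, ?_, ?_, ?_, hopen, AddSubgroup.isClosed_of_isOpen _ hopen, ?_, ?_, ?_, ?_⟩
  · intro j x hx i
    exact (hx i).trans (pow_le_pow_of_le_one hq0.le hq1.le (by omega))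
  · intro j x hx i
    rw [← RingAut.mul_apply, ← pow_succ]
    exact hx _
  · intro i j x hx y hy k
    refine (hC _).trans ?_
    rw [hgp, norm_mul]
    have h1 := hnorm i x hx
    have h2 := hnorm j y hy
    calc C * (‖x‖ * ‖y‖) ≤ C * ((q ^ (i + a) * D) * (q ^ (j + a) * D)) := by gcongr
      _ = (C * D ^ 2 * q ^ a) * q ^ (i + j + a) := by ring
      _ ≤ q * q ^ (i + j + a) := by gcongr
      _ = q ^ (i + j + 1 + a) := by ring
  · intro ε hε
    obtain ⟨k, hk⟩ := exists_pow_lt_of_lt_one hε hq1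
    refine ⟨k, fun x hx => ?_⟩
    refine (hnorm k x hx).trans_lt ?_
    calc q ^ (k + a) * D = q ^ k * (q ^ a * D) := by ring
      _ ≤ q ^ k * 1 := by gcongr
      _ < ε := by linarith
  · intro x hx
    refine (hnorm 0 x hx).trans_lt ?_
    simpa using ha2
  · intro j x hx hfix
    refine ⟨c x * θ, ?_, ?_⟩
    · intro i
      rw [map_mul, hgfix _ (hgc x), hmul _ _ (hgc x), norm_mul]
      exact (mul_le_of_le_one_right (norm_nonneg _) (hθ i)).trans (by simpa using hx 0)
    · conv_rhs => rw [← hsum x]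
      refine Finset.sum_congr rfl fun i _ => ?_
      rw [map_mul, hgfix _ (hgc x), hgfix _ hfix]
  · intro j x hx htr
    let s : ℕ → S := fun i => ∑ k ∈ Finset.range i, c ((g ^ (N - k)) x)
    have hs0 : s 0 = 0 := by simp [s]
    have hsN : s N = 0 := by
      simp only [s]
      rw [← map_sum, ← Finset.sum_range_reflect]
      have : ∑ k ∈ Finset.range N, (g ^ (N - (N - 1 - k))) x =
          g (∑ k ∈ Finset.range N, (g ^ k) x) := by
        rw [map_sum]
        refine Finset.sum_congr rfl fun k hk => ?_
        rw [Finset.mem_range] at hk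
        rw [← RingAut.mul_apply, ← pow_succ']
        congr 2
        omega
      rw [this, htr, map_zero, map_zero]
    have hsg : ∀ i, g (s i) = s i := by
      intro i
      simp only [s, map_sum, hgc]
    have hsn : ∀ i, ‖s i‖ ≤ q ^ (j + a) := fun i =>
      IsUltrametricDist.norm_sum_le_of_forall_le_of_nonneg (by positivity) fun k _ => hx _
    refine ⟨∑ i ∈ Finset.range N, (-s (i + 1)) * (g ^ i) θ,
      hcoord j _ (fun i => by rw [map_neg, hsg]) (fun i => by rw [norm_neg]; exact hsn _), ?_⟩
    have e1 : g (∑ i ∈ Finset.range N, (-s (i + 1)) * (g ^ i) θ) =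
        -∑ i ∈ Finset.range N, s i * (g ^ i) θ := by
      have e2 := Finset.sum_range_succ (fun i => s i * (g ^ i) θ) N
      rw [Finset.sum_range_succ', hs0, hsN, zero_mul, zero_mul, add_zero, add_zero] at e2
      rw [← e2, map_sum, ← Finset.sum_neg_distrib]
      refine Finset.sum_congr rfl fun i _ => ?_
      rw [map_mul, map_neg, hsg, ← RingAut.mul_apply, ← pow_succ', neg_mul]
    rw [e1, ← Finset.sum_neg_distrib, ← Finset.sum_sub_distrib]
    conv_rhs => rw [← hsum x]
    refine Finset.sum_congr rfl fun i _ => ?_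
    simp only [s, Finset.sum_range_succ]
    ring

theorem AlgEquiv.toRingEquiv_pow_apply {K S : Type*} [Field K] [Field S] [Algebra K S]
    (g : S ≃ₐ[K] S) (i : ℕ) (x : S) : ((g : S ≃+* S) ^ i) x = (g ^ i) x := by
  induction i generalizing x with
  | zero => rfl
  | succ i ih => rw [pow_succ, pow_succ, RingAut.mul_apply, AlgEquiv.mul_apply, ih]; rfl

open IntermediateField in
theorem exists_acyclicFiltration {p : ℕ} [Fact p.Prime] {S : Type*} [NormedField S]
    [IsUltrametricDist S] [NormedAlgebra ℚ_[p] S] [FiniteDimensional ℚ_[p] S]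
    (g : S ≃ₐ[ℚ_[p]] S) (hg : ∀ x, ‖g x‖ = ‖x‖) :
    ∃ Λ, AcyclicFiltration (g : S ≃+* S) (orderOf g) Λ := by
  classical
  set K := fixedField (Subgroup.zpowers g) with hK
  have hKmem : ∀ x, x ∈ K ↔ g x = x := by
    intro x
    rw [hK, mem_fixedField_iff]
    constructor
    · intro h; exact h g (Subgroup.mem_zpowers g)
    · intro h
      have : Subgroup.zpowers g ≤ MulAction.stabilizer (S ≃ₐ[ℚ_[p]] S) x := by
        rw [Subgroup.zpowers_le]; exact h
      exact fun f hf => this hf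
  have hfs : K.fixingSubgroup = Subgroup.zpowers g := by
    rw [hK]; exact fixingSubgroup_fixedField _
  have hgmem : g ∈ K.fixingSubgroup := by rw [hfs]; exact Subgroup.mem_zpowers g
  let γ : S ≃ₐ[K] S := K.fixingSubgroupEquiv ⟨g, hgmem⟩
  have hγ : ∀ x, γ x = g x := fun _ => rfl
  have hγi : ∀ (i : ℕ) x, (γ ^ i) x = (g ^ i) x := by
    intro i
    induction i with
    | zero => intro x; rfl
    | succ i ih =>
      intro x
      rw [pow_succ', pow_succ', AlgEquiv.mul_apply, AlgEquiv.mul_apply, ih, hγ]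
  have hord : orderOf γ = orderOf g := by
    rw [MulEquiv.orderOf_eq, Subgroup.orderOf_mk]
  have hgen : ∀ e : S ≃ₐ[K] S, e ∈ Subgroup.zpowers γ := by
    intro e
    obtain ⟨⟨h, hh⟩, rfl⟩ := K.fixingSubgroupEquiv.surjective e
    rw [hfs] at hh
    obtain ⟨k, rfl⟩ := Subgroup.mem_zpowers_iff.mp hh
    refine Subgroup.mem_zpowers_iff.mpr ⟨k, ?_⟩
    rw [← map_zpow]
    rfl
  have hfinK : FiniteDimensional K S := inferInstance
  have hgal : IsGalois K S := IsGalois.of_fixed_field S (Subgroup.zpowers g)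
  let b := IsGalois.normalBasis K S
  have hb : ∀ e e' : S ≃ₐ[K] S, e (b e') = b (e * e') := by
    intro e e'
    rw [IsGalois.normalBasis_apply, IsGalois.normalBasis_apply (e * e'), AlgEquiv.mul_apply]
  have hrep : ∀ (e e' : S ≃ₐ[K] S) x, b.repr (e x) e' = b.repr x (e⁻¹ * e') := by
    intro e e' x
    have h1 : e x = ∑ f, b.repr x (e⁻¹ * f) • b f := by
      conv_lhs => rw [← b.sum_repr x, map_sum]
      refine Eq.trans (Finset.sum_congr rfl fun f _ => ?_)
        (Equiv.sum_comp (Equiv.mulLeft e) (fun f => b.repr x (e⁻¹ * f) • b f))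
      simp [hb]
    rw [h1, b.repr_sum_self]
  let c' : S →ₗ[ℚ_[p]] S :=
    (K.val.toLinearMap ∘ₗ ((b.coord 1).restrictScalars ℚ_[p]))
  have hc' : ∀ x, c' x = (b.repr x 1 : S) := fun _ => rfl
  let C := LinearMap.toContinuousLinearMap c'
  refine exists_acyclicFiltration_of_coord (g : S ≃+* S) hg c'.toAddMonoidHom (b 1) (C := ‖C‖ + 1)
    (by positivity) ?_ ?_ ?_ ?_ ?_
  · intro x
    refine (C.le_opNorm x).trans ?_
    gcongr
    linarith
  · intro x
    exact (hKmem _).mp (b.repr x 1).2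
  · intro a x ha
    have : a * x = (⟨a, (hKmem a).mpr ha⟩ : K) • x := rfl
    change c' (a * x) = a * c' x
    rw [hc', hc', this, map_smul]
    rfl
  · intro i
    rw [AlgEquiv.toRingEquiv_pow_apply, ← hγi]
    change ‖c' ((γ ^ i) (b 1))‖ ≤ 1
    rw [hc', hb, b.repr_self, Finsupp.single_apply]
    split_ifs <;> simp
  · intro x
    have hsum := b.sum_repr x
    rw [← IsCyclic.image_range_orderOf hgen, Finset.sum_image, hord] at hsum
    · conv_rhs => rw [← hsum]
      refine Finset.sum_congr rfl fun i hi => ?_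
      rw [AlgEquiv.toRingEquiv_pow_apply, AlgEquiv.toRingEquiv_pow_apply, ← hγi, ← hγi, hb, mul_one]
      change c' _ * _ = _
      rw [hc', hrep, mul_one]
      have : (γ ^ (orderOf g - i))⁻¹ = γ ^ i := by
        rw [inv_eq_iff_mul_eq_one, ← pow_add, Nat.sub_add_cancel (Finset.mem_range.mp hi).le,
          ← hord, pow_orderOf_eq_one]
      rw [this]
      rfl
    · intro i hi j hj hij
      exact pow_injOn_Iio_orderOf (by simpa using hi) (by simpa using hj) hij

section Herbrand

variable {p : ℕ} [Fact p.Prime] {S : Type*} [NormedField S]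
    [IsUltrametricDist S] [NormedAlgebra ℚ_[p] S] [FiniteDimensional ℚ_[p] S]
    (g : S ≃ₐ[ℚ_[p]] S) (hg : ∀ x, ‖g x‖ = ‖x‖)

omit [IsUltrametricDist S] [FiniteDimensional ℚ_[p] S] in
theorem ringEquiv_pow_orderOf : (g : S ≃+* S) ^ orderOf g = 1 := by
  ext x
  rw [AlgEquiv.toRingEquiv_pow_apply, pow_orderOf_eq_one]
  rfl

theorem sphere_relIndex_eq :
    (sphereNorm (g : S ≃+* S) hg (orderOf g)).range.relIndex (sphereDiff (g : S ≃+* S) hg).ker ≠ 0 ∧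
    (sphereNorm (g : S ≃+* S) hg (orderOf g)).range.relIndex (sphereDiff (g : S ≃+* S) hg).ker =
      (sphereDiff (g : S ≃+* S) hg).range.relIndex
        (sphereNorm (g : S ≃+* S) hg (orderOf g)).ker := by
  have : ProperSpace S := FiniteDimensional.proper ℚ_[p] S
  obtain ⟨Λ, hΛ⟩ := exists_acyclicFiltration g hg
  exact hΛ.relIndex_eq hg (ringEquiv_pow_orderOf g)

omit [IsUltrametricDist S] in
theorem exists_div_eq_of_mem_ker_sphereNorm (u : Metric.sphere (0 : S) 1)
    (hu : u ∈ (sphereNorm (g : S ≃+* S) hg (orderOf g)).ker) :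
    ∃ c : S, c ≠ 0 ∧ (u : S) = g c / c := by
  have hfin : IsOfFinOrder g := isOfFinOrder_of_finite g
  obtain ⟨c, -, hc, hcu⟩ := exists_div_eq_of_prod_eq_one (g : S ≃+* S) ⊤ hfin.orderOf_pos
    (fun _ _ => Subfield.mem_top _)
    (fun x _ => by rw [ringEquiv_pow_orderOf]; rfl)
    (fun i hi hiN => by
      by_contra! hcon
      have : g ^ i = 1 := by
        ext x
        rw [← AlgEquiv.toRingEquiv_pow_apply]
        exact hcon x (Subfield.mem_top _)
      exact absurd (orderOf_le_of_pow_eq_one hi this) (by omega))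
    (u : S) (Subfield.mem_top _)
    (by rw [← coe_sphereNorm (g : S ≃+* S) hg, (MonoidHom.mem_ker).mp hu]; rfl)
  exact ⟨c, hc, hcu⟩

include hg in
/-- Every unit fixed by `g` is a norm of a unit if the extension of the fixed field is
unramified. -/
theorem exists_prod_eq_of_unramified
    (hval : ∀ z : S, z ≠ 0 → ∃ a, g a = a ∧ ‖a‖ = ‖z‖) (u : S) (hu : g u = u) (hu1 : ‖u‖ = 1) :
    ∃ w : S, ‖w‖ = 1 ∧ ∏ i ∈ Finset.range (orderOf g), (g ^ i) w = u := by
  have h1 : (sphereDiff (g : S ≃+* S) hg).range.relIndex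
        (sphereNorm (g : S ≃+* S) hg (orderOf g)).ker = 1 := by
    rw [Subgroup.relIndex_eq_one]
    intro v hv
    obtain ⟨c, hc, hcv⟩ := exists_div_eq_of_mem_ker_sphereNorm g hg v hv
    obtain ⟨a, ha, hac⟩ := hval c hc
    have ha0 : a ≠ 0 := norm_ne_zero_iff.mp (by rw [hac]; exact norm_ne_zero_iff.mpr hc)
    refine ⟨⟨c / a, by simp [hac, hc]⟩, ?_⟩
    ext
    rw [coe_sphereDiff, hcv]
    simp [ha]
    field_simp
  have h2 := (sphere_relIndex_eq g hg).2
  rw [h1, Subgroup.relIndex_eq_one] at h2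
  obtain ⟨w, hw⟩ := h2 (x := ⟨u, by simpa using hu1⟩) ((sphereDiff_eq_one_iff _ hg _).mpr hu)
  refine ⟨w, mem_sphere_zero_iff_norm.mp w.2, ?_⟩
  have h3 := congrArg Subtype.val hw
  rw [coe_sphereNorm] at h3
  simpa only [AlgEquiv.toRingEquiv_pow_apply] using h3

include hg in
/-- The number of classes of fixed units modulo norms of units is at most the ramification
index. -/
theorem exists_ne_eq_mul_prod_of_card
    (π ϖ : S) {P : ℕ} (hϖ : ϖ ≠ 0) (hval : ∀ z : S, z ≠ 0 → ∃ i : ℤ, ‖z‖ = ‖ϖ‖ ^ i)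
    (hπ : g π = π) (hπϖ : ‖π‖ = ‖ϖ‖ ^ P) (hP : 0 < P)
    (s : Fin (P + 1) → S) (hs : ∀ i, g (s i) = s i) (hs1 : ∀ i, ‖s i‖ = 1) :
    ∃ i j, i ≠ j ∧ ∃ w : S, ‖w‖ = 1 ∧
      s i = s j * ∏ k ∈ Finset.range (orderOf g), (g ^ k) w := by
  have : NeZero P := ⟨hP.ne'⟩
  have hϖ0 : 0 < ‖ϖ‖ := norm_pos_iff.mpr hϖ
  let D : Metric.sphere (0 : S) 1 := ⟨g ϖ / ϖ, by
    rw [mem_sphere_zero_iff_norm, norm_div, hg, div_self hϖ0.ne']⟩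
  set f := sphereNorm (g : S ≃+* S) hg (orderOf g) with hf
  set d := sphereDiff (g : S ≃+* S) hg with hd
  have hD : D ∈ f.ker := by
    rw [MonoidHom.mem_ker]
    ext
    rw [hf, coe_sphereNorm]
    simp only [D, map_div₀, Finset.prod_div_distrib, AlgEquiv.toRingEquiv_pow_apply]
    have e := map_prod_ringAut_pow (g : S ≃+* S) (ringEquiv_pow_orderOf g) ϖ
    rw [map_prod] at e
    simp only [AlgEquiv.toRingEquiv_pow_apply] at e
    have e' : ∏ i ∈ Finset.range (orderOf g), (g ^ i) (g ϖ) =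
        ∏ i ∈ Finset.range (orderOf g), (g ^ i) ϖ := by
      rw [← e]
      refine Finset.prod_congr rfl fun i _ => ?_
      rw [← AlgEquiv.mul_apply, ← pow_succ, pow_succ', AlgEquiv.mul_apply]
      rfl
    rw [e']
    exact div_self (Finset.prod_ne_zero_iff.mpr fun i _ => (map_ne_zero (g ^ i)).mpr hϖ)
  have h1 : d.range.relIndex f.ker ≤ P := by
    have hsurj : Function.Surjective (fun i : Fin P =>
        ((⟨D, hD⟩ ^ (i : ℕ) : f.ker) : f.ker ⧸ d.range.subgroupOf f.ker)) := by
      intro q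
      obtain ⟨⟨v, hv⟩, rfl⟩ := QuotientGroup.mk_surjective q
      obtain ⟨c, hc, hcv⟩ := exists_div_eq_of_mem_ker_sphereNorm g hg v hv
      obtain ⟨i, hi⟩ := hval c hc
      have hP' : (0 : ℤ) < P := by exact_mod_cast hP
      have hi0 := Int.emod_nonneg i hP'.ne'
      have hi1 := Int.emod_lt_of_pos i hP'
      have hi2 := Int.emod_add_mul_ediv i P
      obtain ⟨i0, hi0'⟩ := Int.eq_ofNat_of_zero_le hi0
      have hi0P : i0 < P := by omega
      have hπ0 : π ≠ 0 := norm_ne_zero_iff.mp (by rw [hπϖ]; positivity)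
      have hgϖ : g ϖ ≠ 0 := (map_ne_zero g).mpr hϖ
      have hgc : g c ≠ 0 := (map_ne_zero g).mpr hc
      let w : Metric.sphere (0 : S) 1 := ⟨c / (ϖ ^ i0 * π ^ (i / P)), by
        rw [mem_sphere_zero_iff_norm, norm_div, norm_mul, norm_zpow, norm_pow, hπϖ, hi,
          ← zpow_natCast,
          ← zpow_natCast, ← zpow_mul, ← zpow_add₀ hϖ0.ne', ← hi0', hi2]
        exact div_self (zpow_ne_zero _ hϖ0.ne')⟩
      refine ⟨⟨i0, hi0P⟩, ?_⟩
      simp only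
      rw [QuotientGroup.eq, Subgroup.mem_subgroupOf]
      refine ⟨w, ?_⟩
      ext
      rw [hd, coe_sphereDiff]
      simp [w, D, hcv, hπ]
      field_simp
      rw [← mul_pow]
      congr 1
      field_simp
    have := Nat.card_le_card_of_surjective _ hsurj
    simpa [Subgroup.relIndex, Subgroup.index] using this
  have h2 := sphere_relIndex_eq g hg
  rw [← h2.2] at h1
  let s' : Fin (P + 1) → d.ker := fun i =>
    ⟨⟨s i, by simpa using hs1 i⟩, (sphereDiff_eq_one_iff _ hg _).mpr (hs i)⟩
  have hfin : Finite (d.ker ⧸ f.range.subgroupOf d.ker) := Nat.finite_of_card_ne_zero h2.1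
  have := Fintype.ofFinite (d.ker ⧸ f.range.subgroupOf d.ker)
  obtain ⟨i, j, hij, he⟩ := Fintype.exists_ne_map_eq_of_card_lt
    (fun i => (s' i : d.ker ⧸ f.range.subgroupOf d.ker)) (by
      rw [Fintype.card_fin, ← Nat.card_eq_fintype_card]
      exact Nat.lt_succ_of_le h1)
  rw [eq_comm, QuotientGroup.eq, Subgroup.mem_subgroupOf] at he
  obtain ⟨w, hw⟩ := he
  refine ⟨i, j, hij, w, mem_sphere_zero_iff_norm.mp w.2, ?_⟩
  have h3 := congrArg Subtype.val hw
  rw [coe_sphereNorm] at h3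
  simp only [AlgEquiv.toRingEquiv_pow_apply] at h3
  rw [h3]
  have : s j ≠ 0 := norm_ne_zero_iff.mp (by rw [hs1]; exact one_ne_zero)
  simp [s', this]

end Herbrand

section Ambient

variable {p : ℕ} [Fact p.Prime] {Ω : Type*} [NormedField Ω]
    [IsUltrametricDist Ω] [NormedAlgebra ℚ_[p] Ω]

/-- The restriction of an automorphism to a stable finite subextension. -/
noncomputable def AlgEquiv.restrictStable (g : Ω ≃ₐ[ℚ_[p]] Ω) (L : IntermediateField ℚ_[p] Ω)
    [FiniteDimensional ℚ_[p] L] (hL : ∀ x ∈ L, g x ∈ L) : L ≃ₐ[ℚ_[p]] L :=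
  AlgEquiv.ofBijective (((g : Ω →ₐ[ℚ_[p]] Ω).comp L.val).codRestrict L.toSubalgebra
    (fun x => hL x x.2)) (Algebra.IsAlgebraic.algHom_bijective _)

variable (g : Ω ≃ₐ[ℚ_[p]] Ω) (L : IntermediateField ℚ_[p] Ω) [FiniteDimensional ℚ_[p] L]
  (hL : ∀ x ∈ L, g x ∈ L)

omit [IsUltrametricDist Ω] in
theorem AlgEquiv.coe_restrictStable (x : L) : (g.restrictStable L hL x : Ω) = g x := rfl

omit [IsUltrametricDist Ω] in
theorem AlgEquiv.coe_restrictStable_pow (i : ℕ) (x : L) :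
    ((g.restrictStable L hL ^ i) x : Ω) = (g ^ i) x := by
  induction i with
  | zero => rfl
  | succ i ih => rw [pow_succ', pow_succ', AlgEquiv.mul_apply, AlgEquiv.mul_apply,
      AlgEquiv.coe_restrictStable, ih]

omit [IsUltrametricDist Ω] in
theorem AlgEquiv.orderOf_restrictStable {N : ℕ} (hN : 0 < N) (hgN : ∀ x ∈ L, (g ^ N) x = x)
    (hord : ∀ i, 0 < i → i < N → ∃ x ∈ L, (g ^ i) x ≠ x) :
    orderOf (g.restrictStable L hL) = N := by
  rw [orderOf_eq_iff hN]
  constructor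
  · ext x
    rw [AlgEquiv.coe_restrictStable_pow, hgN x x.2]
    rfl
  · intro i hi hi0 h
    obtain ⟨x, hx, hne⟩ := hord i hi0 hi
    apply hne
    have := AlgEquiv.coe_restrictStable_pow g L hL i ⟨x, hx⟩
    rw [h] at this
    exact this.symm

variable {N : ℕ} (hN : 0 < N) (hgN : ∀ x ∈ L, (g ^ N) x = x)
    (hord : ∀ i, 0 < i → i < N → ∃ x ∈ L, (g ^ i) x ≠ x)

include hL hN hgN hord

omit [IsUltrametricDist Ω] [FiniteDimensional ℚ_[p] L] in
/-- Hilbert 90 for a stable finite subextension. -/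
theorem exists_map_div_eq_of_prod_eq_one (a : Ω) (ha : a ∈ L)
    (hprod : ∏ i ∈ Finset.range N, (g ^ i) a = 1) : ∃ c ∈ L, c ≠ 0 ∧ a = g c / c := by
  obtain ⟨c, hc, hc0, h⟩ := exists_div_eq_of_prod_eq_one (g : Ω ≃+* Ω) L.toSubfield hN hL
    (fun x hx => by rw [AlgEquiv.toRingEquiv_pow_apply]; exact hgN x hx)
    (fun i hi hiN => by
      obtain ⟨x, hx, h⟩ := hord i hi hiN
      exact ⟨x, hx, by rwa [AlgEquiv.toRingEquiv_pow_apply]⟩) a ha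
    (by simpa only [AlgEquiv.toRingEquiv_pow_apply] using hprod)
  exact ⟨c, hc, hc0, h⟩

theorem exists_prod_eq_of_unramified' (hg : ∀ x, ‖g x‖ = ‖x‖)
    (hval : ∀ z ∈ L, z ≠ 0 → ∃ a ∈ L, g a = a ∧ ‖a‖ = ‖z‖) (u : Ω) (huL : u ∈ L) (hu : g u = u)
    (hu1 : ‖u‖ = 1) : ∃ w ∈ L, ‖w‖ = 1 ∧ ∏ i ∈ Finset.range N, (g ^ i) w = u := by
  obtain ⟨w, hw, h⟩ := exists_prod_eq_of_unramified (g.restrictStable L hL) (fun x => hg x)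
    (fun z hz => by
      obtain ⟨a, haL, ha, haz⟩ := hval z z.2 (by simpa using hz)
      exact ⟨⟨a, haL⟩, Subtype.ext ha, haz⟩) ⟨u, huL⟩ (Subtype.ext hu) hu1
  refine ⟨w, w.2, hw, ?_⟩
  have := congrArg (algebraMap L Ω) h
  rw [map_prod, AlgEquiv.orderOf_restrictStable g L hL hN hgN hord] at this
  refine Eq.trans (Finset.prod_congr rfl fun i _ => ?_) this
  exact (AlgEquiv.coe_restrictStable_pow g L hL i w).symm

theorem exists_ne_eq_mul_prod_of_card' (hg : ∀ x, ‖g x‖ = ‖x‖)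
    (π ϖ : Ω) (hϖL : ϖ ∈ L) {P : ℕ} (hϖ : ϖ ≠ 0)
    (hval : ∀ z ∈ L, z ≠ 0 → ∃ i : ℤ, ‖z‖ = ‖ϖ‖ ^ i)
    (hπL : π ∈ L) (hπ : g π = π) (hπϖ : ‖π‖ = ‖ϖ‖ ^ P) (hP : 0 < P)
    (s : Fin (P + 1) → Ω) (hsL : ∀ i, s i ∈ L) (hs : ∀ i, g (s i) = s i) (hs1 : ∀ i, ‖s i‖ = 1) :
    ∃ i j, i ≠ j ∧ ∃ w ∈ L, ‖w‖ = 1 ∧ s i = s j * ∏ k ∈ Finset.range N, (g ^ k) w := by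
  obtain ⟨i, j, hij, w, hw, h⟩ := exists_ne_eq_mul_prod_of_card (g.restrictStable L hL)
    (fun x => hg x) ⟨π, hπL⟩ ⟨ϖ, hϖL⟩ (P := P) (fun h => hϖ (congrArg Subtype.val h))
    (fun z hz => hval z z.2 (by simpa using hz)) (Subtype.ext hπ) hπϖ hP
    (fun i => ⟨s i, hsL i⟩) (fun i => Subtype.ext (hs i)) hs1
  refine ⟨i, j, hij, w, w.2, hw, ?_⟩
  have := congrArg (algebraMap L Ω) h
  rw [map_mul, map_prod, AlgEquiv.orderOf_restrictStable g L hL hN hgN hord] at this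
  refine this.trans ?_
  congr 1
  exact Finset.prod_congr rfl fun i _ => AlgEquiv.coe_restrictStable_pow g L hL i w

end Ambient

section

open Finset

section CyclicNorm

variable {K Ω : Type*} [Field K] [Field Ω] [Algebra K Ω]

/-- The product of the first `P` iterated conjugates. -/
noncomputable def cycNorm (g : Ω ≃ₐ[K] Ω) (P : ℕ) (y : Ω) : Ω := ∏ i ∈ range P, (g ^ i) y

variable (g : Ω ≃ₐ[K] Ω) (P : ℕ)

theorem cycNorm_mul (x y : Ω) : cycNorm g P (x * y) = cycNorm g P x * cycNorm g P y := by
  simp [cycNorm, prod_mul_distrib]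

theorem cycNorm_div (x y : Ω) : cycNorm g P (x / y) = cycNorm g P x / cycNorm g P y := by
  simp [cycNorm, prod_div_distrib]

theorem cycNorm_one : cycNorm g P 1 = 1 := by simp [cycNorm]

theorem cycNorm_inv (x : Ω) : cycNorm g P x⁻¹ = (cycNorm g P x)⁻¹ := by
  simp [cycNorm, prod_inv_distrib]

theorem cycNorm_pow (x : Ω) (k : ℕ) : cycNorm g P (x ^ k) = cycNorm g P x ^ k := by
  simp [cycNorm, prod_pow]

theorem cycNorm_ne_zero {x : Ω} (hx : x ≠ 0) : cycNorm g P x ≠ 0 :=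
  prod_ne_zero_iff.mpr fun i _ => (map_ne_zero (g ^ i)).mpr hx

variable {g P}

theorem AlgEquiv.pow_apply_eq_self {a : Ω} (ha : g a = a) (i : ℕ) : (g ^ i) a = a := by
  induction i with
  | zero => rfl
  | succ i ih => rw [pow_succ', AlgEquiv.mul_apply, ih, ha]

theorem cycNorm_of_fixed {x : Ω} (hx : g x = x) : cycNorm g P x = x ^ P := by
  simp [cycNorm, AlgEquiv.pow_apply_eq_self hx]

theorem cycNorm_map_self {x : Ω} (hx : (g ^ P) x = x) : cycNorm g P (g x) = cycNorm g P x := by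
  rcases eq_or_ne x 0 with rfl | h0
  · rw [map_zero]
  have e2 := prod_range_succ (fun i => (g ^ i) x) P
  have e3 := prod_range_succ' (fun i => (g ^ i) x) P
  rw [e3, hx, pow_zero] at e2
  refine Eq.trans ?_ (mul_right_cancel₀ h0 e2)
  exact prod_congr rfl fun i _ => by rw [pow_succ, AlgEquiv.mul_apply]

theorem map_cycNorm_of_comm (s : Ω ≃ₐ[K] Ω) {x : Ω}
    (h : ∀ i : ℕ, s ((g ^ i) x) = (g ^ i) (s x)) : s (cycNorm g P x) = cycNorm g P (s x) := by
  simp only [cycNorm, map_prod, h]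

theorem map_self_cycNorm {x : Ω} (hx : (g ^ P) x = x) : g (cycNorm g P x) = cycNorm g P x := by
  rw [map_cycNorm_of_comm g (fun i => by
    rw [← AlgEquiv.mul_apply, ← AlgEquiv.mul_apply, ← pow_succ, ← pow_succ']), cycNorm_map_self hx]

theorem cycNorm_map_div_self {x : Ω} (hx : (g ^ P) x = x) (h0 : x ≠ 0) :
    cycNorm g P (g x / x) = 1 := by
  rw [cycNorm_div, cycNorm_map_self hx, div_self (cycNorm_ne_zero g P h0)]

theorem cycNorm_mem (L : IntermediateField K Ω) (hL : ∀ x ∈ L, g x ∈ L) {x : Ω} (hx : x ∈ L) :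
    cycNorm g P x ∈ L := by
  have : ∀ i : ℕ, (g ^ i) x ∈ L := by
    intro i
    induction i with
    | zero => exact hx
    | succ i ih => rw [pow_succ', AlgEquiv.mul_apply]; exact hL _ ih
  exact L.prod_mem fun i _ => this i

theorem pow_mul_apply_eq_self {x : Ω} (hx : (g ^ P) x = x) (j : ℕ) : (g ^ (P * j)) x = x := by
  rw [pow_mul]; exact AlgEquiv.pow_apply_eq_self hx j

theorem pow_mod_apply {x : Ω} (hx : (g ^ P) x = x) (j : ℕ) : (g ^ (j % P)) x = (g ^ j) x := by
  conv_rhs => rw [← Nat.mod_add_div j P, pow_add, AlgEquiv.mul_apply, pow_mul_apply_eq_self hx]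

theorem cycNorm_pow_left {x : Ω} (hx : (g ^ P) x = x) (hP : 0 < P) {k : ℕ} (hk : k.Coprime P) :
    cycNorm (g ^ k) P x = cycNorm g P x := by
  have hinj : Set.InjOn (fun j => k * j % P) (range P : Set ℕ) := by
    intro i hi j hj hij
    rw [coe_range, Set.mem_Iio] at hi hj
    have : i ≡ j [MOD P] := Nat.ModEq.cancel_left_of_coprime hk.symm.gcd_eq_one hij
    rwa [Nat.ModEq, Nat.mod_eq_of_lt hi, Nat.mod_eq_of_lt hj] at this
  have himg : (range P).image (fun j => k * j % P) = range P := by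
    refine eq_of_subset_of_card_le ?_ (by rw [card_image_of_injOn hinj])
    intro j hj
    obtain ⟨i, -, rfl⟩ := mem_image.mp hj
    exact mem_range.mpr (Nat.mod_lt _ hP)
  unfold cycNorm
  conv_rhs => rw [← himg, prod_image hinj]
  refine prod_congr rfl fun i _ => ?_
  rw [pow_mod_apply hx, ← pow_mul]

end CyclicNorm

/-- The elements of `L` fixed by `g`. -/
def IntermediateField.fixedIn {K Ω : Type*} [Field K] [Field Ω] [Algebra K Ω]
    (L : IntermediateField K Ω) (g : Ω ≃ₐ[K] Ω) : IntermediateField K Ω where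
  carrier := {x | x ∈ L ∧ g x = x}
  mul_mem' ha hb := ⟨L.mul_mem ha.1 hb.1, by rw [map_mul, ha.2, hb.2]⟩
  add_mem' ha hb := ⟨L.add_mem ha.1 hb.1, by rw [map_add, ha.2, hb.2]⟩
  algebraMap_mem' r := ⟨L.algebraMap_mem r, g.commutes r⟩
  inv_mem' x hx := ⟨L.inv_mem hx.1, by rw [map_inv₀, hx.2]⟩

instance IntermediateField.finiteDimensional_fixedIn {K Ω : Type*} [Field K] [Field Ω]
    [Algebra K Ω] (L : IntermediateField K Ω) (g : Ω ≃ₐ[K] Ω) [FiniteDimensional K L] :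
    FiniteDimensional K (L.fixedIn g) :=
  have h : L.fixedIn g ≤ L := fun _ hx => hx.1
  FiniteDimensional.of_injective (IntermediateField.inclusion h).toLinearMap
    (IntermediateField.inclusion_injective h)

/-- Two commuting automorphisms `τ`, `φ` of order `P` of a local field `L`, such that `L` is
unramified over the fixed field of `φ` and totally ramified over the fixed field of `τ`. -/
structure BicyclicExtension {p : ℕ} [Fact p.Prime] {Ω : Type*} [NormedField Ω]
    [NormedAlgebra ℚ_[p] Ω] (L : IntermediateField ℚ_[p] Ω) (τ φ : Ω ≃ₐ[ℚ_[p]] Ω) (P : ℕ)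
    (ϖ π : Ω) : Prop where
  pos : 0 < P
  norm_map : ∀ (s : Ω ≃ₐ[ℚ_[p]] Ω) (x : Ω), ‖s x‖ = ‖x‖
  comm : ∀ x ∈ L, φ (τ x) = τ (φ x)
  map_τ : ∀ x ∈ L, τ x ∈ L
  map_φ : ∀ x ∈ L, φ x ∈ L
  pow_τ : ∀ x ∈ L, (τ ^ P) x = x
  pow_φ : ∀ x ∈ L, (φ ^ P) x = x
  exists_τ : ∀ i, 0 < i → i < P → ∃ x ∈ L, φ x = x ∧ (τ ^ i) x ≠ x
  exists_φ : ∀ i, 0 < i → i < P → ∃ x ∈ L, τ x = x ∧ (φ ^ i) x ≠ x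
  mem_ϖ : ϖ ∈ L
  fixed_ϖ : φ ϖ = ϖ
  ne_zero : ϖ ≠ 0
  norm_lt : ‖ϖ‖ < 1
  norm_eq : ∀ z ∈ L, z ≠ 0 → ∃ i : ℤ, ‖z‖ = ‖ϖ‖ ^ i
  norm_eq_of_fixed : ∀ z ∈ L, τ z = z → z ≠ 0 → ∃ i : ℤ, ‖z‖ = ‖ϖ‖ ^ (P * i)
  mem_π : π ∈ L
  τ_π : τ π = π
  φ_π : φ π = π
  norm_π : ‖π‖ = ‖ϖ‖ ^ P

end

section

open Finset IntermediateField

namespace BicyclicExtension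

variable {p : ℕ} [Fact p.Prime] {Ω : Type*} [NormedField Ω] [IsUltrametricDist Ω]
  [NormedAlgebra ℚ_[p] Ω] {L : IntermediateField ℚ_[p] Ω} [FiniteDimensional ℚ_[p] L]
  {τ φ : Ω ≃ₐ[ℚ_[p]] Ω} {P : ℕ} {ϖ π : Ω} (h : BicyclicExtension L τ φ P ϖ π)

/-- The relation "`c` has reciprocity invariant `i`". -/
def Rel (_ : BicyclicExtension L τ φ P ϖ π) (c : Ω) (i : ℤ) : Prop :=
  ∃ y ∈ L, ‖y‖ = 1 ∧ ∃ z ∈ L, z ≠ 0 ∧ cycNorm τ P y = c ∧ φ y / y = τ z / z ∧ ‖z‖ = ‖ϖ‖ ^ i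

/-- The units fixed by both automorphisms. -/
def IsBaseUnit (_ : BicyclicExtension L τ φ P ϖ π) (c : Ω) : Prop :=
  c ∈ L ∧ τ c = c ∧ φ c = c ∧ ‖c‖ = 1

include h

omit [IsUltrametricDist Ω] [FiniteDimensional ℚ_[p] L] in
theorem zpow_inj {i j : ℤ} (hij : ‖ϖ‖ ^ i = ‖ϖ‖ ^ j) : i = j :=
  zpow_right_injective₀ (norm_pos_iff.mpr h.ne_zero) h.norm_lt.ne hij

omit [IsUltrametricDist Ω] [FiniteDimensional ℚ_[p] L] in
theorem ne_zero_of_norm {y : Ω} (hy : ‖y‖ = 1) : y ≠ 0 :=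
  norm_ne_zero_iff.mp (by rw [hy]; exact one_ne_zero)

omit [IsUltrametricDist Ω] [FiniteDimensional ℚ_[p] L] in
theorem π_ne_zero : π ≠ 0 := by
  rw [← norm_ne_zero_iff, h.norm_π]
  exact pow_ne_zero _ (norm_ne_zero_iff.mpr h.ne_zero)

omit [IsUltrametricDist Ω] [FiniteDimensional ℚ_[p] L] in
theorem Rel.mul {c c' : Ω} {i i' : ℤ} (hc : h.Rel c i) (hc' : h.Rel c' i') :
    h.Rel (c * c') (i + i') := by
  obtain ⟨y, hy, hy1, z, hz, hz0, h1, h2, h3⟩ := hc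
  obtain ⟨y', hy', hy1', z', hz', hz0', h1', h2', h3'⟩ := hc'
  refine ⟨y * y', L.mul_mem hy hy', by rw [norm_mul, hy1, hy1', one_mul], z * z', L.mul_mem hz hz',
    mul_ne_zero hz0 hz0', by rw [cycNorm_mul, h1, h1'], ?_, ?_⟩
  · rw [map_mul, map_mul, mul_div_mul_comm, mul_div_mul_comm, h2, h2']
  · rw [norm_mul, h3, h3', zpow_add₀ (norm_ne_zero_iff.mpr h.ne_zero)]

omit [IsUltrametricDist Ω] [FiniteDimensional ℚ_[p] L] in
theorem Rel.inv {c : Ω} {i : ℤ} (hc : h.Rel c i) : h.Rel c⁻¹ (-i) := by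
  obtain ⟨y, hy, hy1, z, hz, hz0, h1, h2, h3⟩ := hc
  refine ⟨y⁻¹, L.inv_mem hy, by rw [norm_inv, hy1, inv_one], z⁻¹, L.inv_mem hz,
    inv_ne_zero hz0, by rw [cycNorm_inv, h1], ?_, ?_⟩
  · rw [map_inv₀, map_inv₀, ← inv_div_inv, inv_inv, inv_inv, ← inv_div, h2, inv_div, inv_div_inv]
  · rw [norm_inv, h3, zpow_neg]

omit [IsUltrametricDist Ω] [FiniteDimensional ℚ_[p] L] in
theorem Rel.pow {c : Ω} {i : ℤ} (hc : h.Rel c i) (k : ℕ) : h.Rel (c ^ k) (k * i) := by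
  induction k with
  | zero => exact ⟨1, L.one_mem, norm_one, 1, L.one_mem, one_ne_zero, by simp [cycNorm_one],
      by simp, by simp⟩
  | succ k ih =>
    rw [pow_succ]
    convert Rel.mul h ih hc using 1
    push_cast; ring

omit [IsUltrametricDist Ω] [FiniteDimensional ℚ_[p] L] in
theorem rel_cycNorm {w : Ω} (hw : w ∈ L) (hw1 : ‖w‖ = 1) (hφ : φ w = w) :
    h.Rel (cycNorm τ P w) 0 :=
  ⟨w, hw, hw1, 1, L.one_mem, one_ne_zero, rfl, by
    rw [hφ, div_self (h.ne_zero_of_norm hw1), map_one, div_one], by simp⟩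

omit [IsUltrametricDist Ω] [FiniteDimensional ℚ_[p] L] in
theorem dvd_of_rel_one {i : ℤ} (hi : h.Rel 1 i) : (P : ℤ) ∣ i := by
  obtain ⟨y, hy, hy1, z, hz, hz0, h1, h2, h3⟩ := hi
  obtain ⟨w, hw, hw0, rfl⟩ := exists_map_div_eq_of_prod_eq_one τ L h.map_τ h.pos h.pow_τ
    (fun i hi hi' => by
      obtain ⟨x, hx, -, hne⟩ := h.exists_τ i hi hi'
      exact ⟨x, hx, hne⟩) y hy h1
  have hφw := h.map_φ w hw
  have h0 : φ w ≠ 0 := (map_ne_zero φ).mpr hw0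
  have h0' : τ w ≠ 0 := (map_ne_zero τ).mpr hw0
  have h0'' : τ (φ w) ≠ 0 := (map_ne_zero τ).mpr h0
  have hfix : τ (z / (φ w / w)) = z / (φ w / w) := by
    rw [map_div₀, h.comm w hw] at h2
    rw [map_div₀, map_div₀]
    have hτz : τ z = z * (τ (φ w) / φ w / (τ w / w)) := by rw [h2]; field_simp
    rw [hτz]
    field_simp
  obtain ⟨j, hj⟩ := h.norm_eq_of_fixed _ (L.div_mem hz (L.div_mem hφw hw)) hfix
    (div_ne_zero hz0 (div_ne_zero h0 hw0))
  rw [norm_div, norm_div, h.norm_map, div_self (norm_ne_zero_iff.mpr hw0), div_one, h3] at hj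
  exact ⟨j, h.zpow_inj hj⟩

theorem exists_cycNorm_φ_eq {u : Ω} (hu : h.IsBaseUnit u) :
    ∃ f ∈ L, τ f = f ∧ ‖f‖ = 1 ∧ cycNorm φ P f = u := by
  obtain ⟨huL, huτ, huφ, hu1⟩ := hu
  obtain ⟨w, hw, hw1, hwu⟩ := exists_prod_eq_of_unramified' φ (L.fixedIn τ)
    (fun x hx => ⟨h.map_φ x hx.1, by rw [← h.comm x hx.1, hx.2]⟩) h.pos (fun x hx => h.pow_φ x hx.1)
    (fun i hi hi' => by
      obtain ⟨x, hx, hx', hne⟩ := h.exists_φ i hi hi'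
      exact ⟨x, ⟨hx, hx'⟩, hne⟩) (h.norm_map φ)
    (fun z hz hz0 => by
      obtain ⟨i, hi⟩ := h.norm_eq_of_fixed z hz.1 hz.2 hz0
      refine ⟨π ^ i, ⟨zpow_mem h.mem_π i, by rw [map_zpow₀, h.τ_π]⟩, by rw [map_zpow₀, h.φ_π], ?_⟩
      rw [norm_zpow, h.norm_π, hi, zpow_mul, zpow_natCast]) u ⟨huL, huτ⟩ huφ hu1
  exact ⟨w, hw.1, hw.2, hw1, hwu⟩

omit [IsUltrametricDist Ω] [FiniteDimensional ℚ_[p] L] in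
theorem hilbert90_φ {a : Ω} (ha : a ∈ L) (hN : cycNorm φ P a = 1) :
    ∃ c ∈ L, c ≠ 0 ∧ a = φ c / c :=
  exists_map_div_eq_of_prod_eq_one φ L h.map_φ h.pos h.pow_φ
    (fun i hi hi' => by
      obtain ⟨x, hx, -, hne⟩ := h.exists_φ i hi hi'
      exact ⟨x, hx, hne⟩) a ha hN

omit [IsUltrametricDist Ω] [FiniteDimensional ℚ_[p] L] in
theorem comm_pow {x : Ω} (hx : x ∈ L) (i : ℕ) : φ ((τ ^ i) x) = (τ ^ i) (φ x) := by
  induction i generalizing x with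
  | zero => rfl
  | succ i ih =>
    rw [pow_succ, AlgEquiv.mul_apply, AlgEquiv.mul_apply, ih (h.map_τ x hx), h.comm x hx]

omit [IsUltrametricDist Ω] [FiniteDimensional ℚ_[p] L] in
theorem comm_pow' {x : Ω} (hx : x ∈ L) (i : ℕ) : τ ((φ ^ i) x) = (φ ^ i) (τ x) := by
  induction i generalizing x with
  | zero => rfl
  | succ i ih =>
    rw [pow_succ, AlgEquiv.mul_apply, AlgEquiv.mul_apply, ih (h.map_φ x hx), h.comm x hx]

theorem exists_cycNorm_eq_of_rel {c : Ω} {i : ℤ} (hc : h.Rel c i) (hi : (P : ℤ) ∣ i) :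
    ∃ y ∈ L, φ y = y ∧ ‖y‖ = 1 ∧ cycNorm τ P y = c := by
  obtain ⟨y, hy, hy1, z', hz', hz0', h1, h2', h3'⟩ := hc
  obtain ⟨k, rfl⟩ := hi
  have hy0 := h.ne_zero_of_norm hy1
  have hπ0 := h.π_ne_zero
  obtain ⟨z, hz, hz1, h2⟩ : ∃ z ∈ L, ‖z‖ = 1 ∧ φ y / y = τ z / z := by
    refine ⟨z' / π ^ k, L.div_mem hz' (zpow_mem h.mem_π k), ?_, ?_⟩
    · rw [norm_div, norm_zpow, h3', h.norm_π, zpow_mul, zpow_natCast]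
      exact div_self (zpow_ne_zero _ (pow_ne_zero _ (norm_ne_zero_iff.mpr h.ne_zero)))
    · rw [h2', map_div₀, map_zpow₀, h.τ_π]
      have := zpow_ne_zero k hπ0
      field_simp
  have hz0 := h.ne_zero_of_norm hz1
  have hτz : τ z = z * (φ y / y) := by rw [h2]; field_simp
  obtain ⟨f, hf, hfτ, hf1, hfN⟩ := h.exists_cycNorm_φ_eq (u := cycNorm φ P z)
    ⟨cycNorm_mem L h.map_φ hz, by
      rw [map_cycNorm_of_comm τ (h.comm_pow' hz), hτz, cycNorm_mul,
        cycNorm_map_div_self (h.pow_φ y hy) hy0, mul_one], map_self_cycNorm (h.pow_φ z hz), by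
      rw [cycNorm, norm_prod]
      exact prod_eq_one fun i _ => by rw [h.norm_map, hz1]⟩
  have hf0 := h.ne_zero_of_norm hf1
  obtain ⟨w, hw, hw0, hwz⟩ := h.hilbert90_φ (L.div_mem hz hf)
    (by rw [cycNorm_div, hfN, div_self (cycNorm_ne_zero _ _ hz0)])
  have hτw0 : τ w ≠ 0 := (map_ne_zero τ).mpr hw0
  refine ⟨y * (w / τ w), L.mul_mem hy (L.div_mem hw (h.map_τ w hw)), ?_, ?_, ?_⟩
  · have e1 : τ (z / f) / (z / f) = φ y / y := by
      rw [h2, map_div₀, hfτ]; field_simp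
    rw [hwz, map_div₀, ← h.comm w hw] at e1
    have h4 : φ (τ w) ≠ 0 := (map_ne_zero φ).mpr hτw0
    have h5 : φ w ≠ 0 := (map_ne_zero φ).mpr hw0
    have e2 : φ y = y * (φ (τ w) / τ w / (φ w / w)) := by rw [e1]; field_simp
    rw [map_mul, map_div₀, e2]
    field_simp
  · rw [norm_mul, norm_div, h.norm_map, hy1, div_self (norm_ne_zero_iff.mpr hw0), one_mul]
  · rw [cycNorm_mul, h1, cycNorm_div, cycNorm_map_self (h.pow_τ w hw),
      div_self (cycNorm_ne_zero _ _ hw0), mul_one]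

omit [IsUltrametricDist Ω] [FiniteDimensional ℚ_[p] L] in
theorem Rel.isBaseUnit {c : Ω} {i : ℤ} (hc : h.Rel c i) : h.IsBaseUnit c := by
  obtain ⟨y, hy, hy1, z, hz, hz0, rfl, h2, h3⟩ := hc
  have hy0 := h.ne_zero_of_norm hy1
  refine ⟨cycNorm_mem L h.map_τ hy, map_self_cycNorm (h.pow_τ y hy), ?_, ?_⟩
  · have e : φ y = y * (τ z / z) := by rw [← h2]; field_simp
    rw [map_cycNorm_of_comm φ (h.comm_pow hy), e, cycNorm_mul,
      cycNorm_map_div_self (h.pow_τ z hz) hz0, mul_one]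
  · rw [cycNorm, norm_prod]
    exact prod_eq_one fun i _ => by rw [h.norm_map, hy1]

theorem exists_rel_one : ∃ c, h.Rel c 1 := by
  have hϖn := norm_ne_zero_iff.mpr h.ne_zero
  obtain ⟨f, hf, hf1, hfN⟩ := exists_prod_eq_of_unramified' φ L h.map_φ h.pos h.pow_φ
    (fun i hi hi' => by
      obtain ⟨x, hx, -, hne⟩ := h.exists_φ i hi hi'
      exact ⟨x, hx, hne⟩) (h.norm_map φ)
    (fun z hz hz0 => by
      obtain ⟨i, hi⟩ := h.norm_eq z hz hz0
      exact ⟨ϖ ^ i, zpow_mem h.mem_ϖ i, by rw [map_zpow₀, h.fixed_ϖ], by rw [norm_zpow, hi]⟩)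
    (π / ϖ ^ P) (L.div_mem h.mem_π (pow_mem h.mem_ϖ P))
    (by rw [map_div₀, map_pow, h.φ_π, h.fixed_ϖ])
    (by rw [norm_div, norm_pow, h.norm_π, div_self (pow_ne_zero _ hϖn)])
  have hf0 := h.ne_zero_of_norm hf1
  have hz0 := mul_ne_zero h.ne_zero hf0
  have hz := L.mul_mem h.mem_ϖ hf
  have hN : cycNorm φ P (ϖ * f) = π := by
    rw [cycNorm_mul, cycNorm_of_fixed h.fixed_ϖ]
    rw [show cycNorm φ P f = π / ϖ ^ P from hfN]
    have := pow_ne_zero P h.ne_zero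
    field_simp
  obtain ⟨y, hy, hy0, hyz⟩ := h.hilbert90_φ (L.div_mem (h.map_τ _ hz) hz) (by
    rw [cycNorm_div, ← map_cycNorm_of_comm τ (h.comm_pow' hz), hN, h.τ_π, div_self h.π_ne_zero])
  obtain ⟨k, hk⟩ := h.norm_eq y hy hy0
  have hϖk := zpow_ne_zero k h.ne_zero
  refine ⟨cycNorm τ P (y / ϖ ^ k), y / ϖ ^ k, L.div_mem hy (zpow_mem h.mem_ϖ k), ?_, ϖ * f, hz, hz0,
    rfl, ?_, ?_⟩
  · rw [norm_div, norm_zpow, hk, div_self (zpow_ne_zero _ hϖn)]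
  · rw [hyz, map_div₀, map_zpow₀, h.fixed_ϖ]
    field_simp
  · rw [norm_mul, hf1, mul_one, zpow_one]

theorem exists_rel {c : Ω} (hc : h.IsBaseUnit c) : ∃ i, h.Rel c i := by
  obtain ⟨c0, hc0⟩ := h.exists_rel_one
  have hb := Rel.isBaseUnit h hc0
  let s : Fin (P + 1) → Ω := Fin.snoc (fun j : Fin P => c0 ^ (j : ℕ)) c
  have hs : ∀ i, h.IsBaseUnit (s i) := by
    intro i
    refine Fin.lastCases ?_ (fun j => ?_) i
    · simpa [s] using hc
    · simp only [s, Fin.snoc_castSucc]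
      exact ⟨pow_mem hb.1 _, by rw [map_pow, hb.2.1], by rw [map_pow, hb.2.2.1],
        by rw [norm_pow, hb.2.2.2, one_pow]⟩
  obtain ⟨i, j, hij, w, hw, hw1, hsw⟩ := exists_ne_eq_mul_prod_of_card' τ (L.fixedIn φ)
    (fun x hx => ⟨h.map_τ x hx.1, by rw [h.comm x hx.1, hx.2]⟩) h.pos (fun x hx => h.pow_τ x hx.1)
    (fun i hi hi' => by
      obtain ⟨x, hx, hx', hne⟩ := h.exists_τ i hi hi'
      exact ⟨x, ⟨hx, hx'⟩, hne⟩) (h.norm_map τ) π ϖ ⟨h.mem_ϖ, h.fixed_ϖ⟩ h.ne_zero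
    (fun z hz hz0 => h.norm_eq z hz.1 hz0) ⟨h.mem_π, h.φ_π⟩ h.τ_π h.norm_π h.pos s
    (fun i => ⟨(hs i).1, (hs i).2.2.1⟩) (fun i => (hs i).2.1) (fun i => (hs i).2.2.2)
  have hw' := h.rel_cycNorm hw.1 hw1 hw.2
  change s i = s j * cycNorm τ P w at hsw
  have hc0p := fun k : ℕ => Rel.pow h hc0 k
  revert hij hsw
  refine Fin.lastCases ?_ (fun i => ?_) i <;> refine Fin.lastCases ?_ (fun j => ?_) j
  · intro hij; exact absurd rfl hij
  · intro _ hsw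
    simp only [s, Fin.snoc_castSucc, Fin.snoc_last] at hsw
    rw [hsw]
    exact ⟨_, Rel.mul h (hc0p j) hw'⟩
  · intro _ hsw
    simp only [s, Fin.snoc_castSucc, Fin.snoc_last] at hsw
    have hN0 := cycNorm_ne_zero τ P (h.ne_zero_of_norm hw1)
    have : c = c0 ^ (i : ℕ) * (cycNorm τ P w)⁻¹ := by rw [hsw]; field_simp
    rw [this]
    exact ⟨_, Rel.mul h (hc0p i) (Rel.inv h hw')⟩
  · intro hij hsw
    simp only [s, Fin.snoc_castSucc] at hsw
    have hN0 := cycNorm_ne_zero τ P (h.ne_zero_of_norm hw1)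
    have hcj : c0 ^ (j : ℕ) ≠ 0 := pow_ne_zero _ (h.ne_zero_of_norm hb.2.2.2)
    have h1 := Rel.mul h (hc0p i) (Rel.inv h (Rel.mul h (hc0p j) hw'))
    rw [hsw, mul_inv_cancel₀ (mul_ne_zero hcj hN0)] at h1
    have h2 := h.dvd_of_rel_one h1
    exfalso
    apply hij
    have h3 : ((i : ℕ) : ℤ) ≡ (j : ℕ) [ZMOD P] := by
      refine (Int.emod_emod_of_dvd _ (dvd_refl _)).symm.trans ?_
      rw [Int.emod_emod_of_dvd _ (dvd_refl _)]
      refine Int.ModEq.symm ?_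
      rw [Int.modEq_iff_dvd]
      convert h2 using 1
      ring
    rw [Int.natCast_modEq_iff, Nat.ModEq, Nat.mod_eq_of_lt i.2, Nat.mod_eq_of_lt j.2] at h3
    exact congrArg Fin.castSucc (Fin.ext h3)

omit [IsUltrametricDist Ω] [FiniteDimensional ℚ_[p] L] in
theorem Rel.map {c : Ω} {i : ℤ} (hc : h.Rel c i) (s : Ω ≃ₐ[ℚ_[p]] Ω) {k : ℕ} (hk : k.Coprime P)
    (hsL : ∀ x ∈ L, s x ∈ L) (hsφ : ∀ x ∈ L, s (φ x) = φ (s x))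
    (hsτ : ∀ x ∈ L, s (τ x) = (τ ^ k) (s x)) : h.Rel (s c) (k * i) := by
  obtain ⟨y, hy, hy1, z, hz, hz0, rfl, h2, h3⟩ := hc
  have hpow : ∀ j : ℕ, ∀ x ∈ L, s ((τ ^ j) x) = ((τ ^ k) ^ j) (s x) := by
    intro j
    induction j with
    | zero => intro x _; rfl
    | succ j ih =>
      intro x hx
      rw [pow_succ, pow_succ, AlgEquiv.mul_apply, AlgEquiv.mul_apply, ih _ (h.map_τ x hx), hsτ x hx]
  refine ⟨s y, hsL y hy, by rw [h.norm_map, hy1], cycNorm τ k (s z),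
    cycNorm_mem L h.map_τ (hsL z hz), cycNorm_ne_zero _ _ ((map_ne_zero s).mpr hz0), ?_, ?_, ?_⟩
  · rw [← cycNorm_pow_left (h.pow_τ _ (hsL y hy)) h.pos hk]
    simp only [cycNorm, map_prod]
    exact prod_congr rfl fun j _ => (hpow j y hy).symm
  · rw [← hsφ y hy, ← map_div₀, h2, map_div₀, hsτ z hz]
    have hsz : s z ≠ 0 := (map_ne_zero s).mpr hz0
    have hc0 := cycNorm_ne_zero τ k hsz
    rw [div_eq_div_iff hsz hc0, mul_comm]
    have e2 := prod_range_succ (fun i => (τ ^ i) (s z)) k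
    have e3 := prod_range_succ' (fun i => (τ ^ i) (s z)) k
    rw [e2] at e3
    simp only [cycNorm, map_prod]
    refine e3.trans ?_
    congr 1
    exact prod_congr rfl fun i _ => by rw [pow_succ', AlgEquiv.mul_apply]
  · rw [cycNorm, norm_prod]
    simp only [h.norm_map, h3]
    rw [prod_const, card_range, ← zpow_natCast, ← zpow_mul, mul_comm]

/-- The reciprocity invariant as a function. -/
theorem exists_reciprocity : ∃ R : Ω → ZMod P,
    (∀ a b, h.IsBaseUnit a → h.IsBaseUnit b → R (a * b) = R a + R b) ∧
    (∀ u, h.IsBaseUnit u → (R u = 0 ↔ ∃ y ∈ L, φ y = y ∧ cycNorm τ P y = u)) ∧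
    (∃ c, h.IsBaseUnit c ∧ R c = 1) ∧
    (∀ (s : Ω ≃ₐ[ℚ_[p]] Ω) (k : ℕ), k.Coprime P → (∀ x ∈ L, s x ∈ L) →
      (∀ x ∈ L, s (φ x) = φ (s x)) → (∀ x ∈ L, s (τ x) = (τ ^ k) (s x)) →
      ∀ u, h.IsBaseUnit u → R (s u) = k * R u) := by
  classical
  let R : Ω → ZMod P := fun c => if hc : ∃ i, h.Rel c i then ((hc.choose : ℤ) : ZMod P) else 0
  have hR : ∀ c i, h.Rel c i → R c = ((i : ℤ) : ZMod P) := by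
    intro c i hc
    have hex : ∃ i, h.Rel c i := ⟨i, hc⟩
    have hR' : R c = ((hex.choose : ℤ) : ZMod P) := dif_pos hex
    have h1 := Rel.mul h hex.choose_spec (Rel.inv h hc)
    rw [mul_inv_cancel₀ (h.ne_zero_of_norm (Rel.isBaseUnit h hc).2.2.2)] at h1
    have h2 := (ZMod.intCast_zmod_eq_zero_iff_dvd _ P).mpr (h.dvd_of_rel_one h1)
    push_cast at h2
    rw [hR']
    linear_combination h2
  refine ⟨R, ?_, ?_, ?_, ?_⟩
  · intro a b ha hb
    obtain ⟨i, hi⟩ := h.exists_rel ha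
    obtain ⟨j, hj⟩ := h.exists_rel hb
    rw [hR _ _ hi, hR _ _ hj, hR _ _ (Rel.mul h hi hj)]
    push_cast; rfl
  · intro u hu
    obtain ⟨i, hi⟩ := h.exists_rel hu
    rw [hR _ _ hi]
    constructor
    · intro h0
      obtain ⟨y, hy, hy1, -, hy2⟩ := h.exists_cycNorm_eq_of_rel hi
        ((ZMod.intCast_zmod_eq_zero_iff_dvd _ P).mp h0)
      exact ⟨y, hy, hy1, hy2⟩
    · rintro ⟨y, hy, hφ, rfl⟩
      have hy1 : ‖y‖ = 1 := by
        have := hu.2.2.2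
        rw [cycNorm, norm_prod] at this
        simp only [h.norm_map, prod_const, card_range] at this
        exact (pow_eq_one_iff_of_nonneg (norm_nonneg _) h.pos.ne').mp this
      rw [← hR _ _ hi, hR _ _ (h.rel_cycNorm hy hy1 hφ)]
      simp
  · obtain ⟨c, hc⟩ := h.exists_rel_one
    exact ⟨c, Rel.isBaseUnit h hc, by rw [hR _ _ hc]; simp⟩
  · intro s k hk hsL hsφ hsτ u hu
    obtain ⟨i, hi⟩ := h.exists_rel hu
    rw [hR _ _ hi, hR _ _ (Rel.map h hi s hk hsL hsφ hsτ)]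
    push_cast; rfl

end BicyclicExtension

end

section Lev

variable {F : Type*} [Field F] (v : AddValuation F (WithTop ℤ))

/-- The additive subgroup of elements of valuation at least `j`. -/
def AddValuation.lev (j : ℤ) : AddSubgroup F where
  carrier := {a | (j : WithTop ℤ) ≤ v a}
  add_mem' ha hb := v.map_le_add ha hb
  zero_mem' := by simp
  neg_mem' {a} ha := by
    change (j : WithTop ℤ) ≤ v (-a)
    rw [v.map_neg]
    exact ha

namespace AddValuation

variable {v}

theorem mem_lev {j : ℤ} {a : F} : a ∈ v.lev j ↔ (j : WithTop ℤ) ≤ v a := Iff.rfl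

theorem exists_eq_int {a : F} (ha : a ≠ 0) : ∃ k : ℤ, v a = k := by
  obtain ⟨k, hk⟩ := WithTop.ne_top_iff_exists.mp ((v.ne_top_iff).mpr ha)
  exact ⟨k, hk.symm⟩

theorem ne_zero_of_eq_int {a : F} {k : ℤ} (ha : v a = k) : a ≠ 0 := by
  rintro rfl
  rw [v.map_zero] at ha
  exact WithTop.top_ne_coe ha

theorem mem_lev_iff_of_eq {j k : ℤ} {a : F} (ha : v a = k) : a ∈ v.lev j ↔ j ≤ k := by
  rw [mem_lev, ha]
  exact WithTop.coe_le_coe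

theorem lev_mono {i j : ℤ} (h : i ≤ j) {a : F} (ha : a ∈ v.lev j) : a ∈ v.lev i :=
  le_trans (WithTop.coe_le_coe.mpr h) (mem_lev.mp ha)

theorem mul_mem_lev {i j : ℤ} {a b : F} (ha : a ∈ v.lev i) (hb : b ∈ v.lev j) :
    a * b ∈ v.lev (i + j) := by
  rw [mem_lev, v.map_mul, WithTop.coe_add]
  exact add_le_add ha hb

theorem one_mem_lev : (1 : F) ∈ v.lev 0 := by
  rw [mem_lev, v.map_one]; rfl

theorem map_eq_mul {a b : F} {i j : ℤ} (ha : v a = i) (hb : v b = j) :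
    v (a * b) = ((i + j : ℤ) : WithTop ℤ) := by
  rw [v.map_mul, ha, hb, WithTop.coe_add]

theorem map_eq_inv {a : F} {i : ℤ} (ha : v a = i) : v a⁻¹ = ((-i : ℤ) : WithTop ℤ) := by
  obtain ⟨k, hk⟩ := exists_eq_int (v := v) (inv_ne_zero (ne_zero_of_eq_int ha))
  have h := map_eq_mul ha hk
  rw [mul_inv_cancel₀ (ne_zero_of_eq_int ha), v.map_one] at h
  have : (0 : ℤ) = i + k := WithTop.coe_injective h
  rw [hk]
  congr 1
  omega

theorem map_eq_div {a b : F} {i j : ℤ} (ha : v a = i) (hb : v b = j) :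
    v (a / b) = ((i - j : ℤ) : WithTop ℤ) := by
  rw [div_eq_mul_inv, sub_eq_add_neg]
  exact map_eq_mul ha (map_eq_inv hb)

theorem map_eq_pow {a : F} {i : ℤ} (ha : v a = i) (k : ℕ) :
    v (a ^ k) = ((k * i : ℤ) : WithTop ℤ) := by
  induction k with
  | zero => simp
  | succ k ih =>
    rw [pow_succ, map_eq_mul ih ha]
    congr 1
    push_cast
    ring

theorem pow_mem_lev {i : ℤ} {a : F} (ha : a ∈ v.lev i) (k : ℕ) : a ^ k ∈ v.lev (k * i) := by
  induction k with
  | zero => simpa using one_mem_lev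
  | succ k ih =>
    rw [pow_succ]
    have := mul_mem_lev ih ha
    push_cast
    rwa [add_mul, one_mul]

theorem mul_mem_lev_zero {j : ℤ} {a b : F} (ha : a ∈ v.lev 0) (hb : b ∈ v.lev j) :
    a * b ∈ v.lev j := by
  simpa using mul_mem_lev ha hb

theorem div_mem_lev {i j : ℤ} {a b : F} (ha : a ∈ v.lev i) (hb : v b = j) :
    a / b ∈ v.lev (i - j) := by
  rw [div_eq_mul_inv, sub_eq_add_neg]
  exact mul_mem_lev ha ((mem_lev_iff_of_eq (map_eq_inv hb)).mpr le_rfl)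

theorem natCast_mem_lev (k : ℕ) : (k : F) ∈ v.lev 0 := by
  induction k with
  | zero => simp
  | succ k ih => rw [Nat.cast_succ]; exact (v.lev 0).add_mem ih one_mem_lev

theorem map_add_eq {a b : F} {k : ℤ} (ha : v a = k) (hb : b ∈ v.lev (k + 1)) :
    v (a + b) = k := by
  rw [← ha]
  apply v.map_add_eq_of_lt_left
  rw [ha]
  exact lt_of_lt_of_le (WithTop.coe_lt_coe.mpr (lt_add_one k)) hb

theorem map_eq_zero_of_sub_one_mem {a : F} {j : ℤ} (hj : 0 < j) (ha : a - 1 ∈ v.lev j) :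
    v a = (0 : ℤ) := by
  have := map_add_eq (v := v) (a := 1) (k := 0) v.map_one
    (lev_mono (by omega) ha)
  rwa [add_sub_cancel] at this

theorem mem_lev_zero_of_sub_one_mem {a : F} {j : ℤ} (hj : 0 < j) (ha : a - 1 ∈ v.lev j) :
    a ∈ v.lev 0 :=
  (mem_lev_iff_of_eq (map_eq_zero_of_sub_one_mem hj ha)).mpr le_rfl

theorem mul_sub_one_mem {a b : F} {j : ℤ} (hj : 0 < j) (ha : a - 1 ∈ v.lev j)
    (hb : b - 1 ∈ v.lev j) : a * b - 1 ∈ v.lev j := by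
  have : a * b - 1 = a * (b - 1) + (a - 1) := by ring
  rw [this]
  exact (v.lev j).add_mem (mul_mem_lev_zero (mem_lev_zero_of_sub_one_mem hj ha) hb) ha

theorem div_sub_one_mem {a b : F} {j : ℤ} (hj : 0 < j) (ha : a - 1 ∈ v.lev j)
    (hb : b - 1 ∈ v.lev j) : a / b - 1 ∈ v.lev j := by
  have h0 := map_eq_zero_of_sub_one_mem hj hb
  have : a / b - 1 = ((a - 1) - (b - 1)) / b := by
    rw [div_sub_one (ne_zero_of_eq_int h0)]; ring
  rw [this]
  simpa using div_mem_lev ((v.lev j).sub_mem ha hb) h0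

theorem mem_lev_of_sum_mem {ι : Type*} {s : Finset ι} {f : ι → F} {j : ℤ}
    (hf : ∀ i ∈ s, ∀ i' ∈ s, f i ≠ 0 → v (f i) = v (f i') → i = i')
    (h : ∑ i ∈ s, f i ∈ v.lev j) : ∀ i ∈ s, f i ∈ v.lev j := by
  classical
  by_contra! hc
  obtain ⟨i₁, hi₁, hi₁'⟩ := hc
  obtain ⟨i₀, hi₀, hmin⟩ := s.exists_min_image (fun i => v (f i)) ⟨i₁, hi₁⟩
  have hlt : v (f i₀) < j := lt_of_le_of_lt (hmin i₁ hi₁) (not_le.mp hi₁')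
  have hne : v (f i₀) ≠ ⊤ := ne_top_of_lt hlt
  have hrest : v (f i₀) < v (∑ i ∈ s.erase i₀, f i) := by
    refine v.map_lt_sum hne fun i hi => ?_
    obtain ⟨hne', hi⟩ := Finset.mem_erase.mp hi
    refine lt_of_le_of_ne (hmin i hi) fun heq => hne' ?_
    exact (hf i₀ hi₀ i hi ((v.ne_top_iff).mp hne) heq).symm
  rw [← Finset.add_sum_erase s f hi₀, mem_lev, v.map_add_eq_of_lt_left hrest] at h
  exact absurd hlt (not_lt.mpr h)

theorem mem_lev_succ {a : F} {j : ℤ} (ha : a ∈ v.lev j) (hne : v a ≠ j) : a ∈ v.lev (j + 1) := by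
  by_cases h0 : a = 0
  · rw [h0]; exact (v.lev _).zero_mem
  · obtain ⟨k, hk⟩ := exists_eq_int (v := v) h0
    rw [mem_lev_iff_of_eq hk] at ha ⊢
    rw [hk] at hne
    have : k ≠ j := fun e => hne (by rw [e])
    omega

theorem exists_eq_of_map_sum_eq {ι : Type*} {s : Finset ι} {f : ι → F} {j : ℤ}
    (hf : ∀ i ∈ s, ∀ i' ∈ s, f i ≠ 0 → v (f i) = v (f i') → i = i')
    (h : v (∑ i ∈ s, f i) = j) : ∃ i ∈ s, v (f i) = j := by
  by_contra! hc
  have h1 := mem_lev_of_sum_mem hf ((mem_lev_iff_of_eq h).mpr le_rfl)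
  have h2 := (v.lev (j + 1)).sum_mem fun i hi => mem_lev_succ (h1 i hi) (hc i hi)
  have := (mem_lev_iff_of_eq h).mp h2
  omega

end AddValuation

end Lev

section

open Finset IntermediateField

section Tower

/-- A totally ramified cyclotomic extension `F = E(ζ)` of an unramified base, `ζ` a primitive
`p ^ n`-th root of unity, with valuation `v` and automorphisms `σ c : ζ ↦ ζ ^ c`. -/
structure IsCyclotomicTower (p n : ℕ) {E F : Type*} [Field E] [Field F] [Algebra E F]
    (v : AddValuation F (WithTop ℤ)) (ζ : F) (σ : ℕ → F ≃ₐ[E] F) : Prop where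
  prime : p.Prime
  two_lt : 2 < p
  pos : 1 ≤ n
  root : IsPrimitiveRoot ζ (p ^ n)
  adjoin_eq_top : adjoin E {ζ} = ⊤
  map_one_sub : v (1 - ζ) = (1 : ℤ)
  map_p : v (p : F) = ((p ^ (n - 1) * (p - 1) : ℤ) : WithTop ℤ)
  map_base : ∀ x : E, x ≠ 0 →
    ∃ k : ℤ, v (algebraMap E F x) = ((p ^ (n - 1) * (p - 1) * k : ℤ) : WithTop ℤ)
  map_aut : ∀ (s : F ≃ₐ[E] F) (a : F), v (s a) = v a
  σ_root : ∀ c : ℕ, c.Coprime p → σ c ζ = ζ ^ c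
  hensel : ∀ (β : F) (s : ℤ), (p : ℤ) ^ (n - 1) < s →
    β ∈ v.lev (p ^ (n - 1) * (p - 1) + s) → ∃ w, w ^ p = 1 + β ∧ w - 1 ∈ v.lev s
  residue : ∃ f : ℕ, ∀ a ∈ v.lev 0, a ^ p ^ (f + 1) - a ∈ v.lev 1

variable {E F : Type*} [Field E] [Field F] [Algebra E F]

theorem exists_sum_one_sub_pow_of_mem_adjoin (M : IntermediateField E F) {z : F}
    (hz : IsIntegral E z) (f : Polynomial M) (hf : f.Monic) (hfz : f.aeval z = 0)
    (hd : 0 < f.natDegree) {a : F} (ha : a ∈ adjoin E {z}) :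
    ∃ c : ℕ → M, a = ∑ i ∈ range f.natDegree, (c i : F) * (1 - z) ^ i := by
  rw [← mem_toSubalgebra, adjoin_simple_toSubalgebra_of_isAlgebraic hz.isAlgebraic,
    Algebra.adjoin_singleton_eq_range_aeval] at ha
  obtain ⟨g₀, rfl⟩ := ha
  set g : Polynomial M := (g₀.map (algebraMap E M)) %ₘ f with hg
  have hgz : Polynomial.aeval z g = Polynomial.aeval z g₀ := by
    rw [hg, Polynomial.aeval_modByMonic_eq_self_of_root hfz, Polynomial.aeval_map_algebraMap]
  have hgd : g.natDegree < f.natDegree :=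
    Polynomial.natDegree_modByMonic_lt _ hf (fun h => by simp [h] at hd)
  set G := g.comp (1 - Polynomial.X) with hG
  have hGz : Polynomial.aeval (1 - z) G = Polynomial.aeval z g := by
    rw [hG, Polynomial.aeval_comp]; simp
  have hGd : G.natDegree < f.natDegree := by
    refine lt_of_le_of_lt (Polynomial.natDegree_comp_le) ?_
    have : (1 - Polynomial.X : Polynomial M).natDegree ≤ 1 := by
      refine (Polynomial.natDegree_sub_le _ _).trans ?_
      simp
    calc g.natDegree * _ ≤ g.natDegree * 1 := Nat.mul_le_mul_left _ this
      _ < _ := by omega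
  refine ⟨fun i => G.coeff i, ?_⟩
  change Polynomial.aeval z g₀ = _
  rw [← hgz, ← hGz, Polynomial.aeval_eq_sum_range' hGd]
  rfl

end Tower

namespace IsCyclotomicTower

variable {p n : ℕ} {E F : Type*} [Field E] [Field F] [Algebra E F]
  {v : AddValuation F (WithTop ℤ)} {ζ : F} {σ : ℕ → F ≃ₐ[E] F}
  (h : IsCyclotomicTower p n v ζ σ)

/-- The primitive `p ^ k`-th root of unity. -/
def z (_ : IsCyclotomicTower p n v ζ σ) (k : ℕ) : F := ζ ^ p ^ (n - k)

/-- The intermediate field generated by the `p ^ k`-th roots of unity. -/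
def fld (_ : IsCyclotomicTower p n v ζ σ) (k : ℕ) : IntermediateField E F :=
  adjoin E {ζ ^ p ^ (n - k)}

/-- A generator of the Galois group over `fld k`. -/
def s (_ : IsCyclotomicTower p n v ζ σ) (k : ℕ) : F ≃ₐ[E] F := σ (1 + p ^ k)

include h

theorem z_top : h.z n = ζ := by simp [z]

theorem fld_top : h.fld n = ⊤ := by
  rw [fld, Nat.sub_self, pow_zero, pow_one, h.adjoin_eq_top]

theorem z_mem (k : ℕ) : h.z k ∈ h.fld k := mem_adjoin_simple_self E _

theorem z_pow_p {k : ℕ} (hk : k + 1 ≤ n) : h.z (k + 1) ^ p = h.z k := by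
  rw [z, z, ← pow_mul, ← pow_succ]
  congr 2
  omega

theorem isPrimitiveRoot_z {k : ℕ} (hk : k ≤ n) : IsPrimitiveRoot (h.z k) (p ^ k) := by
  refine h.root.pow (pow_pos h.prime.pos _) ?_
  rw [← pow_add]
  congr 1
  omega

theorem isPrimitiveRoot_ω : IsPrimitiveRoot (h.z 1) p := by
  simpa using h.isPrimitiveRoot_z h.pos

theorem fld_mono {k : ℕ} (hk : k + 1 ≤ n) : h.fld k ≤ h.fld (k + 1) := by
  refine adjoin_simple_le_iff.mpr ?_
  have := pow_mem (h.z_mem (k + 1)) p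
  rwa [h.z_pow_p hk] at this

theorem coprime_one_add {k : ℕ} (hk : 1 ≤ k) : (1 + p ^ k).Coprime p := by
  obtain ⟨j, rfl⟩ := Nat.exists_eq_add_of_le' hk
  rw [pow_succ]
  simp

theorem σ_z {c : ℕ} (hc : c.Coprime p) (k : ℕ) : σ c (h.z k) = h.z k ^ c := by
  rw [z, map_pow, h.σ_root c hc, ← pow_mul, ← pow_mul, mul_comm]

theorem σ_mem {c : ℕ} (hc : c.Coprime p) {k : ℕ} {a : F} (ha : a ∈ h.fld k) :
    σ c a ∈ h.fld k := by
  have : h.fld k ≤ (h.fld k).comap (σ c : F →ₐ[E] F) := by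
    refine adjoin_simple_le_iff.mpr ?_
    change σ c (h.z k) ∈ h.fld k
    rw [h.σ_z hc]
    exact pow_mem (h.z_mem k) c
  exact this ha

theorem s_mem {k j : ℕ} (hk : 1 ≤ k) {a : F} (ha : a ∈ h.fld j) : h.s k a ∈ h.fld j :=
  h.σ_mem (h.coprime_one_add hk) ha

theorem s_z {k : ℕ} (hk : 1 ≤ k) (hkn : k + 1 ≤ n) :
    h.s k (h.z (k + 1)) = h.z (k + 1) * h.z 1 := by
  rw [s, h.σ_z (h.coprime_one_add hk), pow_add, pow_one]
  congr 1
  rw [z, z, ← pow_mul, ← pow_add]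
  congr 2
  omega

theorem s_fix {k j : ℕ} (hj : j ≤ k) (hkn : k ≤ n) (hk : 1 ≤ k) {a : F} (ha : a ∈ h.fld j) :
    h.s k a = a := by
  have : h.fld j ≤ (⊤ : IntermediateField E F).fixedIn (h.s k) := by
    refine adjoin_simple_le_iff.mpr ⟨trivial, ?_⟩
    change h.s k (h.z j) = h.z j
    rw [s, h.σ_z (h.coprime_one_add hk), pow_add, pow_one]
    have : h.z j ^ p ^ k = 1 :=
      ((h.isPrimitiveRoot_z (hj.trans hkn)).pow_eq_one_iff_dvd _).mpr (pow_dvd_pow p hj)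
    rw [this, mul_one]
  exact (this ha).2

theorem s_ω {k : ℕ} (hk : 1 ≤ k) (hkn : k ≤ n) : h.s k (h.z 1) = h.z 1 :=
  h.s_fix hk hkn hk (h.z_mem 1)

theorem s_pow_z {k : ℕ} (hk : 1 ≤ k) (hkn : k + 1 ≤ n) (i : ℕ) :
    (h.s k ^ i) (h.z (k + 1)) = h.z (k + 1) * h.z 1 ^ i := by
  induction i with
  | zero => simp
  | succ i ih =>
    rw [pow_succ', AlgEquiv.mul_apply, ih, map_mul, h.s_z hk hkn, map_pow,
      h.s_ω hk (by omega), pow_succ]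
    ring

theorem s_pow_p {k : ℕ} (hk : 1 ≤ k) (hkn : k + 1 ≤ n) {a : F} (ha : a ∈ h.fld (k + 1)) :
    (h.s k ^ p) a = a := by
  have : h.fld (k + 1) ≤ (⊤ : IntermediateField E F).fixedIn (h.s k ^ p) := by
    refine adjoin_simple_le_iff.mpr ⟨trivial, ?_⟩
    change (h.s k ^ p) (h.z (k + 1)) = h.z (k + 1)
    rw [h.s_pow_z hk hkn, h.isPrimitiveRoot_ω.pow_eq_one, mul_one]
  exact (this ha).2

theorem isIntegral_z {k : ℕ} (hk : k ≤ n) : IsIntegral E (h.z k) :=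
  ((h.isPrimitiveRoot_z hk).isIntegral (pow_pos h.prime.pos _)).tower_top

theorem exists_sum {k : ℕ} (hk : k + 1 ≤ n) {a : F} (ha : a ∈ h.fld (k + 1)) :
    ∃ c : ℕ → F, (∀ i, c i ∈ h.fld k) ∧ a = ∑ i ∈ range p, c i * (1 - h.z (k + 1)) ^ i := by
  have hd : (Polynomial.X ^ p - Polynomial.C ⟨h.z k, h.z_mem k⟩ :
      Polynomial (h.fld k)).natDegree = p := Polynomial.natDegree_X_pow_sub_C
  obtain ⟨c, hc⟩ := exists_sum_one_sub_pow_of_mem_adjoin (h.fld k) (h.isIntegral_z hk)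
    (Polynomial.X ^ p - Polynomial.C ⟨h.z k, h.z_mem k⟩)
    (Polynomial.monic_X_pow_sub_C _ h.prime.ne_zero)
    (by
      simp only [map_sub, map_pow, Polynomial.aeval_X, Polynomial.aeval_C]
      rw [h.z_pow_p hk]; exact sub_self _)
    (by rw [hd]; exact h.prime.pos) ha
  rw [hd] at hc
  exact ⟨fun i => c i, fun i => (c i).2, hc⟩

theorem exists_sum_one {a : F} (ha : a ∈ h.fld 1) :
    ∃ c : ℕ → E, a = ∑ i ∈ range (p - 1), algebraMap E F (c i) * (1 - h.z 1) ^ i := by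
  have hd : (Polynomial.cyclotomic p (⊥ : IntermediateField E F)).natDegree = p - 1 := by
    rw [Polynomial.natDegree_cyclotomic, Nat.totient_prime h.prime]
  obtain ⟨c, hc⟩ := exists_sum_one_sub_pow_of_mem_adjoin (⊥ : IntermediateField E F)
    (h.isIntegral_z h.pos) (Polynomial.cyclotomic p _) (Polynomial.cyclotomic.monic p _)
    (by
      rw [Polynomial.aeval_def, Polynomial.eval₂_eq_eval_map, Polynomial.map_cyclotomic]
      exact h.isPrimitiveRoot_ω.isRoot_cyclotomic h.prime.pos)
    (by rw [hd]; have := h.two_lt; omega) ha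
  rw [hd] at hc
  choose d hd' using fun i => IntermediateField.mem_bot.mp (c i).2
  exact ⟨d, by simpa only [hd'] using hc⟩

theorem map_root {a : F} {N : ℕ} (hN : 0 < N) (ha : a ^ N = 1) : v a = (0 : ℤ) := by
  have h0 : a ≠ 0 := by rintro rfl; rw [zero_pow hN.ne'] at ha; exact zero_ne_one ha
  obtain ⟨k, hk⟩ := AddValuation.exists_eq_int (v := v) h0
  have h1 := AddValuation.map_eq_pow hk N
  rw [ha, v.map_one] at h1
  have h2 : (0 : ℤ) = N * k := WithTop.coe_injective h1
  rcases mul_eq_zero.mp h2.symm with h3 | h3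
  · simp at h3; omega
  · rw [hk, h3]

theorem map_z {k : ℕ} (hk : k ≤ n) : v (h.z k) = (0 : ℤ) :=
  h.map_root (pow_pos h.prime.pos k) (h.isPrimitiveRoot_z hk).pow_eq_one

theorem cycNorm_one_sub_z {k : ℕ} (hk : 1 ≤ k) (hkn : k + 1 ≤ n) :
    cycNorm (h.s k) p (1 - h.z (k + 1)) = 1 - h.z k := by
  have h1 := h.isPrimitiveRoot_ω.pow_sub_pow_eq_prod_sub_mul 1 (h.z (k + 1)) h.prime.pos
  rw [one_pow, h.z_pow_p hkn] at h1
  rw [h1]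
  classical
  have hinj : Set.InjOn (fun i => h.z 1 ^ i) (range p : Set ℕ) := fun i hi j hj hij =>
    h.isPrimitiveRoot_ω.pow_inj (by simpa using hi) (by simpa using hj) hij
  have hr : Polynomial.nthRootsFinset p (1 : F) = (range p).image (fun i => h.z 1 ^ i) := by
    refine (eq_of_subset_of_card_le ?_ ?_).symm
    · intro x hx
      obtain ⟨i, -, rfl⟩ := mem_image.mp hx
      rw [Polynomial.mem_nthRootsFinset h.prime.pos, ← pow_mul, mul_comm, pow_mul,
        h.isPrimitiveRoot_ω.pow_eq_one, one_pow]
    · rw [card_image_of_injOn hinj, h.isPrimitiveRoot_ω.card_nthRootsFinset, card_range]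
  rw [hr, prod_image hinj]
  refine prod_congr rfl fun i _ => ?_
  rw [map_sub, map_one, h.s_pow_z hk hkn, mul_comm]

end IsCyclotomicTower

end

section

open Finset IntermediateField

namespace IsCyclotomicTower

variable {p n : ℕ} {E F : Type*} [Field E] [Field F] [Algebra E F]
  {v : AddValuation F (WithTop ℤ)} {ζ : F} {σ : ℕ → F ≃ₐ[E] F}
  (h : IsCyclotomicTower p n v ζ σ)

include h

theorem map_aut_mem (s : F ≃ₐ[E] F) {j : ℤ} {a : F} (ha : a ∈ v.lev j) : s a ∈ v.lev j := by
  rw [AddValuation.mem_lev, h.map_aut]; exact ha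

theorem map_cycNorm (s : F ≃ₐ[E] F) (N : ℕ) {a : F} {j : ℤ} (ha : v a = j) :
    v (cycNorm s N a) = ((N * j : ℤ) : WithTop ℤ) := by
  induction N with
  | zero => simp [cycNorm]
  | succ N ih =>
    rw [cycNorm, prod_range_succ]
    rw [AddValuation.map_eq_mul (a := ∏ i ∈ range N, (s ^ i) a) ih ((h.map_aut (s ^ N) a).trans ha)]
    congr 1
    push_cast
    ring

theorem cycNorm_mem_lev (s : F ≃ₐ[E] F) (N : ℕ) {a : F} {j : ℤ} (ha : a ∈ v.lev j) :
    cycNorm s N a ∈ v.lev (N * j) := by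
  induction N with
  | zero => simpa [cycNorm] using AddValuation.one_mem_lev
  | succ N ih =>
    rw [cycNorm, prod_range_succ]
    have := AddValuation.mul_mem_lev ih (h.map_aut_mem (s ^ N) ha)
    push_cast
    rwa [add_mul, one_mul]

theorem map_one_sub_z {k : ℕ} (hk : 1 ≤ k) (hkn : k ≤ n) :
    v (1 - h.z k) = ((p : ℤ) ^ (n - k) : ℤ) := by
  obtain ⟨d, hd⟩ := Nat.exists_eq_add_of_le hkn
  induction d generalizing k with
  | zero =>
    obtain rfl : n = k := hd
    rw [h.z_top, h.map_one_sub, Nat.sub_self, pow_zero]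
  | succ d ih =>
    have h1 := h.map_cycNorm (h.s k) p (ih (k := k + 1) (by omega) (by omega) (by omega))
    rw [h.cycNorm_one_sub_z hk (by omega)] at h1
    rw [h1, ← pow_succ', show n - (k + 1) + 1 = n - k by omega]

theorem map_natCast {c : ℕ} (hc : c.Coprime p) : v (c : F) = (0 : ℤ) := by
  have hp0 : ((p : F)) ∈ v.lev 1 := by
    rw [AddValuation.mem_lev_iff_of_eq h.map_p]
    have := h.two_lt
    have h1 : (0 : ℤ) < p ^ (n - 1) := pow_pos (by exact_mod_cast h.prime.pos) _
    have h2 : (2 : ℤ) < p := by exact_mod_cast h.two_lt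
    nlinarith
  have hc0 : (c : F) ∈ v.lev 0 := AddValuation.natCast_mem_lev c
  refine le_antisymm ?_ hc0
  by_contra! hlt
  have hc1 : (c : F) ∈ v.lev 1 := by
    change ((1 : ℤ) : WithTop ℤ) ≤ v c
    by_cases h0 : (c : F) = 0
    · rw [h0, v.map_zero]; exact le_top
    · obtain ⟨k, hk⟩ := AddValuation.exists_eq_int (v := v) h0
      rw [hk] at hlt ⊢
      have := WithTop.coe_lt_coe.mp hlt
      exact WithTop.coe_le_coe.mpr (by omega)
  obtain ⟨m, hm⟩ := Nat.exists_mul_mod_eq_one_of_coprime hc h.prime.one_lt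
  have h1 : (1 : F) ∈ v.lev 1 := by
    have h2 : (1 : F) = c * m - p * ((c * m / p : ℕ) : F) := by
      have := Nat.mod_add_div (c * m) p
      rw [hm.2] at this
      have h3 : ((1 + p * (c * m / p) : ℕ) : F) = ((c * m : ℕ) : F) := by rw [this]
      push_cast at h3
      rw [← h3]; ring
    rw [h2]
    refine (v.lev 1).sub_mem ?_ ?_
    · rw [mul_comm]; exact AddValuation.mul_mem_lev_zero (AddValuation.natCast_mem_lev _) hc1
    · rw [mul_comm]; exact AddValuation.mul_mem_lev_zero (AddValuation.natCast_mem_lev _) hp0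
  have := (AddValuation.mem_lev_iff_of_eq (v := v) (k := 0) v.map_one).mp h1
  omega

theorem coprime_of_lt {i : ℕ} (hi : 0 < i) (hip : i < p) : i.Coprime p :=
  (Nat.coprime_of_lt_prime hi.ne' hip h.prime).symm

theorem pow_pos_int (k : ℕ) : (0 : ℤ) < (p : ℤ) ^ k :=
  pow_pos (by exact_mod_cast h.prime.pos) k

theorem terms_inj {k : ℕ} (hkn : k + 1 ≤ n)
    (hdvd : ∀ a ∈ h.fld k, ∀ j : ℤ, v a = j → (p : ℤ) ^ (n - k) ∣ j)
    {c w : ℕ → F} (hc : ∀ i, c i ∈ h.fld k) {S : Finset ℕ} (hS : S ⊆ range p) {K : ℤ}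
    (hw : ∀ i ∈ S, v (w i) = ((i * (p : ℤ) ^ (n - (k + 1)) + K : ℤ) : WithTop ℤ)) :
    ∀ i ∈ S, ∀ i' ∈ S, c i * w i ≠ 0 → v (c i * w i) = v (c i' * w i') → i = i' := by
  intro i hi i' hi' hne heq
  obtain ⟨x, hx⟩ := AddValuation.exists_eq_int (v := v) (left_ne_zero_of_mul hne)
  rw [AddValuation.map_eq_mul hx (hw i hi)] at heq
  have hne' := left_ne_zero_of_mul (AddValuation.ne_zero_of_eq_int heq.symm)
  obtain ⟨x', hx'⟩ := AddValuation.exists_eq_int (v := v) hne'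
  rw [AddValuation.map_eq_mul hx' (hw i' hi')] at heq
  have heq' : x + (i * (p : ℤ) ^ (n - (k + 1)) + K) = x' + (i' * (p : ℤ) ^ (n - (k + 1)) + K) :=
    WithTop.coe_injective heq
  obtain ⟨y, rfl⟩ := hdvd _ (hc i) x hx
  obtain ⟨y', rfl⟩ := hdvd _ (hc i') x' hx'
  rw [show n - k = n - (k + 1) + 1 by omega, pow_succ] at heq'
  have hd := h.pow_pos_int (n - (k + 1))
  have h2 : (p : ℤ) * y + i = p * y' + i' := by
    have : (p : ℤ) ^ (n - (k + 1)) * (p * y + i) = (p : ℤ) ^ (n - (k + 1)) * (p * y' + i') := by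
      linear_combination heq'
    exact mul_left_cancel₀ hd.ne' this
  have hlt := mem_range.mp (hS hi)
  have hlt' := mem_range.mp (hS hi')
  have h3 : (i : ℤ) % p = i' % p := by
    have := congrArg (· % (p : ℤ)) h2
    simpa using this
  rw [Int.emod_eq_of_lt (by omega) (by omega), Int.emod_eq_of_lt (by omega) (by omega)] at h3
  exact_mod_cast h3

theorem map_one_sub_z_pow {k : ℕ} (hk : 1 ≤ k) (hkn : k ≤ n) (i : ℕ) :
    v ((1 - h.z k) ^ i) = ((i * (p : ℤ) ^ (n - k) : ℤ) : WithTop ℤ) :=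
  AddValuation.map_eq_pow (h.map_one_sub_z hk hkn) i

theorem terms_inj_one (c : ℕ → E) : ∀ i ∈ range (p - 1), ∀ i' ∈ range (p - 1),
    algebraMap E F (c i) * (1 - h.z 1) ^ i ≠ 0 →
    v (algebraMap E F (c i) * (1 - h.z 1) ^ i) = v (algebraMap E F (c i') * (1 - h.z 1) ^ i') →
    i = i' := by
  have hkn := h.pos
  have hd := h.pow_pos_int (n - 1)
  intro i hi i' hi' hne heq
  have hci : c i ≠ 0 := by rintro h0; simp [h0] at hne
  obtain ⟨x, hx⟩ := h.map_base _ hci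
  rw [AddValuation.map_eq_mul hx (h.map_one_sub_z_pow le_rfl hkn i)] at heq
  have hci' : c i' ≠ 0 := by
    rintro h0
    rw [h0, map_zero, zero_mul, v.map_zero] at heq
    exact WithTop.coe_ne_top heq
  obtain ⟨x', hx'⟩ := h.map_base _ hci'
  rw [AddValuation.map_eq_mul hx' (h.map_one_sub_z_pow le_rfl hkn i')] at heq
  have heq' := WithTop.coe_injective heq
  have h2 : ((p : ℤ) - 1) * x + i = (p - 1) * x' + i' := by
    have : (p : ℤ) ^ (n - 1) * ((p - 1) * x + i) = (p : ℤ) ^ (n - 1) * ((p - 1) * x' + i') := by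
      linear_combination heq'
    exact mul_left_cancel₀ hd.ne' this
  have hlt := mem_range.mp hi
  have hlt' := mem_range.mp hi'
  have h3 : (i : ℤ) % (p - 1) = i' % (p - 1) := by
    have := congrArg (· % ((p : ℤ) - 1)) h2
    simpa only [Int.mul_add_emod_self_left] using this
  rw [Int.emod_eq_of_lt (by omega) (by omega), Int.emod_eq_of_lt (by omega) (by omega)] at h3
  exact_mod_cast h3

theorem dvd_valuation {k : ℕ} (hk : 1 ≤ k) (hkn : k ≤ n) :
    ∀ a ∈ h.fld k, ∀ j : ℤ, v a = j → (p : ℤ) ^ (n - k) ∣ j := by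
  induction k, hk using Nat.le_induction with
  | base =>
    intro a ha j hj
    obtain ⟨c, rfl⟩ := h.exists_sum_one ha
    obtain ⟨i, -, hi⟩ := AddValuation.exists_eq_of_map_sum_eq (h.terms_inj_one c) hj
    have hci : c i ≠ 0 := by rintro h0; simp [h0] at hi
    obtain ⟨x, hx⟩ := h.map_base _ hci
    rw [AddValuation.map_eq_mul hx (h.map_one_sub_z_pow le_rfl hkn i)] at hi
    rw [← WithTop.coe_injective hi]
    exact ⟨(p - 1) * x + i, by ring⟩
  | succ k hk ih =>
    intro a ha j hj
    obtain ⟨c, hc, rfl⟩ := h.exists_sum hkn ha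
    obtain ⟨i, -, hi⟩ := AddValuation.exists_eq_of_map_sum_eq (h.terms_inj hkn (ih (by omega)) hc
      (Subset.refl _) (K := 0) fun i _ => by
        rw [add_zero]; exact h.map_one_sub_z_pow (by omega) hkn i) hj
    have hci : c i ≠ 0 := by rintro h0; simp [h0] at hi
    obtain ⟨x, hx⟩ := AddValuation.exists_eq_int (v := v) hci
    rw [AddValuation.map_eq_mul hx (h.map_one_sub_z_pow (by omega) hkn i)] at hi
    rw [← WithTop.coe_injective hi]
    refine dvd_add ((pow_dvd_pow _ (by omega)).trans (ih (by omega) _ (hc i) x hx)) ?_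
    exact Dvd.intro_left _ rfl

/-- Valuations on `fld k` are multiples of `p ^ (n - k)`. -/
theorem mem_lev_of_mem_fld {k : ℕ} (hk : 1 ≤ k) (hkn : k ≤ n) {a : F} (ha : a ∈ h.fld k) {j : ℤ}
    (hj : a ∈ v.lev ((p : ℤ) ^ (n - k) * j + 1)) : a ∈ v.lev ((p : ℤ) ^ (n - k) * (j + 1)) := by
  by_cases h0 : a = 0
  · rw [h0]; exact (v.lev _).zero_mem
  obtain ⟨x, hx⟩ := AddValuation.exists_eq_int (v := v) h0
  obtain ⟨y, rfl⟩ := h.dvd_valuation hk hkn a ha x hx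
  rw [AddValuation.mem_lev_iff_of_eq hx] at hj ⊢
  have hd := h.pow_pos_int (n - k)
  have : j < y := by nlinarith
  nlinarith

/-- The terms of an expansion in powers of the uniformizer are as integral as the sum. -/
theorem term_mem_lev {k : ℕ} (hk : 1 ≤ k) (hkn : k + 1 ≤ n) {c : ℕ → F}
    (hc : ∀ i, c i ∈ h.fld k) {j : ℤ}
    (hj : ∑ i ∈ range p, c i * (1 - h.z (k + 1)) ^ i ∈ v.lev j) {i : ℕ} (hi : i < p) :
    c i * (1 - h.z (k + 1)) ^ i ∈ v.lev j :=
  AddValuation.mem_lev_of_sum_mem (h.terms_inj hkn (h.dvd_valuation hk (by omega)) hc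
      (Subset.refl _) (K := 0) fun i _ => by
        rw [add_zero]; exact h.map_one_sub_z_pow (by omega) hkn i) hj i (mem_range.mpr hi)

theorem map_s_pow_sub {k : ℕ} (hk : 1 ≤ k) (hkn : k + 1 ≤ n) {i : ℕ} (hi : 0 < i) (hip : i < p) :
    v ((h.s k (1 - h.z (k + 1))) ^ i - (1 - h.z (k + 1)) ^ i) =
      ((i * (p : ℤ) ^ (n - (k + 1)) + (p ^ (n - 1) - p ^ (n - (k + 1))) : ℤ) : WithTop ℤ) := by
  set π := 1 - h.z (k + 1) with hπ
  have hvπ : v π = ((p : ℤ) ^ (n - (k + 1)) : ℤ) := h.map_one_sub_z (by omega) hkn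
  have hπ0 := AddValuation.ne_zero_of_eq_int hvπ
  set ε := h.z (k + 1) * (1 - h.z 1) / π with hε
  have hvε : v ε = ((p : ℤ) ^ (n - 1) - p ^ (n - (k + 1)) : ℤ) := by
    have := AddValuation.map_eq_div (AddValuation.map_eq_mul (h.map_z hkn)
      (h.map_one_sub_z le_rfl h.pos)) hvπ
    rwa [zero_add] at this
  have hpos : (0 : ℤ) < (p : ℤ) ^ (n - 1) - p ^ (n - (k + 1)) := by
    have : (p : ℤ) ^ (n - (k + 1)) < (p : ℤ) ^ (n - 1) :=
      pow_lt_pow_right₀ (by exact_mod_cast h.prime.one_lt) (by omega)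
    omega
  have hs : h.s k π = π * (1 + ε) := by
    rw [hπ, map_sub, map_one, h.s_z hk hkn, mul_add, hε, ← hπ, mul_div_cancel₀ _ hπ0]
    rw [hπ]; ring
  have hgeom : (1 + ε) ^ i - 1 = (∑ l ∈ range i, (1 + ε) ^ l) * ε := by
    have := geom_sum_mul (1 + ε) i
    rw [add_sub_cancel_left] at this
    exact this.symm
  have hε1 : ε ∈ v.lev 1 := (AddValuation.mem_lev_iff_of_eq hvε).mpr (by omega)
  have hl : ∀ l : ℕ, (1 + ε) ^ l - 1 ∈ v.lev 1 := by
    intro l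
    induction l with
    | zero => simp
    | succ l ih =>
      rw [pow_succ]
      exact AddValuation.mul_sub_one_mem one_pos ih (by rwa [add_sub_cancel_left])
  have hsum : v (∑ l ∈ range i, (1 + ε) ^ l) = (0 : ℤ) := by
    have : ∑ l ∈ range i, (1 + ε) ^ l = (i : F) + ∑ l ∈ range i, ((1 + ε) ^ l - 1) := by
      rw [sum_sub_distrib]; simp
    rw [this]
    exact AddValuation.map_add_eq (h.map_natCast (h.coprime_of_lt hi hip))
      ((v.lev _).sum_mem fun l _ => hl l)
  have : (h.s k π) ^ i - π ^ i = π ^ i * ((∑ l ∈ range i, (1 + ε) ^ l) * ε) := by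
    rw [hs, mul_pow, ← hgeom]; ring
  rw [this, AddValuation.map_eq_mul (AddValuation.map_eq_pow hvπ i)
    (AddValuation.map_eq_mul hsum hvε), zero_add]

/-- An element of `fld (k + 1)` which is almost fixed by `s k` is close to `fld k`. -/
theorem exists_close {k : ℕ} (hk : 1 ≤ k) (hkn : k + 1 ≤ n) {a : F} (ha : a ∈ h.fld (k + 1)) :
    ∃ b ∈ h.fld k, ∀ j : ℤ, h.s k a - a ∈ v.lev j →
      a - b ∈ v.lev (j - (p ^ (n - 1) - p ^ (n - (k + 1)))) := by
  obtain ⟨c, hc, rfl⟩ := h.exists_sum hkn ha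
  set π := 1 - h.z (k + 1) with hπ
  have hp0 : 0 ∈ range p := mem_range.mpr h.prime.pos
  refine ⟨c 0, hc 0, fun j hj => ?_⟩
  have hdiff : h.s k (∑ i ∈ range p, c i * π ^ i) - ∑ i ∈ range p, c i * π ^ i =
      ∑ i ∈ (range p).erase 0, c i * ((h.s k π) ^ i - π ^ i) := by
    rw [map_sum, ← sum_sub_distrib, ← add_sum_erase _ _ hp0]
    rw [map_mul, h.s_fix le_rfl (by omega) hk (hc 0)]
    simp only [pow_zero, map_one, sub_self, zero_add]
    refine sum_congr rfl fun i _ => ?_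
    rw [map_mul, h.s_fix le_rfl (by omega) hk (hc i), map_pow, mul_sub]
  rw [hdiff] at hj
  have hmem := AddValuation.mem_lev_of_sum_mem (h.terms_inj hkn (h.dvd_valuation hk (by omega)) hc
    (erase_subset 0 (range p)) (K := p ^ (n - 1) - p ^ (n - (k + 1))) fun i hi => by
      rw [mem_erase, mem_range] at hi
      exact h.map_s_pow_sub hk hkn (by omega) hi.2) hj
  rw [← add_sum_erase _ _ hp0, pow_zero, mul_one, add_sub_cancel_left]
  refine (v.lev _).sum_mem fun i hi => ?_
  have hi' := mem_erase.mp hi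
  rw [mem_range] at hi'
  by_cases h0 : c i = 0
  · rw [h0, zero_mul]; exact (v.lev _).zero_mem
  obtain ⟨x, hx⟩ := AddValuation.exists_eq_int (v := v) h0
  have h1 := hmem i hi
  rw [AddValuation.mem_lev_iff_of_eq
    (AddValuation.map_eq_mul hx (h.map_s_pow_sub hk hkn (by omega) hi'.2))] at h1
  rw [AddValuation.mem_lev_iff_of_eq
    (AddValuation.map_eq_mul hx (h.map_one_sub_z_pow (by omega) hkn i))]
  omega

theorem mem_fld_of_s_fix {k : ℕ} (hk : 1 ≤ k) (hkn : k + 1 ≤ n) {a : F} (ha : a ∈ h.fld (k + 1))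
    (hs : h.s k a = a) : a ∈ h.fld k := by
  obtain ⟨b, hb, hab⟩ := h.exists_close hk hkn ha
  have : a - b = 0 := by
    by_contra h0
    obtain ⟨x, hx⟩ := AddValuation.exists_eq_int (v := v) h0
    have h1 := hab (x + (p ^ (n - 1) - p ^ (n - (k + 1))) + 1) (by
      rw [hs, sub_self]; exact (v.lev _).zero_mem)
    rw [AddValuation.mem_lev_iff_of_eq hx] at h1
    omega
  rwa [sub_eq_zero.mp this]

end IsCyclotomicTower

end

section

open Finset IntermediateField

section Newton

variable {F : Type*} [Field F] {v : AddValuation F (WithTop ℤ)}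

/-- If the power sums of `p` integral elements have valuation at least `e`, so do the elementary
symmetric functions of degree less than `p`. -/
theorem AddValuation.esymm_mem_lev {p : ℕ} {e : ℤ} (he : 0 ≤ e)
    (hunit : ∀ i : ℕ, 0 < i → i < p → v (i : F) = (0 : ℤ)) {N : ℕ} (x : Fin N → F)
    (hpsum : ∀ i : ℕ, 0 < i → i < p → ∑ l, x l ^ i ∈ v.lev e) {i : ℕ} (hi : 0 < i) (hip : i < p) :
    MvPolynomial.aeval x (MvPolynomial.esymm (Fin N) F i) ∈ v.lev e := by
  induction i using Nat.strong_induction_on with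
  | _ i ih =>
  have hint : ∀ l < i, MvPolynomial.aeval x (MvPolynomial.esymm (Fin N) F l) ∈ v.lev 0 := by
    intro l hl
    rcases Nat.eq_zero_or_pos l with rfl | hl0
    · simpa using AddValuation.one_mem_lev
    · exact AddValuation.lev_mono he (ih l hl hl0 (by omega))
  have hN := congrArg (MvPolynomial.aeval x) (MvPolynomial.mul_esymm_eq_sum (Fin N) F i)
  simp only [_root_.map_mul, map_natCast, map_sum, _root_.map_pow, _root_.map_neg,
    _root_.map_one] at hN
  have hmem : (i : F) * MvPolynomial.aeval x (MvPolynomial.esymm (Fin N) F i) ∈ v.lev e := by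
    rw [hN]
    have hsign : ∀ m : ℕ, ((-1 : F)) ^ m ∈ v.lev 0 := fun m => by
      simpa using AddValuation.pow_mem_lev (i := 0) ((v.lev 0).neg_mem AddValuation.one_mem_lev) m
    refine AddValuation.mul_mem_lev_zero (hsign _) ((v.lev e).sum_mem fun a ha => ?_)
    rw [mem_filter, HasAntidiagonal.mem_antidiagonal] at ha
    refine AddValuation.mul_mem_lev_zero ?_ ?_
    · simpa using AddValuation.mul_mem_lev (hsign a.1) (hint a.1 ha.2)
    · have := hpsum a.2 (by omega) (by omega)
      simpa [MvPolynomial.psum] using this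
  have := AddValuation.div_mem_lev hmem (hunit i hi hip)
  rwa [mul_div_cancel_left₀ _ (AddValuation.ne_zero_of_eq_int (hunit i hi hip)), sub_zero] at this

theorem prod_one_add_mul_eq_sum_esymm {N : ℕ} (x : Fin N → F) (b : F) :
    ∏ l, (1 + b * x l) =
      ∑ i ∈ range (N + 1), b ^ i * MvPolynomial.aeval x (MvPolynomial.esymm (Fin N) F i) := by
  rw [prod_one_add, sum_powerset]
  simp only [card_univ, Fintype.card_fin]
  refine sum_congr rfl fun i _ => ?_
  rw [MvPolynomial.esymm, map_sum, mul_sum]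
  refine sum_congr rfl fun t ht => ?_
  rw [prod_mul_distrib, prod_const, (mem_powersetCard.mp ht).2, map_prod]
  simp

end Newton

namespace IsCyclotomicTower

variable {p n : ℕ} {E F : Type*} [Field E] [Field F] [Algebra E F]
  {v : AddValuation F (WithTop ℤ)} {ζ : F} {σ : ℕ → F ≃ₐ[E] F}
  (h : IsCyclotomicTower p n v ζ σ)

include h

theorem pow_z_sum {k : ℕ} (hk : 1 ≤ k) (hkn : k + 1 ≤ n) {j : ℕ} (hj : 0 < j) (hjp : j < p) :
    ∑ i ∈ range p, (h.s k ^ i) (h.z (k + 1) ^ j) = 0 := by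
  have h1 : ∀ i ∈ range p, (h.s k ^ i) (h.z (k + 1) ^ j) = h.z (k + 1) ^ j * (h.z 1 ^ j) ^ i := by
    intro i _
    rw [map_pow, h.s_pow_z hk hkn, mul_pow, ← pow_mul, ← pow_mul, mul_comm i]
  rw [sum_congr rfl h1, ← mul_sum]
  have h2 := geom_sum_mul (h.z 1 ^ j) p
  rw [← pow_mul, mul_comm j, pow_mul, h.isPrimitiveRoot_ω.pow_eq_one, one_pow, sub_self] at h2
  rcases mul_eq_zero.mp h2 with h3 | h3
  · rw [h3, mul_zero]
  · exact absurd (sub_eq_zero.mp h3) (h.isPrimitiveRoot_ω.pow_ne_one_of_pos_of_lt hj.ne' hjp)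

theorem trace_pi_pow {k : ℕ} (hk : 1 ≤ k) (hkn : k + 1 ≤ n) {m : ℕ} (hm : m < p) :
    ∑ i ∈ range p, (h.s k ^ i) ((1 - h.z (k + 1)) ^ m) = p := by
  have h1 : (1 - h.z (k + 1)) ^ m =
      ∑ j ∈ range (m + 1), ((-1) ^ j * (m.choose j : F)) * h.z (k + 1) ^ j := by
    rw [sub_eq_add_neg, add_comm, add_pow]
    refine sum_congr rfl fun j _ => ?_
    rw [neg_pow, one_pow]; ring
  simp only [h1, map_sum]
  rw [sum_comm, sum_range_succ']
  have h2 : ∀ j ∈ range m, ∑ i ∈ range p, (h.s k ^ i)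
      (((-1) ^ (j + 1) * (m.choose (j + 1) : F)) * h.z (k + 1) ^ (j + 1)) = 0 := by
    intro j hj
    rw [mem_range] at hj
    have h3 : ∀ i : ℕ, (h.s k ^ i) ((-1) ^ (j + 1) * (m.choose (j + 1) : F)) =
        (-1) ^ (j + 1) * (m.choose (j + 1) : F) := fun i => by
      rw [map_mul, map_pow, map_neg, map_one, _root_.map_natCast]
    simp only [map_mul (h.s k ^ _) (_ * _), h3]
    rw [← mul_sum, h.pow_z_sum hk hkn (Nat.succ_pos j) (by omega), mul_zero]
  rw [sum_eq_zero h2]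
  simp

theorem map_p_nonneg : (0 : ℤ) ≤ p ^ (n - 1) * (p - 1) := by
  have := h.two_lt
  exact mul_nonneg (by positivity) (by omega)

theorem trace_mem_lev {k : ℕ} (hk : 1 ≤ k) (hkn : k + 1 ≤ n) {a : F} (ha : a ∈ h.fld (k + 1))
    (ha0 : a ∈ v.lev 0) :
    ∑ i ∈ range p, (h.s k ^ i) a ∈ v.lev (p ^ (n - 1) * (p - 1)) := by
  obtain ⟨c, hc, rfl⟩ := h.exists_sum hkn ha
  simp only [map_sum]
  rw [sum_comm]
  refine (v.lev _).sum_mem fun m hm => ?_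
  have hmp := mem_range.mp hm
  have h1 : ∑ i ∈ range p, (h.s k ^ i) (c m * (1 - h.z (k + 1)) ^ m) = c m * p := by
    rw [← h.trace_pi_pow hk hkn hmp, mul_sum]
    refine sum_congr rfl fun i _ => ?_
    rw [map_mul, AlgEquiv.pow_apply_eq_self (h.s_fix le_rfl (by omega) hk (hc m))]
  rw [h1]
  have h2 := h.term_mem_lev hk hkn hc ha0 hmp
  have hcm : c m ∈ v.lev 0 := by
    by_cases h0 : c m = 0
    · rw [h0]; exact (v.lev _).zero_mem
    obtain ⟨x, hx⟩ := AddValuation.exists_eq_int (v := v) h0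
    obtain ⟨y, rfl⟩ := h.dvd_valuation hk (by omega) _ (hc m) x hx
    rw [AddValuation.mem_lev_iff_of_eq
      (AddValuation.map_eq_mul hx (h.map_one_sub_z_pow (by omega) hkn m))] at h2
    rw [AddValuation.mem_lev_iff_of_eq hx]
    rw [show n - k = n - (k + 1) + 1 by omega, pow_succ] at h2 ⊢
    have hd := h.pow_pos_int (n - (k + 1))
    have h3 : 0 ≤ (p : ℤ) ^ (n - (k + 1)) * (p * y + m) := by linarith
    have h4 : 0 ≤ (p : ℤ) * y + m := nonneg_of_mul_nonneg_right h3 hd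
    have h5 : 0 ≤ y := by
      by_contra! hy
      have : (p : ℤ) * y ≤ p * (-1) := by
        apply mul_le_mul_of_nonneg_left <;> omega
      omega
    positivity
  exact AddValuation.mul_mem_lev_zero hcm ((AddValuation.mem_lev_iff_of_eq h.map_p).mpr le_rfl)

theorem cycNorm_one_add_mul {k : ℕ} (hk : 1 ≤ k) (hkn : k + 1 ≤ n) {γ b : F} {j : ℤ} (hj : 0 ≤ j)
    (hγ : γ ∈ h.fld (k + 1)) (hγ0 : γ ∈ v.lev 0) (hb : b ∈ h.fld k) (hbj : b ∈ v.lev j) :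
    cycNorm (h.s k) p (1 + b * γ) -
      (1 + b * ∑ i ∈ range p, (h.s k ^ i) γ + b ^ p * cycNorm (h.s k) p γ) ∈
      v.lev (p ^ (n - 1) * (p - 1) + 2 * j) := by
  set x : Fin p → F := fun l => (h.s k ^ (l : ℕ)) γ with hx
  have h2p := h.two_lt
  have hes : ∀ i : ℕ, 0 < i → i < p →
      MvPolynomial.aeval x (MvPolynomial.esymm (Fin p) F i) ∈ v.lev (p ^ (n - 1) * (p - 1)) := by
    intro i hi hip
    refine AddValuation.esymm_mem_lev h.map_p_nonneg
      (fun i hi hip => h.map_natCast (h.coprime_of_lt hi hip)) x (fun i hi hip => ?_) hi hip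
    have := h.trace_mem_lev hk hkn (pow_mem hγ i)
      (by simpa using AddValuation.pow_mem_lev hγ0 i)
    rw [← Fin.sum_univ_eq_sum_range (fun l => (h.s k ^ l) (γ ^ i))] at this
    simpa [hx, map_pow] using this
  have h1 : cycNorm (h.s k) p (1 + b * γ) = ∏ l, (1 + b * x l) := by
    rw [cycNorm, ← Fin.prod_univ_eq_prod_range (fun l => (h.s k ^ l) (1 + b * γ))]
    refine prod_congr rfl fun l _ => ?_
    rw [map_add, map_one, map_mul,
      AlgEquiv.pow_apply_eq_self (h.s_fix le_rfl (by omega) hk hb)]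
  have e1 : MvPolynomial.aeval x (MvPolynomial.esymm (Fin p) F 1) =
      ∑ i ∈ range p, (h.s k ^ i) γ := by
    rw [← Fin.sum_univ_eq_sum_range (fun l => (h.s k ^ l) γ)]
    simp [MvPolynomial.esymm_one, hx]
  have ep : MvPolynomial.aeval x (MvPolynomial.esymm (Fin p) F p) = cycNorm (h.s k) p γ := by
    rw [cycNorm, ← Fin.prod_univ_eq_prod_range (fun l => (h.s k ^ l) γ)]
    have : powersetCard p (univ : Finset (Fin p)) = {univ} := by
      have := powersetCard_self (univ : Finset (Fin p))
      rwa [card_univ, Fintype.card_fin] at this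
    rw [MvPolynomial.esymm, this]
    simp [hx]
  obtain ⟨q, hq⟩ : ∃ q, p = q + 2 := ⟨p - 2, by omega⟩
  have hsum : cycNorm (h.s k) p (1 + b * γ) -
      (1 + b * ∑ i ∈ range p, (h.s k ^ i) γ + b ^ p * cycNorm (h.s k) p γ) =
      ∑ i ∈ range (p - 2), b ^ (i + 2) *
        MvPolynomial.aeval x (MvPolynomial.esymm (Fin p) F (i + 2)) := by
    rw [h1, prod_one_add_mul_eq_sum_esymm, sum_range_succ, ep, ← e1]
    have : range p = range ((p - 2) + 2) := by congr 1; omega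
    rw [this, sum_range_succ', sum_range_succ']
    simp
    ring
  rw [hsum]
  refine (v.lev _).sum_mem fun i hi => ?_
  rw [mem_range] at hi
  rw [add_comm (_ * _ : ℤ)]
  refine AddValuation.mul_mem_lev ?_ (hes _ (by omega) (by omega))
  refine AddValuation.lev_mono ?_ (AddValuation.pow_mem_lev hbj (i + 2))
  push_cast
  nlinarith

theorem cycNorm_sub_mem {k : ℕ} (hk : 1 ≤ k) (hkn : k + 1 ≤ n) {γ b : F} {j : ℤ} (hj : 0 ≤ j)
    (hγ : γ ∈ h.fld (k + 1)) (hγ0 : γ ∈ v.lev 0) (hb : b ∈ h.fld k) (hbj : b ∈ v.lev j) :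
    cycNorm (h.s k) p (1 + b * γ) - (1 + b ^ p * cycNorm (h.s k) p γ) ∈
      v.lev (p ^ (n - 1) * (p - 1) + j) := by
  have h1 := h.cycNorm_one_add_mul hk hkn hj hγ hγ0 hb hbj
  have h2 := AddValuation.mul_mem_lev hbj (h.trace_mem_lev hk hkn hγ hγ0)
  have h3 := (v.lev _).add_mem (AddValuation.lev_mono (by omega) h1) (AddValuation.lev_mono
    (i := (p : ℤ) ^ (n - 1) * (p - 1) + j) (by omega) h2)
  convert h3 using 1
  ring

theorem cycNorm_mem_fld {k : ℕ} (hk : 1 ≤ k) (hkn : k + 1 ≤ n) {a : F}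
    (ha : a ∈ h.fld (k + 1)) : cycNorm (h.s k) p a ∈ h.fld k := by
  refine h.mem_fld_of_s_fix hk hkn (cycNorm_mem _ (fun x hx => h.s_mem hk hx) ha) ?_
  exact map_self_cycNorm (h.s_pow_p hk hkn ha)

/-- The norm of a principal unit. -/
theorem cycNorm_sub_one_mem {k : ℕ} (hk : 1 ≤ k) (hkn : k + 1 ≤ n) {w : F} {j i : ℤ} (hj : 0 ≤ j)
    (hw : w ∈ h.fld (k + 1)) (hwj : w - 1 ∈ v.lev j) (hi : i ≤ p * j)
    (hi' : i ≤ p ^ (n - 1) * (p - 1)) : cycNorm (h.s k) p w - 1 ∈ v.lev i := by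
  have h1 := h.cycNorm_sub_mem hk hkn le_rfl (sub_mem hw (one_mem _))
    (AddValuation.lev_mono hj hwj) (one_mem (h.fld k)) AddValuation.one_mem_lev
  rw [one_mul, one_pow, one_mul, add_sub_cancel, add_zero] at h1
  have h2 := (v.lev i).add_mem (AddValuation.lev_mono hi' h1)
    (AddValuation.lev_mono hi (h.cycNorm_mem_lev (h.s k) p hwj))
  convert h2 using 1
  ring

end IsCyclotomicTower

end

section

open Finset IntermediateField

/-- A character of the units of a cyclotomic tower, with values in `ZMod (p ^ n)`, on which the
Galois group acts through a character congruent to the `(t - 1)`-st power of the cyclotomic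
character modulo `p`. -/
structure IsTwistedCharacter {p n : ℕ} {E F : Type*} [Field E] [Field F] [Algebra E F]
    (v : AddValuation F (WithTop ℤ)) (σ : ℕ → F ≃ₐ[E] F) (t : ℕ) (R : F → ZMod (p ^ n)) : Prop where
  map_mul : ∀ a b : F, v a = (0 : ℤ) → v b = (0 : ℤ) → R (a * b) = R a + R b
  exists_one : ∃ c, v c = (0 : ℤ) ∧ R c = 1
  s_apply : ∀ k, 1 ≤ k → k ≤ n → ∃ y : ZMod (p ^ n), ∀ a, v a = (0 : ℤ) →
    R (σ (1 + p ^ k) a) = (1 + (p : ZMod (p ^ n)) ^ k * y) * R a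
  σ_apply : ∀ g : ℕ, g.Coprime p → ∃ y : ZMod (p ^ n), ∀ a, v a = (0 : ℤ) →
    R (σ g a) = ((g : ZMod (p ^ n)) ^ (t - 1) + p * y) * R a

theorem ZMod.isNilpotent_p_mul (p n : ℕ) (x : ZMod (p ^ n)) :
    IsNilpotent ((p : ZMod (p ^ n)) * x) :=
  ⟨n, by rw [mul_pow, ← Nat.cast_pow, ZMod.natCast_self, zero_mul]⟩

theorem ZMod.isUnit_add_p_mul {p n : ℕ} {a : ZMod (p ^ n)} (ha : IsUnit a) (x : ZMod (p ^ n)) :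
    IsUnit (a + p * x) :=
  IsNilpotent.isUnit_add_left_of_commute (isNilpotent_p_mul p n x) ha (Commute.all _ _)

theorem one_add_pow_eq_add {A : Type*} [CommRing A] (y : A) (i : ℕ) :
    ∃ x, (1 + y) ^ i = 1 + i * y + y ^ 2 * x := by
  induction i with
  | zero => exact ⟨0, by simp⟩
  | succ i ih =>
    obtain ⟨x, hx⟩ := ih
    exact ⟨x + i + y * x, by rw [pow_succ, hx]; push_cast; ring⟩

theorem geom_sum_one_add_p_mul {A : Type*} [CommRing A] {p : ℕ} (hp : Odd p) (y : A) :
    ∃ x, ∑ i ∈ range p, (1 + p * y) ^ i = p * (1 + p * x) := by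
  choose x hx using fun i => one_add_pow_eq_add ((p : A) * y) i
  obtain ⟨m, hm⟩ := hp
  have hsum : (∑ i ∈ range p, i) = p * m := by
    have := Finset.sum_range_id_mul_two p
    rw [show p - 1 = 2 * m by omega] at this
    nlinarith
  refine ⟨m * y + y ^ 2 * ∑ i ∈ range p, x i, ?_⟩
  simp only [hx]
  rw [sum_add_distrib, sum_add_distrib, ← mul_sum, ← sum_mul, ← Nat.cast_sum, hsum]
  simp
  ring

theorem exists_nat_primitiveRoot (p : ℕ) [Fact p.Prime] :
    ∃ g : ℕ, g.Coprime p ∧ ∀ i j : ℕ, g ^ i ≡ g ^ j [MOD p] → i ≡ j [MOD (p - 1)] := by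
  obtain ⟨u, hu⟩ := IsCyclic.exists_generator (α := (ZMod p)ˣ)
  have hord : orderOf u = p - 1 := by
    rw [orderOf_eq_card_of_forall_mem_zpowers hu, Nat.card_eq_fintype_card, ZMod.card_units]
  refine ⟨(u : ZMod p).val, ZMod.val_coe_unit_coprime u, fun i j hij => ?_⟩
  rw [← hord, ← pow_eq_pow_iff_modEq]
  have := (ZMod.natCast_eq_natCast_iff _ _ _).mpr hij
  push_cast at this
  rw [ZMod.natCast_zmod_val] at this
  ext
  push_cast
  exact this

theorem ZMod.isUnit_pow_sub_pow {p n : ℕ} (hp : p.Prime) {g i j : ℕ}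
    (hg : ¬ g ^ i ≡ g ^ j [MOD p]) : IsUnit ((g : ZMod (p ^ n)) ^ i - (g : ZMod (p ^ n)) ^ j) := by
  have h1 : IsCoprime (((g : ℤ) ^ i - (g : ℤ) ^ j)) (p : ℤ) := by
    rw [isCoprime_comm, (Nat.prime_iff_prime_int.mp hp).coprime_iff_not_dvd]
    intro hd
    apply hg
    have : ((g ^ j : ℕ) : ℤ) ≡ ((g ^ i : ℕ) : ℤ) [ZMOD p] := by
      rw [Int.modEq_iff_dvd]; push_cast; exact hd
    exact (Int.natCast_modEq_iff.mp this).symm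
  have h2 := (h1.pow_right (n := n))
  obtain ⟨a, b, hab⟩ := h2
  have h3 := congrArg (Int.cast : ℤ → ZMod (p ^ n)) hab
  push_cast at h3
  have h4 : (p : ZMod (p ^ n)) ^ n = 0 := by rw [← Nat.cast_pow, ZMod.natCast_self]
  rw [h4, mul_zero, add_zero] at h3
  exact IsUnit.of_mul_eq_one _ (by rw [mul_comm]; exact h3)

namespace IsTwistedCharacter

variable {p n : ℕ} {E F : Type*} [Field E] [Field F] [Algebra E F]
  {v : AddValuation F (WithTop ℤ)} {ζ : F} {σ : ℕ → F ≃ₐ[E] F} {t : ℕ} {R : F → ZMod (p ^ n)}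
  (hR : IsTwistedCharacter v σ t R) (h : IsCyclotomicTower p n v ζ σ)

include hR

theorem map_one : R 1 = 0 := by
  have := hR.map_mul 1 1 v.map_one v.map_one
  rw [mul_one] at this
  exact left_eq_add.mp this

theorem map_div {a b : F} (ha : v a = (0 : ℤ)) (hb : v b = (0 : ℤ)) : R (a / b) = R a - R b := by
  have h1 := hR.map_mul (a / b) b (by simpa using AddValuation.map_eq_div ha hb) hb
  rw [div_mul_cancel₀ _ (AddValuation.ne_zero_of_eq_int hb)] at h1
  rw [h1, add_sub_cancel_right]

theorem map_pow {a : F} (ha : v a = (0 : ℤ)) (k : ℕ) : R (a ^ k) = k * R a := by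
  induction k with
  | zero => simp [hR.map_one]
  | succ k ih =>
    rw [pow_succ, hR.map_mul _ _ (by simpa using AddValuation.map_eq_pow ha k) ha, ih]
    push_cast; ring

include h

theorem map_cycNorm {k : ℕ} (hk : 1 ≤ k) (hkn : k ≤ n) : ∃ μ : ZMod (p ^ n), IsUnit μ ∧
    ∀ a, v a = (0 : ℤ) → R (cycNorm (h.s k) p a) = p * μ * R a := by
  obtain ⟨y, hy⟩ := hR.s_apply k hk hkn
  obtain ⟨x, hx⟩ := geom_sum_one_add_p_mul (h.prime.odd_of_ne_two h.two_lt.ne')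
    ((p : ZMod (p ^ n)) ^ (k - 1) * y)
  refine ⟨1 + p * x, ZMod.isUnit_add_p_mul isUnit_one x, fun a ha => ?_⟩
  rw [← hx, ← mul_assoc, ← pow_succ', show k - 1 + 1 = k by omega, sum_mul]
  have hi : ∀ i : ℕ, R ((h.s k ^ i) a) = (1 + (p : ZMod (p ^ n)) ^ k * y) ^ i * R a := by
    intro i
    induction i with
    | zero => simp
    | succ i ih =>
      rw [pow_succ', AlgEquiv.mul_apply]
      rw [IsCyclotomicTower.s, hy _ ((h.map_aut _ _).trans ha)]
      rw [IsCyclotomicTower.s] at ih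
      rw [ih, pow_succ]; ring
  have hN : ∀ N : ℕ, R (cycNorm (h.s k) N a) = ∑ i ∈ range N, R ((h.s k ^ i) a) := by
    intro N
    induction N with
    | zero => simp [cycNorm, hR.map_one]
    | succ N ih =>
      rw [cycNorm, prod_range_succ, sum_range_succ, ← ih]
      exact hR.map_mul _ _ ((h.map_cycNorm (h.s k) N ha).trans (by rw [mul_zero]))
          ((h.map_aut _ _).trans ha)
  rw [hN]
  exact sum_congr rfl fun i _ => hi i

end IsTwistedCharacter

namespace IsCyclotomicTower

variable {p n : ℕ} {E F : Type*} [Field E] [Field F] [Algebra E F]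
  {v : AddValuation F (WithTop ℤ)} {ζ : F} {σ : ℕ → F ≃ₐ[E] F}
  (h : IsCyclotomicTower p n v ζ σ)

include h

/-- The Galois group acts trivially on the residue field. -/
theorem map_sub_self_mem (s : F ≃ₐ[E] F) {a : F} (ha : a ∈ h.fld 1) (ha0 : a ∈ v.lev 0) :
    s a - a ∈ v.lev 1 := by
  obtain ⟨c, rfl⟩ := h.exists_sum_one ha
  have hd := h.pow_pos_int (n - 1)
  have hterm := AddValuation.mem_lev_of_sum_mem (h.terms_inj_one c) ha0
  rw [map_sum, ← sum_sub_distrib]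
  refine (v.lev 1).sum_mem fun i hi => ?_
  rw [map_mul, AlgEquiv.commutes, _root_.map_pow]
  rcases Nat.eq_zero_or_pos i with rfl | hi0
  · simp
  have h1 : algebraMap E F (c i) * (1 - h.z 1) ^ i ∈ v.lev 1 := by
    by_cases h0 : c i = 0
    · rw [h0, map_zero, zero_mul]; exact (v.lev _).zero_mem
    obtain ⟨x, hx⟩ := h.map_base _ h0
    have h2 := hterm i hi
    have hv := AddValuation.map_eq_mul hx (h.map_one_sub_z_pow le_rfl h.pos i)
    rw [AddValuation.mem_lev_iff_of_eq hv] at h2 ⊢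
    have hip := mem_range.mp hi
    have h3 : 0 ≤ (p : ℤ) ^ (n - 1) * ((p - 1) * x + i) := by linarith
    have h4 : 0 ≤ ((p : ℤ) - 1) * x + i := nonneg_of_mul_nonneg_right h3 hd
    have h5 : 0 ≤ x := by
      by_contra! hx
      have : ((p : ℤ) - 1) * x ≤ (p - 1) * (-1) := by
        apply mul_le_mul_of_nonneg_left <;> omega
      omega
    have h6 : 0 ≤ ((p : ℤ) - 1) * x := mul_nonneg (by omega) h5
    have h7 : 0 ≤ (p : ℤ) ^ (n - 1) * ((p - 1) * x) := mul_nonneg hd.le h6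
    have h8 : 1 * 1 ≤ (i : ℤ) * (p : ℤ) ^ (n - 1) :=
      mul_le_mul (by omega) (by omega) (by omega) (by omega)
    linarith
  have h2 := h.map_aut_mem s h1
  rw [map_mul, AlgEquiv.commutes, _root_.map_pow] at h2
  exact (v.lev 1).sub_mem h2 h1

end IsCyclotomicTower

end

section

open Finset IntermediateField

namespace AddValuation

variable {F : Type*} [Field F] {v : AddValuation F (WithTop ℤ)}

theorem pow_sub_pow_mem_lev {a b : F} {i : ℤ} (ha : a ∈ v.lev 0) (hb : b ∈ v.lev 0)
    (h : a - b ∈ v.lev i) (j : ℕ) : a ^ j - b ^ j ∈ v.lev i := by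
  induction j with
  | zero => simp only [pow_zero, sub_self]; exact (v.lev i).zero_mem
  | succ j ih =>
    have hb' : b ^ j ∈ v.lev 0 := by simpa using pow_mem_lev hb j
    have : a ^ (j + 1) - b ^ (j + 1) = a * (a ^ j - b ^ j) + b ^ j * (a - b) := by ring
    rw [this]
    exact (v.lev i).add_mem (mul_mem_lev_zero ha ih) (mul_mem_lev_zero hb' h)

theorem one_add_pow_sub_mem_lev {b : F} {J : ℤ} (hJ : 0 ≤ J) (hb : b ∈ v.lev J) (G : ℕ) :
    (1 + b) ^ G - 1 - G * b ∈ v.lev (2 * J) := by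
  induction G with
  | zero =>
    have : (1 + b) ^ 0 - 1 - ((0 : ℕ) : F) * b = 0 := by simp
    rw [this]; exact (v.lev _).zero_mem
  | succ G ih =>
    have : (1 + b) ^ (G + 1) - 1 - ((G + 1 : ℕ) : F) * b =
        (1 + b) * ((1 + b) ^ G - 1 - G * b) + G * (b * b) := by push_cast; ring
    rw [this]
    refine (v.lev _).add_mem (mul_mem_lev_zero ?_ ih) (mul_mem_lev_zero (natCast_mem_lev G) ?_)
    · exact (v.lev 0).add_mem one_mem_lev (lev_mono hJ hb)
    · rw [two_mul]; exact mul_mem_lev hb hb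

end AddValuation

theorem pow_sub_eq_mul_pow_sub {p n k : ℕ} (hkn : k + 1 ≤ n) :
    (p : ℤ) ^ (n - k) = p * p ^ (n - (k + 1)) := by
  rw [← pow_succ']; congr 1; omega

theorem pow_sub_one_eq_mul {p n k : ℕ} (hk : 1 ≤ k) (hkn : k ≤ n) :
    (p : ℤ) ^ (n - 1) = p ^ (n - k) * p ^ (k - 1) := by
  rw [← pow_add]; congr 1; omega

open AddValuation

namespace IsCyclotomicTower

variable {p n : ℕ} {E F : Type*} [Field E] [Field F] [Algebra E F]
  {v : AddValuation F (WithTop ℤ)} {ζ : F} {σ : ℕ → F ≃ₐ[E] F}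
  (h : IsCyclotomicTower p n v ζ σ)

include h

theorem fld_le {j k : ℕ} (hjk : j ≤ k) (hkn : k ≤ n) : h.fld j ≤ h.fld k := by
  induction k, hjk using Nat.le_induction with
  | base => exact le_rfl
  | succ k _ ih => exact (ih (by omega)).trans (h.fld_mono hkn)

theorem σ_sub_pow_mul_mem {g : ℕ} (hg : g.Coprime p) {j : ℕ} {b : F}
    (hb : b ∈ h.fld 1) (hbj : b ∈ v.lev (p ^ (n - 1) * j)) :
    σ g b - g ^ j * b ∈ v.lev (p ^ (n - 1) * j + 1) := by
  have hπ := h.map_one_sub_z_pow le_rfl h.pos j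
  have hπ0 := ne_zero_of_eq_int hπ
  have hπmem : 1 - h.z 1 ∈ h.fld 1 := sub_mem (one_mem _) (h.z_mem 1)
  set a := b / (1 - h.z 1) ^ j with ha
  have hamem : a ∈ h.fld 1 := div_mem hb (pow_mem hπmem j)
  have ha0 : a ∈ v.lev 0 := lev_mono (by rw [mul_comm]; simp) (div_mem_lev hbj hπ)
  have hba : b = a * (1 - h.z 1) ^ j := by rw [ha, div_mul_cancel₀ _ hπ0]
  set θ := ∑ i ∈ range g, h.z 1 ^ i with hθ
  have hσπ : σ g (1 - h.z 1) = (1 - h.z 1) * θ := by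
    rw [_root_.map_sub, _root_.map_one, h.σ_z hg, hθ, mul_neg_geom_sum]
  have hz0 : h.z 1 ∈ v.lev 0 := (mem_lev_iff_of_eq (h.map_z h.pos)).mpr le_rfl
  have hθg : θ - g ∈ v.lev 1 := by
    have : θ - g = ∑ i ∈ range g, (h.z 1 ^ i - 1) := by
      rw [sum_sub_distrib, hθ]; simp
    rw [this]
    refine (v.lev 1).sum_mem fun i _ => ?_
    have := pow_sub_pow_mem_lev (i := 1) hz0 one_mem_lev (?_ : h.z 1 - 1 ∈ v.lev 1) i
    · simpa using this
    · rw [← neg_sub]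
      refine (v.lev 1).neg_mem ?_
      rw [mem_lev_iff_of_eq (h.map_one_sub_z le_rfl h.pos)]
      exact h.pow_pos_int _
  have hg0 : (g : F) ∈ v.lev 0 := natCast_mem_lev g
  have hθ0 : θ ∈ v.lev 0 := by
    have := (v.lev 0).add_mem (lev_mono (by norm_num) hθg) hg0
    rwa [sub_add_cancel] at this
  have hθj := pow_sub_pow_mem_lev hθ0 hg0 hθg j
  have hθj0 : θ ^ j ∈ v.lev 0 := by simpa using pow_mem_lev hθ0 j
  have key : σ g b - g ^ j * b =
      (1 - h.z 1) ^ j * (θ ^ j * (σ g a - a) + a * (θ ^ j - g ^ j)) := by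
    rw [hba, _root_.map_mul, _root_.map_pow, hσπ, mul_pow]; ring
  rw [key]
  refine mul_mem_lev ((mem_lev_iff_of_eq hπ).mpr (by rw [mul_comm])) ?_
  exact (v.lev 1).add_mem (mul_mem_lev_zero hθj0 (h.map_sub_self_mem _ hamem ha0))
    (mul_mem_lev_zero ha0 hθj)

theorem exists_cycNorm_close {k : ℕ} (hk : 1 ≤ k) (hkn : k + 1 ≤ n) {j : ℕ} (hj : 1 ≤ j)
    (hje : (j : ℤ) + 1 ≤ p ^ (k - 1) * (p - 1)) {w : F} (hw : w ∈ h.fld k)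
    (hwj : w - 1 ∈ v.lev (p ^ (n - k) * j)) :
    ∃ w₂ ∈ h.fld (k + 1), w₂ - 1 ∈ v.lev (p ^ (n - (k + 1)) * j) ∧
      w / cycNorm (h.s k) p w₂ - 1 ∈ v.lev (p ^ (n - k) * (j + 1)) := by
  have hπ := h.map_one_sub_z_pow hk (by omega) j
  have hπ0 := ne_zero_of_eq_int hπ
  have hπmem : 1 - h.z k ∈ h.fld k := sub_mem (one_mem _) (h.z_mem k)
  have hπ' := h.map_one_sub_z_pow (k := k + 1) (by omega) hkn j
  have hπmem' : 1 - h.z (k + 1) ∈ h.fld (k + 1) := sub_mem (one_mem _) (h.z_mem _)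
  obtain ⟨f, hf⟩ := h.residue
  set a := (w - 1) / (1 - h.z k) ^ j with ha
  have hamem : a ∈ h.fld k := div_mem (sub_mem hw (one_mem _)) (pow_mem hπmem j)
  have ha0 : a ∈ v.lev 0 := lev_mono (by rw [mul_comm]; simp) (div_mem_lev hwj hπ)
  have hba : w = 1 + a * (1 - h.z k) ^ j := by rw [ha, div_mul_cancel₀ _ hπ0]; ring
  have hapf : a ^ p ^ f ∈ v.lev 0 := by simpa using pow_mem_lev ha0 (p ^ f)
  have hγ0 : (1 - h.z (k + 1)) ^ j ∈ v.lev 0 :=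
    (mem_lev_iff_of_eq hπ').mpr (mul_nonneg (by positivity) (h.pow_pos_int _).le)
  have hw₂ : (1 + a ^ p ^ f * (1 - h.z (k + 1)) ^ j) - 1 ∈ v.lev (p ^ (n - (k + 1)) * j) := by
    rw [add_sub_cancel_left]
    exact mul_mem_lev_zero hapf ((mem_lev_iff_of_eq hπ').mpr (by rw [mul_comm]))
  have hmem : 1 + a ^ p ^ f * (1 - h.z (k + 1)) ^ j ∈ h.fld (k + 1) :=
    add_mem (one_mem _) (mul_mem (pow_mem (h.fld_mono hkn hamem) _) (pow_mem hπmem' _))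
  refine ⟨_, hmem, hw₂, ?_⟩
  have hd := h.pow_pos_int (n - k)
  have hd' := h.pow_pos_int (n - (k + 1))
  have hN := h.cycNorm_sub_mem hk hkn le_rfl (pow_mem hπmem' j) hγ0 (pow_mem hamem (p ^ f)) hapf
  rw [cycNorm_pow, h.cycNorm_one_sub_z hk hkn, ← pow_mul, ← pow_succ, add_zero] at hN
  have hlev : p ^ (n - k) * (j : ℤ) + 1 ≤ p ^ (n - 1) * (p - 1) := by
    rw [pow_sub_one_eq_mul hk (by omega : k ≤ n)]; nlinarith
  have hNw : cycNorm (h.s k) p (1 + a ^ p ^ f * (1 - h.z (k + 1)) ^ j) - w ∈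
      v.lev (p ^ (n - k) * j + 1) := by
    have := (v.lev (p ^ (n - k) * (j : ℤ) + 1)).add_mem (lev_mono hlev hN)
      (mul_mem_lev ((mem_lev_iff_of_eq hπ).mpr (le_of_eq (mul_comm _ _))) (hf a ha0))
    convert this using 1
    linear_combination -hba
  have hv2 : v (cycNorm (h.s k) p (1 + a ^ p ^ f * (1 - h.z (k + 1)) ^ j)) = (0 : ℤ) :=
    (h.map_cycNorm (h.s k) p (map_eq_zero_of_sub_one_mem (by positivity) hw₂)).trans
      (by rw [mul_zero])
  refine h.mem_lev_of_mem_fld hk (by omega)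
    (sub_mem (div_mem hw (h.cycNorm_mem_fld hk hkn hmem)) (one_mem _)) ?_
  rw [div_sub_one (ne_zero_of_eq_int hv2)]
  have := div_mem_lev ((v.lev _).neg_mem hNw) hv2
  rwa [neg_sub, sub_zero] at this

/-- A `p`-th root close to `1` lies in the same layer of the tower. -/
theorem mem_fld_of_pow_mem {k : ℕ} (hk : 1 ≤ k) (hkn : k ≤ n) {w : F} {s : ℤ}
    (hs : (p : ℤ) ^ (n - 1) < s) (hw : w - 1 ∈ v.lev s) (hwp : w ^ p ∈ h.fld k) :
    w ∈ h.fld k := by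
  have hspos : 0 < s := (h.pow_pos_int (n - 1)).trans hs
  suffices hd : ∀ d j, j = n - d → k ≤ j → d ≤ n → w ∈ h.fld j from
    hd (n - k) k (by omega) le_rfl (by omega)
  intro d
  induction d with
  | zero =>
    intro j hj _ _
    rw [show j = n from hj, h.fld_top]; trivial
  | succ d ih =>
    intro j hj hkj hdn
    have hj1 : j + 1 ≤ n := by omega
    have hw1 := ih (j + 1) (by omega) (by omega) (by omega)
    refine h.mem_fld_of_s_fix (by omega) hj1 hw1 ?_
    have hw0 := map_eq_zero_of_sub_one_mem hspos hw
    have hwne := ne_zero_of_eq_int hw0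
    have hsw : h.s j w - 1 ∈ v.lev s := by simpa using h.map_aut_mem (h.s j) hw
    have hη := div_sub_one_mem hspos hsw hw
    have hηp : (h.s j w / w) ^ p = 1 := by
      rw [div_pow, ← _root_.map_pow, h.s_fix hkj (by omega) (by omega) hwp,
        div_self (pow_ne_zero _ hwne)]
    have : NeZero p := ⟨h.prime.ne_zero⟩
    obtain ⟨i, hip, hi⟩ := h.isPrimitiveRoot_ω.eq_pow_of_pow_eq_one hηp
    have : i = 0 := by
      by_contra hi0
      have hic := h.coprime_of_lt (Nat.pos_of_ne_zero hi0) hip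
      rw [← hi, ← h.σ_z hic] at hη
      have h1 : v (σ i (h.z 1) - 1) = ((p : ℤ) ^ (n - 1) : ℤ) := by
        rw [← h.map_one_sub_z le_rfl h.pos, ← h.map_aut (σ i) (1 - h.z 1), ← v.map_neg]
        simp
      rw [mem_lev_iff_of_eq h1] at hη
      omega
    rw [this, pow_zero] at hi
    exact (div_eq_one_iff_eq hwne).mp hi.symm

/-- Hilbert 90 in the layers of the tower. -/
theorem exists_eq_s_div {k : ℕ} (hk : 1 ≤ k) (hkn : k + 1 ≤ n) {a : F} (ha : a ∈ h.fld (k + 1))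
    (hN : cycNorm (h.s k) p a = 1) : ∃ c ∈ h.fld (k + 1), c ≠ 0 ∧ a = h.s k c / c := by
  have hpow : ∀ i : ℕ, ∀ x, ((h.s k : F ≃+* F) ^ i) x = (h.s k ^ i) x := by
    intro i
    induction i with
    | zero => intro x; rfl
    | succ i ih => intro x; rw [pow_succ, RingAut.mul_apply, ih, pow_succ]; rfl
  refine exists_div_eq_of_prod_eq_one (h.s k : F ≃+* F) (h.fld (k + 1)).toSubfield h.prime.pos
    (fun x hx => h.s_mem hk hx) (fun x hx => ?_) (fun i hi hip => ?_) a ha ?_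
  · rw [hpow]; exact h.s_pow_p hk hkn hx
  · refine ⟨h.z (k + 1), h.z_mem _, ?_⟩
    rw [hpow, h.s_pow_z hk hkn]
    intro hc
    have hz0 : h.z (k + 1) ≠ 0 := ne_zero_of_eq_int (h.map_z hkn)
    exact h.isPrimitiveRoot_ω.pow_ne_one_of_pos_of_lt hi.ne' hip
      (mul_left_cancel₀ hz0 (hc.trans (mul_one _).symm))
  · rw [← hN, cycNorm]
    exact prod_congr rfl fun i _ => hpow i a

theorem exists_eq_s_div_of_mem_lev {k : ℕ} (hk : 1 ≤ k) (hkn : k + 1 ≤ n) {a : F}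
    (ha : a ∈ h.fld (k + 1)) (hN : cycNorm (h.s k) p a = 1) {T : ℤ}
    (hT : (p : ℤ) ^ (n - 1) - p ^ (n - (k + 1)) < T) (haT : a - 1 ∈ v.lev T) :
    ∃ c ∈ h.fld (k + 1), c - 1 ∈ v.lev (T - (p ^ (n - 1) - p ^ (n - (k + 1)))) ∧
      a = h.s k c / c := by
  obtain ⟨c, hc, hc0, rfl⟩ := h.exists_eq_s_div hk hkn ha hN
  obtain ⟨j, hj⟩ := exists_eq_int (v := v) hc0
  obtain ⟨b, hb, hcb⟩ := h.exists_close hk hkn hc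
  have h1 : h.s k c - c ∈ v.lev (j + T) := by
    have := mul_mem_lev ((mem_lev_iff_of_eq hj).mpr le_rfl) haT
    rwa [mul_sub, mul_one, mul_div_cancel₀ _ hc0] at this
  have h2 := hcb _ h1
  have hbj : v b = j := by
    have := map_add_eq hj ((v.lev _).neg_mem (lev_mono (i := j + 1) (by omega) h2))
    rwa [neg_sub, add_sub_cancel] at this
  have hb0 := ne_zero_of_eq_int hbj
  refine ⟨c / b, div_mem hc (h.fld_mono hkn hb), ?_, ?_⟩
  · rw [div_sub_one hb0]
    exact lev_mono (by omega) (div_mem_lev h2 hbj)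
  · rw [map_div₀, h.s_fix le_rfl (by omega) hk hb, div_div_div_cancel_right₀ hb0]

end IsCyclotomicTower

end

section

open Finset IntermediateField AddValuation

namespace IsTwistedCharacter

variable {p n : ℕ} {E F : Type*} [Field E] [Field F] [Algebra E F]
  {v : AddValuation F (WithTop ℤ)} {ζ : F} {σ : ℕ → F ≃ₐ[E] F} {t : ℕ} {R : F → ZMod (p ^ n)}
  (hR : IsTwistedCharacter v σ t R) (h : IsCyclotomicTower p n v ζ σ)

include hR h

theorem exists_raise_level_succ {j : ℕ} (hj : 1 ≤ j) (hjt : ¬ j ≡ t - 1 [MOD (p - 1)]) {w : F}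
    (hw : w ∈ h.fld 1) (hwj : w - 1 ∈ v.lev (p ^ (n - 1) * j)) :
    ∃ w' ∈ h.fld 1, w' - 1 ∈ v.lev (p ^ (n - 1) * (j + 1)) ∧
      ∃ μ : ZMod (p ^ n), IsUnit μ ∧ R w' = μ * R w := by
  have : Fact p.Prime := ⟨h.prime⟩
  obtain ⟨g, hg, hgm⟩ := exists_nat_primitiveRoot p
  obtain ⟨y, hy⟩ := hR.σ_apply g hg
  have hpos := h.pow_pos_int (n - 1)
  have hJ : 1 ≤ (p : ℤ) ^ (n - 1) * j := by
    have : (1 : ℤ) * 1 ≤ (p : ℤ) ^ (n - 1) * j :=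
      mul_le_mul (by omega) (by omega) (by omega) (by omega)
    omega
  have hw0 := map_eq_zero_of_sub_one_mem (by omega) hwj
  have hwG : v (w ^ g ^ j) = (0 : ℤ) := by simpa using map_eq_pow hw0 (g ^ j)
  have hσw : v (σ g w) = (0 : ℤ) := (h.map_aut _ _).trans hw0
  refine ⟨σ g w / w ^ g ^ j, div_mem (h.σ_mem hg hw) (pow_mem hw _), ?_, _,
    ZMod.isUnit_add_p_mul (ZMod.isUnit_pow_sub_pow h.prime fun hc => hjt (hgm _ _ hc).symm) y, ?_⟩
  · refine h.mem_lev_of_mem_fld le_rfl h.pos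
      (sub_mem (div_mem (h.σ_mem hg hw) (pow_mem hw _)) (one_mem _)) ?_
    have h1 := h.σ_sub_pow_mul_mem hg (sub_mem hw (one_mem _)) hwj
    have h2 := lev_mono (i := (p : ℤ) ^ (n - 1) * j + 1) (by omega)
      (one_add_pow_sub_mem_lev (by omega) hwj (g ^ j))
    have h3 := (v.lev _).sub_mem h1 h2
    rw [div_sub_one (ne_zero_of_eq_int hwG)]
    have h4 := div_mem_lev h3 hwG
    rw [sub_zero] at h4
    convert h4 using 2
    rw [_root_.map_sub, _root_.map_one]
    push_cast
    ring
  · rw [hR.map_div hσw hwG, hR.map_pow hw0, hy w hw0]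
    push_cast
    ring

theorem exists_raise_level {a : ℕ} (ha : 1 ≤ a) {w : F} (hw : w ∈ h.fld 1)
    (hwa : w - 1 ∈ v.lev (p ^ (n - 1) * a)) (N : ℕ)
    (hN : ∀ i < N, ¬ a + i ≡ t - 1 [MOD (p - 1)]) :
    ∃ w' ∈ h.fld 1, w' - 1 ∈ v.lev (p ^ (n - 1) * (a + N)) ∧
      ∃ μ : ZMod (p ^ n), IsUnit μ ∧ R w' = μ * R w := by
  induction N with
  | zero => exact ⟨w, hw, by simpa using hwa, 1, isUnit_one, (one_mul _).symm⟩
  | succ N ih =>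
    obtain ⟨w₁, hw₁, hl₁, μ₁, hμ₁, hRw₁⟩ := ih fun i hi => hN i (by omega)
    obtain ⟨w₂, hw₂, hl₂, μ₂, hμ₂, hRw₂⟩ := hR.exists_raise_level_succ h (j := a + N) (by omega)
      (hN N (by omega)) hw₁ (by exact_mod_cast hl₁)
    refine ⟨w₂, hw₂, ?_, μ₂ * μ₁, hμ₂.mul hμ₁, by rw [hRw₂, hRw₁, mul_assoc]⟩
    convert hl₂ using 3
    push_cast; ring

theorem exists_eq_add_of_level (d : ℕ) : ∀ k, 1 ≤ k → k + d = n → ∀ j : ℕ, 1 ≤ j →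
    (j : ℤ) + 1 ≤ p ^ (k - 1) * (p - 1) → ∀ w ∈ h.fld k, w - 1 ∈ v.lev (p ^ (n - k) * j) →
    ∃ w₀ ∈ h.fld k, w₀ - 1 ∈ v.lev (p ^ (n - k) * (j + 1)) ∧
      ∃ ρ : ZMod (p ^ n), R w = p ^ d * ρ + R w₀ := by
  induction d with
  | zero =>
    intro k hk hkd j hj hje w hw hwj
    refine ⟨1, one_mem _, by rw [sub_self]; exact (v.lev _).zero_mem, R w, ?_⟩
    rw [hR.map_one, pow_zero, one_mul, add_zero]
  | succ d ih =>
    intro k hk hkd j hj hje w hw hwj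
    have hkn : k + 1 ≤ n := by omega
    have hq := h.pow_pos_int (n - k)
    have hq' := h.pow_pos_int (n - (k + 1))
    obtain ⟨w₂, hw₂, hl₂, hl⟩ := h.exists_cycNorm_close hk hkn hj hje hw hwj
    have hppos := h.prime.one_lt
    obtain ⟨w₀, hw₀, hl₀, ρ, hρ⟩ := ih (k + 1) (by omega) (by omega) j hj (by
      refine hje.trans (mul_le_mul_of_nonneg_right ?_ (by omega))
      exact pow_le_pow_right₀ (by omega) (by omega)) w₂ hw₂ hl₂
    obtain ⟨μ, hμ, hN⟩ := hR.map_cycNorm h hk (by omega)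
    have hv₂ : v w₂ = (0 : ℤ) := map_eq_zero_of_sub_one_mem (by positivity) hl₂
    have hv₀ : v w₀ = (0 : ℤ) := map_eq_zero_of_sub_one_mem (by positivity) hl₀
    have hvq : v (w / cycNorm (h.s k) p w₂) = (0 : ℤ) :=
      map_eq_zero_of_sub_one_mem (by positivity) hl
    have hvN₂ : v (cycNorm (h.s k) p w₂) = (0 : ℤ) :=
      (h.map_cycNorm _ _ hv₂).trans (by rw [mul_zero])
    have hvN₀ : v (cycNorm (h.s k) p w₀) = (0 : ℤ) :=
      (h.map_cycNorm _ _ hv₀).trans (by rw [mul_zero])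
    have hlN₀ : cycNorm (h.s k) p w₀ - 1 ∈ v.lev (p ^ (n - k) * (j + 1)) := by
      refine h.cycNorm_sub_one_mem hk hkn (by positivity) hw₀ hl₀ ?_ ?_
      · rw [pow_sub_eq_mul_pow_sub hkn, mul_assoc]
      · rw [pow_sub_one_eq_mul hk (by omega : k ≤ n), mul_assoc]
        exact mul_le_mul_of_nonneg_left hje hq.le
    refine ⟨cycNorm (h.s k) p w₀ * (w / cycNorm (h.s k) p w₂),
      mul_mem (h.cycNorm_mem_fld hk hkn hw₀) (div_mem hw (h.cycNorm_mem_fld hk hkn hw₂)),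
      mul_sub_one_mem (by positivity) hlN₀ hl, μ * ρ, ?_⟩
    have hw' : w = cycNorm (h.s k) p w₂ * (w / cycNorm (h.s k) p w₂) :=
      (mul_div_cancel₀ _ (ne_zero_of_eq_int hvN₂)).symm
    calc R w = R (cycNorm (h.s k) p w₂) + R (w / cycNorm (h.s k) p w₂) := by
          rw [← hR.map_mul _ _ hvN₂ hvq, ← hw']
      _ = _ := by rw [hR.map_mul _ _ hvN₀ hvq, hN _ hv₂, hN _ hv₀, hρ]; ring

variable (ht : 3 ≤ t) (htp : t + 1 ≤ p)

include ht htp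

theorem exists_eq_p_mul {w : F} (hw : w ∈ h.fld 1) (hwt : w - 1 ∈ v.lev (p ^ (n - 1) * t)) :
    ∃ w₀ ∈ h.fld 1, w₀ - 1 ∈ v.lev (p ^ (n - 1) * t) ∧ ∃ μ : ZMod (p ^ n),
      R w = p * μ * R w₀ := by
  have hpos := h.pow_pos_int (n - 1)
  obtain ⟨w', hw', hl', μ, hμ, hRw'⟩ := hR.exists_raise_level h (a := t) (by omega) hw hwt (p - 2)
    (fun i hi hc => by
      have h1 := (Nat.modEq_iff_dvd' (show t - 1 ≤ t + i by omega)).mp hc.symm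
      have := Nat.le_of_dvd (by omega) h1
      omega)
  have hlev : (p : ℤ) ^ (n - 1) * (t + (p - 2 : ℕ)) =
      p ^ (n - 1) * (p - 1) + p ^ (n - 1) * ((t - 1 : ℕ) : ℤ) := by
    rw [← mul_add]; congr 1; push_cast [show 2 ≤ p by omega, show 1 ≤ t by omega]; ring
  rw [hlev] at hl'
  have hs : (p : ℤ) ^ (n - 1) < p ^ (n - 1) * ((t - 1 : ℕ) : ℤ) :=
    (lt_mul_iff_one_lt_right hpos).mpr (by omega)
  obtain ⟨w₁, hw₁p, hl₁⟩ := h.hensel _ _ hs hl'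
  rw [add_sub_cancel] at hw₁p
  have hw₁ := h.mem_fld_of_pow_mem le_rfl h.pos hs hl₁ (hw₁p ▸ hw')
  have hv₁ := map_eq_zero_of_sub_one_mem (hpos.trans hs) hl₁
  obtain ⟨w₀, hw₀, hl₀, ρ, hρ⟩ := hR.exists_eq_add_of_level h (n - 1) 1 le_rfl
    (by have := h.pos; omega) (t - 1) (by omega) (by simp; omega) w₁ hw₁ hl₁
  rw [show ((t - 1 : ℕ) : ℤ) + 1 = t by omega] at hl₀
  obtain ⟨ν, hν⟩ := hμ.exists_left_inv
  refine ⟨w₀, hw₀, hl₀, ν, ?_⟩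
  have hpn : (p : ZMod (p ^ n)) * p ^ (n - 1) = 0 := by
    rw [← pow_succ', show n - 1 + 1 = n by have := h.pos; omega, ← Nat.cast_pow,
      ZMod.natCast_self]
  calc R w = ν * R w' := by rw [hRw', ← mul_assoc, hν, one_mul]
    _ = ν * (p * (p ^ (n - 1) * ρ + R w₀)) := by rw [← hρ, ← hw₁p, hR.map_pow hv₁]
    _ = ν * ρ * (p * p ^ (n - 1)) + p * ν * R w₀ := by ring
    _ = _ := by rw [hpn]; ring

theorem eq_zero_of_level_one {w : F} (hw : w ∈ h.fld 1) (hwt : w - 1 ∈ v.lev (p ^ (n - 1) * t)) :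
    R w = 0 := by
  have : ∀ i : ℕ, ∃ w₀ ∈ h.fld 1, w₀ - 1 ∈ v.lev (p ^ (n - 1) * t) ∧ ∃ μ : ZMod (p ^ n),
      R w = p ^ i * μ * R w₀ := by
    intro i
    induction i with
    | zero => exact ⟨w, hw, hwt, 1, by ring⟩
    | succ i ih =>
      obtain ⟨w₀, hw₀, hl₀, μ, hμ⟩ := ih
      obtain ⟨w₁, hw₁, hl₁, μ₁, hμ₁⟩ := hR.exists_eq_p_mul h ht htp hw₀ hl₀
      exact ⟨w₁, hw₁, hl₁, μ * μ₁, by rw [hμ, hμ₁]; ring⟩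
  obtain ⟨w₀, -, -, μ, hμ⟩ := this n
  rw [hμ, ← Nat.cast_pow, ZMod.natCast_self, zero_mul, zero_mul]

omit ht in
theorem pow_mul_eq_zero_of_level {m : ℕ} (hm : 1 ≤ m)
    (hzero : ∀ w ∈ h.fld m, w - 1 ∈ v.lev (p ^ (n - 1) * t) → R w = 0) {k : ℕ} (hmk : m ≤ k)
    (hkn : k ≤ n) : ∀ u ∈ h.fld k, u - 1 ∈ v.lev (p ^ (n - k) * (p ^ (m - 1) * t)) →
      v u = (0 : ℤ) → (p : ZMod (p ^ n)) ^ (k - m) * R u = 0 := by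
  induction k, hmk using Nat.le_induction with
  | base =>
    intro u hu hl _
    rw [← mul_assoc, ← pow_sub_one_eq_mul hm hkn] at hl
    rw [hzero u hu hl, mul_zero]
  | succ k hmk ih =>
    intro u hu hl hu0
    have hk : 1 ≤ k := hm.trans hmk
    have hq := h.pow_pos_int (n - k)
    have hq' := h.pow_pos_int (n - (k + 1))
    have hm' := h.pow_pos_int (m - 1)
    obtain ⟨μ, hμ, hN⟩ := hR.map_cycNorm h hk (by omega)
    have h1 := ih (by omega) _ (h.cycNorm_mem_fld hk hkn hu) (h.cycNorm_sub_one_mem hk hkn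
      (by positivity) hu hl (by rw [pow_sub_eq_mul_pow_sub hkn, mul_assoc]) (by
        rw [pow_sub_one_eq_mul hk (by omega : k ≤ n), mul_assoc]
        refine mul_le_mul_of_nonneg_left (mul_le_mul ?_ (by omega) (by omega) (by positivity)) hq.le
        exact pow_le_pow_right₀ (by omega) (by omega)))
      ((h.map_cycNorm _ _ hu0).trans (by rw [mul_zero]))
    rw [hN _ hu0] at h1
    refine (hμ.mul_right_eq_zero).mp ?_
    rw [← h1, show k + 1 - m = k - m + 1 by omega, pow_succ]
    ring

end IsTwistedCharacter

end

section

open Finset IntermediateField AddValuation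

namespace IsTwistedCharacter

variable {p n : ℕ} {E F : Type*} [Field E] [Field F] [Algebra E F]
  {v : AddValuation F (WithTop ℤ)} {ζ : F} {σ : ℕ → F ≃ₐ[E] F} {t : ℕ} {R : F → ZMod (p ^ n)}
  (hR : IsTwistedCharacter v σ t R) (h : IsCyclotomicTower p n v ζ σ)
  (ht : 3 ≤ t) (htp : t + 1 ≤ p)

include hR h ht htp

theorem eq_zero_of_cycNorm_eq_one {k : ℕ} (hk : 1 ≤ k) (hkn : k + 1 ≤ n) {a : F}
    (ha : a ∈ h.fld (k + 1)) (hN : cycNorm (h.s k) p a = 1) {T : ℤ}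
    (hT : p ^ (n - (k + 1)) * (t : ℤ) ≤ T - (p ^ (n - 1) - p ^ (n - (k + 1))))
    (haT : a - 1 ∈ v.lev T) : R a = 0 := by
  have hq' := h.pow_pos_int (n - (k + 1))
  have htpos : 0 < (p : ℤ) ^ (n - (k + 1)) * t := by positivity
  obtain ⟨c, hc, hcl, rfl⟩ := h.exists_eq_s_div_of_mem_lev hk hkn ha hN (by omega) haT
  have hc0 : v c = (0 : ℤ) := map_eq_zero_of_sub_one_mem (by omega) hcl
  have h1 := hR.pow_mul_eq_zero_of_level h htp le_rfl
    (fun w hw hl => hR.eq_zero_of_level_one h ht htp hw hl) (k := k + 1) (by omega) hkn c hc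
    (by rw [Nat.sub_self, pow_zero, one_mul]; exact lev_mono hT hcl) hc0
  obtain ⟨y, hy⟩ := hR.s_apply k hk (by omega)
  rw [hR.map_div ((h.map_aut _ _).trans hc0) hc0, IsCyclotomicTower.s, hy c hc0]
  rw [Nat.add_sub_cancel] at h1
  linear_combination y * h1

theorem eq_zero_of_level {k : ℕ} (hk : 1 ≤ k) (hkn : k ≤ n) : ∀ w ∈ h.fld k,
    w - 1 ∈ v.lev (p ^ (n - 1) * t) → R w = 0 := by
  induction k, hk using Nat.le_induction with
  | base => exact fun w hw hl => hR.eq_zero_of_level_one h ht htp hw hl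
  | succ k hk ih =>
    intro w hw hl
    have hk1 : k ≤ n := by omega
    have hpos := h.pow_pos_int (n - 1)
    have hπ := h.map_one_sub_z_pow le_rfl h.pos t
    have hπ0 := ne_zero_of_eq_int hπ
    have hπmem : 1 - h.z 1 ∈ h.fld k :=
      sub_mem (one_mem _) (h.fld_le hk hk1 (h.z_mem 1))
    have htpos : (p : ℤ) ^ (n - 1) < p ^ (n - 1) * t :=
      (lt_mul_iff_one_lt_right hpos).mpr (by omega)
    set γ := (w - 1) / (1 - h.z 1) ^ t with hγ
    have hγmem : γ ∈ h.fld (k + 1) :=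
      div_mem (sub_mem hw (one_mem _)) (pow_mem (h.fld_mono hkn hπmem) _)
    have hγ0 : γ ∈ v.lev 0 := lev_mono (by rw [mul_comm]; simp) (div_mem_lev hl hπ)
    have hwγ : w = 1 + (1 - h.z 1) ^ t * γ := by rw [hγ, mul_div_cancel₀ _ hπ0]; ring
    have hb : (1 - h.z 1) ^ t ∈ v.lev (p ^ (n - 1) * t) :=
      (mem_lev_iff_of_eq hπ).mpr (le_of_eq (mul_comm _ _))
    have hN := h.cycNorm_one_add_mul hk hkn (by positivity) hγmem hγ0 (pow_mem hπmem t) hb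
    rw [← hwγ] at hN
    have htr := mul_mem_lev hb (h.trace_mem_lev hk hkn hγmem hγ0)
    have hbp := mul_mem_lev (pow_mem_lev hb p) (h.cycNorm_mem_lev (h.s k) p hγ0)
    have hβ : cycNorm (h.s k) p w - 1 ∈ v.lev (p ^ (n - 1) * (p - 1) + p ^ (n - 1) * t) := by
      have h1 := (v.lev (p ^ (n - 1) * (p - 1) + p ^ (n - 1) * (t : ℤ))).add_mem
        (lev_mono (by linarith) hN) ((v.lev _).add_mem (lev_mono (by linarith) htr)
        (lev_mono ?_ hbp))
      · convert h1 using 1; ring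
      · have : (1 : ℤ) * (p ^ (n - 1) * (p - 1)) ≤ t * (p ^ (n - 1) * (p - 1)) :=
          mul_le_mul_of_nonneg_right (by omega) h.map_p_nonneg
        linarith
    obtain ⟨w₁, hw₁p, hl₁⟩ := h.hensel _ _ htpos hβ
    rw [add_sub_cancel] at hw₁p
    have hw₁ := h.mem_fld_of_pow_mem hk hk1 htpos hl₁ (hw₁p ▸ h.cycNorm_mem_fld hk hkn hw)
    have hv := map_eq_zero_of_sub_one_mem (hpos.trans htpos) hl
    have hv₁ := map_eq_zero_of_sub_one_mem (hpos.trans htpos) hl₁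
    have hN1 : cycNorm (h.s k) p (w / w₁) = 1 := by
      rw [cycNorm_div, cycNorm_of_fixed (h.s_fix le_rfl hk1 hk hw₁), hw₁p]
      exact div_self (ne_zero_of_eq_int ((h.map_cycNorm (h.s k) p hv).trans (by rw [mul_zero])))
    have hq' := h.pow_pos_int (n - (k + 1))
    have h2 := hR.eq_zero_of_cycNorm_eq_one h ht htp hk hkn (div_mem hw (h.fld_mono hkn hw₁)) hN1
      (T := p ^ (n - 1) * t) (by
        have h3 : (p : ℤ) ^ (n - (k + 1)) ≤ p ^ (n - 1) :=
          pow_le_pow_right₀ (by omega) (by omega)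
        have : (p : ℤ) ^ (n - (k + 1)) * (t - 1) ≤ p ^ (n - 1) * (t - 1) :=
          mul_le_mul_of_nonneg_right h3 (by omega)
        linarith) (div_sub_one_mem (hpos.trans htpos) hl hl₁)
    rwa [hR.map_div hv hv₁, ih hk1 w₁ hw₁ hl₁, sub_zero] at h2

theorem exists_ne_zero_level_one : ∃ w ∈ h.fld 1,
    w - 1 ∈ v.lev (p ^ (n - 1) * t - p ^ (n - 1)) ∧ R w ≠ 0 := by
  have hpos := h.pow_pos_int (n - 1)
  have hdown : ∀ d k, k + d = n → 1 ≤ k → ∃ c ∈ h.fld k, v c = (0 : ℤ) ∧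
      ∃ μ : ZMod (p ^ n), IsUnit μ ∧ R c = p ^ d * μ := by
    intro d
    induction d with
    | zero =>
      intro k hk _
      obtain ⟨c, hc, hRc⟩ := hR.exists_one
      refine ⟨c, ?_, hc, 1, isUnit_one, by rw [hRc, pow_zero, one_mul]⟩
      rw [show k = n from hk, h.fld_top]; trivial
    | succ d ih =>
      intro k hk hk1
      obtain ⟨c, hc, hvc, μ, hμ, hRc⟩ := ih (k + 1) (by omega) (by omega)
      obtain ⟨ν, hν, hN⟩ := hR.map_cycNorm h hk1 (by omega)
      exact ⟨_, h.cycNorm_mem_fld hk1 (by omega) hc,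
        (h.map_cycNorm _ _ hvc).trans (by rw [mul_zero]), ν * μ, hν.mul hμ,
        by rw [hN c hvc, hRc]; ring⟩
  have hnpos := h.pos
  obtain ⟨c, hc, hvc, μ, hμ, hRc⟩ := hdown (n - 1) 1 (by omega) le_rfl
  obtain ⟨f, hf⟩ := h.residue
  have hq : 1 ≤ p ^ (f + 1) := Nat.one_le_pow _ _ h.prime.pos
  have hl : c ^ (p ^ (f + 1) - 1) - 1 ∈ v.lev (p ^ (n - 1) * (1 : ℕ)) := by
    have h1 := div_mem_lev (hf c ((mem_lev_iff_of_eq hvc).mpr le_rfl)) hvc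
    have h2 : (c ^ p ^ (f + 1) - c) / c = c ^ (p ^ (f + 1) - 1) - 1 := by
      rw [sub_div, div_self (ne_zero_of_eq_int hvc), pow_sub₀ _ (ne_zero_of_eq_int hvc) hq,
        pow_one, div_eq_mul_inv]
    rw [h2, sub_zero] at h1
    have := h.mem_lev_of_mem_fld le_rfl h.pos (sub_mem (pow_mem hc _) (one_mem _)) (j := 0)
      (by simpa using h1)
    simpa using this
  obtain ⟨w, hw, hwl, ν, hν, hRw⟩ := hR.exists_raise_level h le_rfl (pow_mem hc _) hl (t - 2)
    (fun i hi hc => by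
      have h1 := (Nat.modEq_iff_dvd' (show 1 + i ≤ t - 1 by omega)).mp hc
      have := Nat.le_of_dvd (by omega) h1
      omega)
  refine ⟨w, hw, ?_, ?_⟩
  · convert hwl using 2
    push_cast [show 2 ≤ t by omega]
    ring
  have hpn : (p : ZMod (p ^ n)) ^ (f + 1) * p ^ (n - 1) = 0 := by
    rw [← pow_add, show f + 1 + (n - 1) = n + f by omega, pow_add, ← Nat.cast_pow,
      ZMod.natCast_self, zero_mul]
  have hne : (p : ZMod (p ^ n)) ^ (n - 1) ≠ 0 := by
    rw [← Nat.cast_pow, Ne, ZMod.natCast_eq_zero_iff]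
    intro hd
    have := (Nat.pow_dvd_pow_iff_le_right h.prime.one_lt).mp hd
    omega
  rw [hRw, hR.map_pow hvc, hRc, Ne, hν.mul_right_eq_zero]
  push_cast [hq]
  intro h0
  have h1 : (p : ZMod (p ^ n)) ^ (n - 1) * μ = 0 := by linear_combination μ * hpn - h0
  exact hne (hμ.mul_left_eq_zero.mp h1)

theorem exists_ne_zero_level {k : ℕ} (hk : 1 ≤ k) (hkn : k ≤ n) : ∃ w ∈ h.fld k,
    w - 1 ∈ v.lev (p ^ (n - 1) * t - p ^ (n - k)) ∧ R w ≠ 0 := by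
  induction k, hk using Nat.le_induction with
  | base => exact hR.exists_ne_zero_level_one h ht htp
  | succ k hk ih =>
    obtain ⟨w₁, hw₁, hl₁, hne⟩ := ih (by omega)
    have hk1 : k ≤ n := by omega
    have hq' := h.pow_pos_int (n - (k + 1))
    have hQ := pow_sub_eq_mul_pow_sub (p := p) hkn
    have hQQ : (p : ℤ) ^ (n - k) ≤ p ^ (n - 1) := pow_le_pow_right₀ (by omega) (by omega)
    set q : ℤ := p ^ (n - (k + 1)) with hqdef
    set Q : ℤ := p ^ (n - k) with hQdef
    set M : ℤ := p ^ (n - 1) with hMdef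
    have hQpos : 0 < Q := h.pow_pos_int _
    have hpt : (t : ℤ) + 1 ≤ p := by exact_mod_cast htp
    have ht' : (3 : ℤ) ≤ t := by exact_mod_cast ht
    have hMt : 3 * M ≤ M * t := by
      rw [mul_comm M]
      exact mul_le_mul_of_nonneg_right ht' (by linarith)
    have hMltMt : M < M * t := by linarith
    have hπ := h.map_one_sub_z_pow (k := k + 1) (by omega) hkn (p - 1)
    have hπmem : (1 - h.z (k + 1)) ^ (p - 1) ∈ h.fld (k + 1) :=
      pow_mem (sub_mem (one_mem _) (h.z_mem _)) _
    have hπ0 : (1 - h.z (k + 1)) ^ (p - 1) ∈ v.lev 0 := (mem_lev_iff_of_eq hπ).mpr (by positivity)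
    have hπl : (1 - h.z (k + 1)) ^ (p - 1) ∈ v.lev ((p - 1) * q) :=
      (mem_lev_iff_of_eq hπ).mpr (by push_cast [show 1 ≤ p by omega]; rfl)
    set b := w₁ - 1 with hb
    have hbmem : b ∈ h.fld k := sub_mem hw₁ (one_mem _)
    set u := 1 + b * (1 - h.z (k + 1)) ^ (p - 1) with hu
    have hul : u - 1 ∈ v.lev (M * t - q) := by
      rw [hu, add_sub_cancel_left]
      exact lev_mono (by rw [hQ]; linarith) (mul_mem_lev hl₁ hπl)
    have humem : u ∈ h.fld (k + 1) :=
      add_mem (one_mem _) (mul_mem (h.fld_mono hkn hbmem) hπmem)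
    have hqQ : q ≤ Q := by rw [hQ]; nlinarith
    have hj0 : 0 ≤ M * t - Q := by linarith
    have hju : 0 < M * t - Q := by linarith
    have hvu := map_eq_zero_of_sub_one_mem (by linarith : 0 < M * t - q) hul
    have hv₁ := map_eq_zero_of_sub_one_mem hju hl₁
    refine ⟨u, humem, hul, ?_⟩
    have hN := h.cycNorm_one_add_mul hk hkn hj0 hπmem hπ0 hbmem hl₁
    rw [h.trace_pi_pow hk hkn (by omega : p - 1 < p), ← hu, cycNorm_pow,
      h.cycNorm_one_sub_z hk hkn] at hN
    -- the binomial expansion of `(1 + b) ^ p`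
    have hbin : (1 + b) ^ p - (1 + b * p + b ^ p) ∈ v.lev (M * (p - 1) + 2 * (M * t - Q)) := by
      rw [add_comm 1 b, add_pow]
      obtain ⟨m, rfl⟩ : ∃ m, p = m + 2 := ⟨p - 2, by omega⟩
      rw [sum_range_succ, sum_range_succ', sum_range_succ']
      have hsum : ∑ i ∈ range m, b ^ (i + 1 + 1) * 1 ^ (m + 2 - (i + 1 + 1)) *
          (((m + 2).choose (i + 1 + 1) : ℕ) : F) ∈
          v.lev (M * (((m + 2 : ℕ) : ℤ) - 1) + 2 * (M * t - Q)) := by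
        refine (v.lev _).sum_mem fun i hi => ?_
        have hi' := mem_range.mp hi
        obtain ⟨c, hc⟩ := h.prime.dvd_choose_self (k := i + 1 + 1) (by omega) (by omega)
        rw [hc, one_pow, mul_one, Nat.cast_mul, mul_comm (b ^ _)]
        refine mul_mem_lev ?_ ?_
        · rw [mul_comm ((m + 2 : ℕ) : F)]
          exact mul_mem_lev_zero (natCast_mem_lev c) ((mem_lev_iff_of_eq h.map_p).mpr le_rfl)
        · rw [show i + 1 + 1 = i + 2 by ring, pow_add]
          refine mul_mem_lev_zero ?_ (by simpa using pow_mem_lev hl₁ 2)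
          exact lev_mono (by positivity) (pow_mem_lev hl₁ i)
      convert hsum using 1
      simp
      ring
    have hbp := pow_mem_lev hl₁ p
    have hzk : (1 - h.z k) ^ (p - 1) ∈ v.lev 0 :=
      (mem_lev_iff_of_eq (h.map_one_sub_z_pow hk hk1 (p - 1))).mpr (by positivity)
    have hdiff : cycNorm (h.s k) p u - w₁ ^ p ∈ v.lev (M * (p - 1) + M * t) := by
      have h1 : M * (p - 1) + M * t ≤ M * (p - 1) + 2 * (M * t - Q) := by linarith
      have h2 : M * (p - 1) + M * t ≤ p * (M * t - Q) := by
        have h3 : M * p ≤ (M * (p - 1)) * (t - 1) := by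
          have : 2 * (M * (p - 1)) ≤ (t - 1) * (M * (p - 1)) :=
            mul_le_mul_of_nonneg_right (by linarith) (mul_nonneg (by linarith) (by linarith))
          nlinarith
        nlinarith
      have h4 := (v.lev (M * (p - 1) + M * t)).add_mem ((v.lev _).sub_mem (lev_mono h1 hN)
        (lev_mono h1 hbin)) (mul_mem_lev_zero ((v.lev 0).sub_mem hzk one_mem_lev)
        (lev_mono h2 hbp))
      convert h4 using 1
      rw [hb]
      ring
    have hvw₁p : v (w₁ ^ p) = (0 : ℤ) := by simpa using map_eq_pow hv₁ p
    have hβ : cycNorm (h.s k) p u / w₁ ^ p - 1 ∈ v.lev (M * (p - 1) + M * t) := by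
      rw [div_sub_one (ne_zero_of_eq_int hvw₁p)]
      simpa using div_mem_lev hdiff hvw₁p
    obtain ⟨w₂, hw₂p, hl₂⟩ := h.hensel _ _ hMltMt hβ
    rw [add_sub_cancel] at hw₂p
    have hw₂ := h.mem_fld_of_pow_mem hk hk1 hMltMt hl₂
      (hw₂p ▸ div_mem (h.cycNorm_mem_fld hk hkn humem) (pow_mem hw₁ p))
    have hv₂ := map_eq_zero_of_sub_one_mem (by linarith) hl₂
    have hN1 : cycNorm (h.s k) p (u / (w₁ * w₂)) = 1 := by
      rw [cycNorm_div, cycNorm_of_fixed (h.s_fix le_rfl hk1 hk (mul_mem hw₁ hw₂)),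
        mul_pow, hw₂p, mul_div_cancel₀ _ (ne_zero_of_eq_int hvw₁p)]
      exact div_self (ne_zero_of_eq_int ((h.map_cycNorm (h.s k) p hvu).trans (by rw [mul_zero])))
    have hv₁₂ : v (w₁ * w₂) = (0 : ℤ) := by simpa using map_eq_mul hv₁ hv₂
    have h5 := hR.eq_zero_of_cycNorm_eq_one h ht htp hk hkn
      (div_mem humem (h.fld_mono hkn (mul_mem hw₁ hw₂))) hN1 (T := M * t - Q) (by
        change q * t ≤ M * t - Q - (M - q)
        have : (Q - q) * (t - 1) ≤ (M - q) * (t - 1) :=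
          mul_le_mul_of_nonneg_right (by linarith) (by linarith)
        have h6 : Q ≤ (Q - q) * (t - 1) := by
          have : q * ((p - 1) * 2) ≤ q * ((p - 1) * (t - 1)) :=
            mul_le_mul_of_nonneg_left (mul_le_mul_of_nonneg_left (by linarith) (by linarith)) hq'.le
          rw [hQ]
          nlinarith
        linarith)
      (div_sub_one_mem hju (lev_mono (by linarith) hul)
        (mul_sub_one_mem hju hl₁ (lev_mono (by linarith) hl₂)))
    rw [hR.map_div hvu hv₁₂, hR.map_mul _ _ hv₁ hv₂, hR.eq_zero_of_level h ht htp hk hk1 w₂ hw₂ hl₂,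
      add_zero, sub_eq_zero] at h5
    rwa [h5]

/-- The filtration jump: the `p ^ (n - m)`-th multiple of the character vanishes on units of
level `p ^ (m - 1) * t`. -/
theorem pow_mul_eq_zero {m : ℕ} (hm : 1 ≤ m) (hmn : m ≤ n) {u : F} (hu : v u = (0 : ℤ))
    (hl : u - 1 ∈ v.lev (p ^ (m - 1) * t)) : (p : ZMod (p ^ n)) ^ (n - m) * R u = 0 :=
  hR.pow_mul_eq_zero_of_level h htp hm (fun w hw hl => hR.eq_zero_of_level h ht htp hm hmn w hw hl)
    hmn le_rfl u (by rw [h.fld_top]; trivial) (by simpa using hl) hu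

/-- The filtration jump: the `p ^ (n - m)`-th multiple of the character does not vanish on units of
level `p ^ (m - 1) * t - 1`. -/
theorem exists_pow_mul_ne_zero {m : ℕ} (hm : 1 ≤ m) (hmn : m ≤ n) : ∃ d : F,
    d - 1 ∈ v.lev (p ^ (m - 1) * t - 1) ∧ (p : ZMod (p ^ n)) ^ (n - m) * R d ≠ 0 := by
  have hm' : 1 ≤ p ^ (m - 1) := Nat.one_le_pow _ _ h.prime.pos
  have hjt : 3 ≤ p ^ (m - 1) * t := by nlinarith
  set j := p ^ (m - 1) * t - 1 with hj
  have hjc : (j : ℤ) + 1 = p ^ (m - 1) * t := by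
    have : j + 1 = p ^ (m - 1) * t := by omega
    exact_mod_cast this
  suffices hk : ∀ k, m ≤ k → k ≤ n → ∃ d ∈ h.fld k, d - 1 ∈ v.lev (p ^ (n - k) * j) ∧
      (p : ZMod (p ^ n)) ^ (k - m) * R d ≠ 0 by
    obtain ⟨d, -, hd, hne⟩ := hk n hmn le_rfl
    refine ⟨d, ?_, hne⟩
    rw [Nat.sub_self, pow_zero, one_mul] at hd
    rwa [← hjc, add_sub_cancel_right]
  intro k hmk
  induction k, hmk using Nat.le_induction with
  | base =>
    intro _
    obtain ⟨w, hw, hl, hne⟩ := hR.exists_ne_zero_level h ht htp hm hmn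
    refine ⟨w, hw, ?_, by rwa [Nat.sub_self, pow_zero, one_mul]⟩
    convert hl using 2
    rw [pow_sub_one_eq_mul hm hmn, mul_assoc, ← hjc]
    ring
  | succ k hmk ih =>
    intro hkn
    have hk : 1 ≤ k := hm.trans hmk
    have hq := h.pow_pos_int (n - k)
    have hq' := h.pow_pos_int (n - (k + 1))
    obtain ⟨d, hd, hl, hne⟩ := ih (by omega)
    obtain ⟨d₂, hd₂, hl₂, hl'⟩ := h.exists_cycNorm_close hk hkn (by omega) (by
      rw [hjc]
      refine mul_le_mul ?_ (by omega) (by omega) (by positivity)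
      exact pow_le_pow_right₀ (by omega) (by omega)) hd hl
    have hjpos : 0 < (j : ℤ) := by omega
    have hv₂ := map_eq_zero_of_sub_one_mem (by positivity) hl₂
    have hvq := map_eq_zero_of_sub_one_mem (by positivity) hl'
    have hvN₂ : v (cycNorm (h.s k) p d₂) = (0 : ℤ) :=
      (h.map_cycNorm _ _ hv₂).trans (by rw [mul_zero])
    obtain ⟨μ, hμ, hN⟩ := hR.map_cycNorm h hk (by omega)
    rw [hjc] at hl'
    have h0 := hR.pow_mul_eq_zero_of_level h htp hm
      (fun w hw hl => hR.eq_zero_of_level h ht htp hm hmn w hw hl) hmk (by omega) _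
      (div_mem hd (h.cycNorm_mem_fld hk hkn hd₂)) hl' hvq
    have hd' : R d = p * μ * R d₂ + R (d / cycNorm (h.s k) p d₂) := by
      rw [← hN _ hv₂, ← hR.map_mul _ _ hvN₂ hvq, mul_div_cancel₀ _ (ne_zero_of_eq_int hvN₂)]
    refine ⟨d₂, hd₂, hl₂, fun hc => hne ?_⟩
    rw [hd', mul_add, h0, add_zero]
    rw [show k + 1 - m = k - m + 1 by omega, pow_succ] at hc
    linear_combination μ * hc

end IsTwistedCharacter

end

section

variable {p : ℕ} [Fact p.Prime] {Ω : Type*} [NormedField Ω] [NormedAlgebra ℚ_[p] Ω]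

theorem AlgEquiv.norm_map_of_padic [Algebra.IsAlgebraic ℚ_[p] Ω] (g : Ω ≃ₐ[ℚ_[p]] Ω) (x : Ω) :
    ‖g x‖ = ‖x‖ := by
  rw [NormedAlgebra.norm_eq_spectralNorm ℚ_[p], NormedAlgebra.norm_eq_spectralNorm ℚ_[p] x]
  exact (spectralNorm_eq_of_equiv g x).symm

theorem norm_natCast_of_padic (k : ℕ) : ‖(k : Ω)‖ = ‖(k : ℚ_[p])‖ := by
  rw [← map_natCast (algebraMap ℚ_[p] Ω), norm_algebraMap']

theorem norm_prime_of_padic : ‖(p : Ω)‖ = (p : ℝ)⁻¹ := by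
  rw [norm_natCast_of_padic (p := p), Padic.norm_p]

variable (M : IntermediateField ℚ_[p] Ω) [FiniteDimensional ℚ_[p] M]

theorem exists_norm_pow_eq_zpow [Algebra.IsAlgebraic ℚ_[p] Ω] {x : Ω} (hx : x ∈ M) (hx0 : x ≠ 0) :
    ∃ k : ℤ, ‖x‖ ^ (Module.finrank ℚ_[p] M).factorial = (p : ℝ) ^ k := by
  set D := Module.finrank ℚ_[p] M
  have hint : IsIntegral ℚ_[p] x := Algebra.IsIntegral.isIntegral x
  set P := minpoly ℚ_[p] x with hP
  have hdeg : P.natDegree ≤ D := by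
    have := minpoly.natDegree_le (A := ℚ_[p]) (⟨x, hx⟩ : M)
    rwa [IntermediateField.minpoly_eq] at this
  have hpos : 0 < P.natDegree := minpoly.natDegree_pos hint
  have hc : P.coeff 0 ≠ 0 := minpoly.coeff_zero_ne_zero hint hx0
  obtain ⟨c, hcD⟩ : P.natDegree ∣ D.factorial := Nat.dvd_factorial hpos hdeg
  have h1 : ‖x‖ ^ P.natDegree = ‖P.coeff 0‖ := by
    rw [NormedAlgebra.norm_eq_spectralNorm ℚ_[p],
      spectralNorm.spectralNorm_eq_norm_coeff_zero_rpow, ← Real.rpow_natCast, ← Real.rpow_mul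
        (norm_nonneg _), one_div, inv_mul_cancel₀ (by exact_mod_cast hpos.ne'), Real.rpow_one]
  refine ⟨-(P.coeff 0).valuation * c, ?_⟩
  rw [hcD, pow_mul, h1, Padic.norm_eq_zpow_neg_valuation hc, zpow_mul, zpow_natCast]

theorem exists_uniformizer_of_finiteDimensional [Algebra.IsAlgebraic ℚ_[p] Ω] :
    ∃ ϖ ∈ M, ϖ ≠ 0 ∧ ‖ϖ‖ < 1 ∧ ∀ z ∈ M, z ≠ 0 → ∃ i : ℤ, ‖z‖ = ‖ϖ‖ ^ i := by
  set D := (Module.finrank ℚ_[p] M).factorial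
  have hD : D ≠ 0 := Nat.factorial_ne_zero _
  have hp1 : (1 : ℝ) < p := by exact_mod_cast (Fact.out : p.Prime).one_lt
  have hp0 : (0 : ℝ) < p := by linarith
  let H : AddSubgroup ℤ :=
    { carrier := {k | ∃ x ∈ M, x ≠ 0 ∧ ‖x‖ ^ D = (p : ℝ) ^ k}
      zero_mem' := ⟨1, M.one_mem, one_ne_zero, by simp⟩
      add_mem' := by
        rintro a b ⟨x, hx, hx0, hxa⟩ ⟨y, hy, hy0, hyb⟩
        exact ⟨x * y, M.mul_mem hx hy, mul_ne_zero hx0 hy0, by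
          rw [norm_mul, mul_pow, hxa, hyb, zpow_add₀ hp0.ne']⟩
      neg_mem' := by
        rintro a ⟨x, hx, hx0, hxa⟩
        exact ⟨x⁻¹, M.inv_mem hx, inv_ne_zero hx0, by
          rw [norm_inv, inv_pow, hxa, zpow_neg]⟩ }
  have hHm : ∀ k, k ∈ H ↔ ∃ x ∈ M, x ≠ 0 ∧ ‖x‖ ^ D = (p : ℝ) ^ k := fun k => Iff.rfl
  obtain ⟨a, ha⟩ := Int.subgroup_cyclic H
  have hmem : ∀ k, k ∈ H ↔ a ∣ k := by
    intro k
    rw [ha, AddSubgroup.mem_closure_singleton]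
    exact ⟨fun ⟨n, hn⟩ => ⟨n, by rw [← hn]; simp [mul_comm]⟩,
      fun ⟨n, hn⟩ => ⟨n, by rw [hn]; simp [mul_comm]⟩⟩
  have hpΩ : (p : Ω) ≠ 0 := by
    rw [← norm_ne_zero_iff, norm_prime_of_padic (p := p)]; positivity
  have hpH : (-(D : ℤ)) ∈ H := (hHm _).2 ⟨p, M.natCast_mem p, hpΩ, by
    rw [norm_prime_of_padic (p := p), inv_pow, zpow_neg, zpow_natCast]⟩
  have ha0 : a ≠ 0 := by
    rintro rfl
    have := (hmem _).1 hpH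
    rw [zero_dvd_iff] at this
    omega
  have hneg : -|a| ∈ H := (hmem _).2 (by rw [dvd_neg, dvd_abs])
  obtain ⟨ϖ, hϖ, hϖ0, hϖn⟩ := (hHm _).1 hneg
  have habs : 0 < |a| := abs_pos.mpr ha0
  refine ⟨ϖ, hϖ, hϖ0, ?_, ?_⟩
  · rw [← pow_lt_one_iff_of_nonneg (norm_nonneg _) hD, hϖn]
    exact zpow_lt_one_of_neg₀ hp1 (by omega)
  · intro z hz hz0
    obtain ⟨k, hk⟩ := exists_norm_pow_eq_zpow M hz hz0
    obtain ⟨j, hj⟩ := (hmem k).1 ((hHm k).2 ⟨z, hz, hz0, hk⟩)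
    obtain ⟨j', hj'⟩ : |a| ∣ k := (abs_dvd _ _).2 ⟨j, hj⟩
    refine ⟨-j', ?_⟩
    rw [← pow_left_inj₀ (norm_nonneg _) (zpow_nonneg (norm_nonneg _) _) hD, hk, ← zpow_natCast,
      ← zpow_mul, mul_comm (-j'), zpow_mul, zpow_natCast, hϖn, ← zpow_mul, hj']
    congr 1; ring

end

section Residue

variable (Ω : Type*) [NormedField Ω] [IsUltrametricDist Ω]

/-- The unit ball of an ultrametric normed field. -/
noncomputable abbrev normUnitBall : ValuationSubring Ω :=
  (NormedField.valuation (K := Ω)).valuationSubring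

variable {Ω}

theorem mem_normUnitBall {x : Ω} : x ∈ normUnitBall Ω ↔ ‖x‖ ≤ 1 := by
  rw [Valuation.mem_valuationSubring_iff, NormedField.valuation_apply]
  exact Iff.rfl

theorem residue_normUnitBall_eq_zero (x : normUnitBall Ω) :
    IsLocalRing.residue (normUnitBall Ω) x = 0 ↔ ‖(x : Ω)‖ < 1 := by
  rw [IsLocalRing.residue_eq_zero_iff, IsLocalRing.mem_maximalIdeal, mem_nonunits_iff]
  constructor
  · intro hx
    refine lt_of_le_of_ne (mem_normUnitBall.1 x.2) fun h1 => hx ?_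
    have h0 : (x : Ω) ≠ 0 := norm_ne_zero_iff.mp (by rw [h1]; exact one_ne_zero)
    refine IsUnit.of_mul_eq_one ⟨(x : Ω)⁻¹, mem_normUnitBall.2 (by rw [norm_inv, h1, inv_one])⟩ ?_
    exact Subtype.ext (mul_inv_cancel₀ h0)
  · rintro hlt ⟨u, rfl⟩
    have h1 : ((u : normUnitBall Ω) : Ω) * ((u⁻¹ : (normUnitBall Ω)ˣ) : normUnitBall Ω) = 1 := by
      have := congrArg (Subtype.val) (Units.mul_inv u)
      exact this
    have h2 : ‖(((u⁻¹ : (normUnitBall Ω)ˣ) : normUnitBall Ω) : Ω)‖ ≤ 1 :=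
      mem_normUnitBall.1 (Subtype.prop _)
    have h3 := congrArg norm h1
    rw [norm_mul, norm_one] at h3
    nlinarith [norm_nonneg ((u : normUnitBall Ω) : Ω)]

theorem residue_normUnitBall_eq (x y : normUnitBall Ω) :
    IsLocalRing.residue (normUnitBall Ω) x = IsLocalRing.residue (normUnitBall Ω) y ↔
      ‖(x : Ω) - y‖ < 1 := by
  rw [← sub_eq_zero, ← map_sub, residue_normUnitBall_eq_zero]
  rfl

/-- A polynomial of degree less than `D` with coefficients in the unit ball which has `D` roots
modulo the open unit ball with pairwise distance at least one vanishes modulo the open unit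
ball. -/
theorem norm_lt_one_of_card_roots {D : ℕ} (a : ℕ → Ω) (ha : ∀ i < D, ‖a i‖ ≤ 1)
    (S : Finset Ω) (hS : ∀ s ∈ S, ‖s‖ ≤ 1) (hcard : D ≤ S.card)
    (hsep : ∀ s ∈ S, ∀ s' ∈ S, s ≠ s' → 1 ≤ ‖s - s'‖)
    (hroot : ∀ s ∈ S, ‖∑ i ∈ Finset.range D, a i * s ^ i‖ < 1) :
    ∀ i < D, ‖a i‖ < 1 := by
  classical
  rcases Nat.eq_zero_or_pos D with rfl | hD
  · intro i hi; omega
  let κ := IsLocalRing.ResidueField (normUnitBall Ω)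
  let res : normUnitBall Ω →+* κ := IsLocalRing.residue (normUnitBall Ω)
  let b : ℕ → normUnitBall Ω := fun i => if h : ‖a i‖ ≤ 1 then ⟨a i, mem_normUnitBall.2 h⟩ else 0
  have hb : ∀ i < D, (b i : Ω) = a i := fun i hi => by simp [b, ha i hi]
  let T : Ω → normUnitBall Ω := fun s => if h : ‖s‖ ≤ 1 then ⟨s, mem_normUnitBall.2 h⟩ else 0
  have hT : ∀ s ∈ S, (T s : Ω) = s := fun i hi => by simp [T, hS i hi]
  let Q : Polynomial κ := ∑ i ∈ Finset.range D, Polynomial.monomial i (res (b i))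
  have hQdeg : Q.natDegree < D := by
    refine lt_of_le_of_lt (Polynomial.natDegree_sum_le_of_forall_le (n := D - 1) _ _ ?_) (by omega)
    intro i hi
    exact (Polynomial.natDegree_monomial_le _).trans (by have := Finset.mem_range.1 hi; omega)
  have hinj : Set.InjOn (fun s => res (T s)) S := by
    intro s hs s' hs' heq
    by_contra hne
    have := (residue_normUnitBall_eq _ _).1 heq
    rw [hT s hs, hT s' hs'] at this
    exact absurd (hsep s hs s' hs' hne) (not_le.2 this)
  have hQ : Q = 0 := by
    refine Polynomial.eq_zero_of_natDegree_lt_card_of_eval_eq_zero' Q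
      (S.image fun s => res (T s)) ?_ ?_
    · intro c hc
      obtain ⟨s, hs, rfl⟩ := Finset.mem_image.1 hc
      have h1 : res (∑ i ∈ Finset.range D, b i * T s ^ i) = 0 := by
        refine (residue_normUnitBall_eq_zero _).2 ?_
        have h2 : ((∑ i ∈ Finset.range D, b i * T s ^ i : normUnitBall Ω) : Ω) =
            ∑ i ∈ Finset.range D, a i * s ^ i := by
          push_cast
          exact Finset.sum_congr rfl fun i hi => by rw [hb i (Finset.mem_range.1 hi), hT s hs]
        rw [h2]; exact hroot s hs
      rw [map_sum] at h1
      rw [Polynomial.eval_finsetSum, ← h1]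
      exact Finset.sum_congr rfl fun i _ => by rw [Polynomial.eval_monomial, map_mul, map_pow]
    · rw [Finset.card_image_of_injOn hinj]; omega
  intro i hi
  have h1 : Q.coeff i = res (b i) := by
    rw [Polynomial.finsetSum_coeff]
    simp [Polynomial.coeff_monomial, hi]
  rw [hQ, Polynomial.coeff_zero] at h1
  have := (residue_normUnitBall_eq_zero _).1 h1.symm
  rwa [hb i hi] at this

end Residue

section

variable {p : ℕ} [Fact p.Prime] {Ω : Type*} [NormedField Ω] [NormedAlgebra ℚ_[p] Ω]

/-- A nonarchimedean approximation criterion: if every nonzero element of a subspace containing the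
finite dimensional subspace `W` can be improved by an element of `W`, then it lies in `W`. -/
theorem mem_of_forall_exists_norm_sub_lt (W : Submodule ℚ_[p] Ω) [FiniteDimensional ℚ_[p] W]
    (M : Submodule ℚ_[p] Ω) (hWM : W ≤ M)
    (happ : ∀ a ∈ M, a ≠ 0 → ∃ w ∈ W, ‖a - w‖ < ‖a‖) : M ≤ W := by
  have : ProperSpace W := FiniteDimensional.proper ℚ_[p] W
  intro a ha
  obtain ⟨w₀, hw₀⟩ : ∃ w₀ : W, ∀ w : W, ‖a - w₀‖ ≤ ‖a - w‖ := by
    refine Continuous.exists_forall_le (f := fun w : W => ‖a - w‖) (by fun_prop) ?_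
    have h1 : Filter.Tendsto (fun w : W => ‖w‖ - ‖a‖) (Filter.cocompact W) Filter.atTop :=
      Filter.tendsto_atTop_add_const_right _ _ (tendsto_norm_cocompact_atTop (E := W))
    refine Filter.tendsto_atTop_mono (fun w => ?_) h1
    have := norm_sub_norm_le (w : Ω) a
    rw [norm_sub_rev] at this
    exact this
  by_contra hna
  have hne : a - w₀ ≠ 0 := fun h0 => hna (by rw [sub_eq_zero.1 h0]; exact w₀.2)
  obtain ⟨w, hw, hlt⟩ := happ (a - w₀) (M.sub_mem ha (hWM w₀.2)) hne
  have := hw₀ (w₀ + ⟨w, hw⟩)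
  rw [Submodule.coe_add, ← sub_sub] at this
  exact absurd hlt (not_lt.2 this)

variable [IsUltrametricDist Ω]

/-- `q` is the number of elements of the residue field of `M`. -/
structure IsResidueCard (M : IntermediateField ℚ_[p] Ω) (q : ℕ) : Prop where
  eq_pow : ∃ f, 1 ≤ f ∧ q = p ^ f
  norm_pow_sub_lt : ∀ a ∈ M, ‖a‖ ≤ 1 → ‖a ^ q - a‖ < 1
  exists_norm_sub_lt : ∀ a : Ω, ‖a‖ ≤ 1 → ‖a ^ q - a‖ < 1 → ∃ b ∈ M, ‖b‖ ≤ 1 ∧ ‖a - b‖ < 1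

variable (p) in
theorem charP_residueField_normUnitBall :
    CharP (IsLocalRing.ResidueField (normUnitBall Ω)) p := by
  have hp : p.Prime := Fact.out
  have h0 : ((p : ℕ) : IsLocalRing.ResidueField (normUnitBall Ω)) = 0 := by
    rw [← map_natCast (IsLocalRing.residue (normUnitBall Ω)), residue_normUnitBall_eq_zero]
    have : (((p : normUnitBall Ω)) : Ω) = p := rfl
    rw [this, norm_prime_of_padic (p := p)]
    exact inv_lt_one_of_one_lt₀ (by exact_mod_cast hp.one_lt)
  obtain ⟨c, hc⟩ := CharP.exists (IsLocalRing.ResidueField (normUnitBall Ω))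
  have hd : c ∣ p := (CharP.cast_eq_zero_iff _ c p).1 h0
  rcases (Nat.dvd_prime hp).1 hd with rfl | rfl
  · exact absurd rfl (CharP.char_ne_one (IsLocalRing.ResidueField (normUnitBall Ω)) 1)
  · exact hc

theorem exists_isResidueCard (M : IntermediateField ℚ_[p] Ω) [FiniteDimensional ℚ_[p] M] :
    ∃ q, IsResidueCard M q := by
  classical
  let κ := IsLocalRing.ResidueField (normUnitBall Ω)
  let res : normUnitBall Ω →+* κ := IsLocalRing.residue (normUnitBall Ω)
  let S : Subring κ := (M.toSubalgebra.toSubring.comap (normUnitBall Ω).subtype).map res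
  have hS : ∀ c, c ∈ S ↔ ∃ a : normUnitBall Ω, (a : Ω) ∈ M ∧ res a = c := fun c => Iff.rfl
  have : ProperSpace M := FiniteDimensional.proper ℚ_[p] M
  have hfin : (S : Set κ).Finite := by
    obtain ⟨T, hT1, hTf, hT⟩ :=
      (isCompact_closedBall (0 : M) 1).finite_cover_balls (e := 1) one_pos
    let g : M → κ := fun a => if h : ‖(a : Ω)‖ ≤ 1 then res ⟨a, mem_normUnitBall.2 h⟩ else 0
    refine (hTf.image g).subset ?_
    rintro c hc
    obtain ⟨a, haM, rfl⟩ := (hS c).1 hc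
    have ha1 := mem_normUnitBall.1 a.2
    have hmem : (⟨a, haM⟩ : M) ∈ Metric.closedBall (0 : M) 1 := by
      rw [mem_closedBall_zero_iff]; exact ha1
    obtain ⟨b, hb, hab⟩ := Set.mem_iUnion₂.1 (hT hmem)
    have hb1 : ‖(b : Ω)‖ ≤ 1 := mem_closedBall_zero_iff.1 (hT1 hb)
    refine ⟨b, hb, ?_⟩
    simp only [g, dif_pos hb1]
    refine (residue_normUnitBall_eq _ _).2 ?_
    rw [norm_sub_rev]
    rw [mem_ball_iff_norm] at hab
    exact hab
  have : Finite S := hfin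
  have : Fintype S := Fintype.ofFinite S
  let : Field S := Fintype.fieldOfDomain S
  have := charP_residueField_normUnitBall p (Ω := Ω)
  have : CharP S p := (CharP.subring κ p S)
  obtain ⟨f, -, hcard⟩ := FiniteField.card S p
  have hq1 : 1 < Fintype.card S := Fintype.one_lt_card
  have hpow : ∀ c ∈ S, c ^ Fintype.card S = c := by
    intro c hc
    have := FiniteField.pow_card (⟨c, hc⟩ : S)
    have := congrArg Subtype.val this
    exact this
  refine ⟨Fintype.card S, ⟨f, f.2, hcard⟩, ?_, ?_⟩
  · intro a ha ha1
    let a' : normUnitBall Ω := ⟨a, mem_normUnitBall.2 ha1⟩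
    have := hpow (res a') ((hS _).2 ⟨a', ha, rfl⟩)
    rw [← map_pow] at this
    exact (residue_normUnitBall_eq _ _).1 this
  · intro a ha1 hlt
    let a' : normUnitBall Ω := ⟨a, mem_normUnitBall.2 ha1⟩
    have h1 : res a' ^ Fintype.card S = res a' := by
      rw [← map_pow]; exact (residue_normUnitBall_eq _ _).2 hlt
    have hQ0 : (Polynomial.X ^ Fintype.card S - Polynomial.X : Polynomial κ) ≠ 0 :=
      FiniteField.X_pow_card_sub_X_ne_zero κ hq1
    have hsub : hfin.toFinset ⊆
        (Polynomial.X ^ Fintype.card S - Polynomial.X : Polynomial κ).roots.toFinset := by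
      intro c hc
      rw [Multiset.mem_toFinset, Polynomial.mem_roots hQ0]
      simp [hpow c (hfin.mem_toFinset.1 hc)]
    have heq := Finset.eq_of_subset_of_card_le hsub (by
      refine (Multiset.toFinset_card_le _).trans ((Polynomial.card_roots' _).trans ?_)
      rw [FiniteField.X_pow_card_sub_X_natDegree_eq κ hq1, ← Nat.card_eq_fintype_card,
        ← Set.ncard_eq_toFinset_card _ hfin]
      exact le_of_eq rfl)
    have hmem : res a' ∈ hfin.toFinset := by
      rw [heq, Multiset.mem_toFinset, Polynomial.mem_roots hQ0]
      simp [h1]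
    obtain ⟨b, hbM, hb⟩ := (hS _).1 (hfin.mem_toFinset.1 hmem)
    refine ⟨b, hbM, mem_normUnitBall.1 b.2, ?_⟩
    exact (residue_normUnitBall_eq a' b).1 hb.symm

end

section

variable {Ω : Type*} [NormedField Ω] [IsUltrametricDist Ω]

theorem norm_sum_lt_one_of_forall {ι : Type*} (s : Finset ι) (f : ι → Ω)
    (hf : ∀ i ∈ s, ‖f i‖ < 1) : ‖∑ i ∈ s, f i‖ < 1 := by
  rcases s.eq_empty_or_nonempty with rfl | hs
  · simp
  · obtain ⟨i, hi, hle⟩ := IsUltrametricDist.exists_norm_finsetSum_le_of_nonempty hs f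
    exact hle.trans_lt (hf i hi)

theorem norm_add_lt_one {a b : Ω} (ha : ‖a‖ < 1) (hb : ‖b‖ < 1) : ‖a + b‖ < 1 :=
  (IsUltrametricDist.norm_add_le_max a b).trans_lt (max_lt ha hb)

theorem norm_sub_lt_one_trans {a b c : Ω} (ha : ‖a - b‖ < 1) (hb : ‖b - c‖ < 1) : ‖a - c‖ < 1 := by
  have := norm_add_lt_one ha hb
  rwa [sub_add_sub_cancel] at this

variable {p : ℕ} [Fact p.Prime] [NormedAlgebra ℚ_[p] Ω]

theorem norm_sum_pow_sub_lt_one {q f : ℕ} (hq : q = p ^ f) {ι : Type*} (s : Finset ι)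
    (c : ι → Ω) (hc : ∀ i ∈ s, ‖c i‖ ≤ 1) :
    ‖(∑ i ∈ s, c i) ^ q - ∑ i ∈ s, c i ^ q‖ < 1 := by
  have := charP_residueField_normUnitBall p (Ω := Ω)
  let b : s → normUnitBall Ω := fun i => ⟨c i, mem_normUnitBall.2 (hc i i.2)⟩
  have h1 : IsLocalRing.residue (normUnitBall Ω) ((∑ i, b i) ^ q) =
      IsLocalRing.residue (normUnitBall Ω) (∑ i, b i ^ q) := by
    rw [map_pow, map_sum, hq, sum_pow_char_pow, map_sum]
    simp only [map_pow]
  have h2 := (residue_normUnitBall_eq _ _).1 h1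
  push_cast at h2
  have h3 := Finset.sum_coe_sort s (fun i => c i)
  have h4 := Finset.sum_coe_sort s (fun i => c i ^ q)
  rw [← h3, ← h4]
  exact h2

variable (p) in
/-- Roots of unity of order prime to `p` have pairwise distance one. -/
theorem eq_of_norm_sub_lt_one_of_pow_eq_one {N : ℕ} (hN : ¬ p ∣ N) {s s' : Ω} (hs : s ^ N = 1)
    (hs' : s' ^ N = 1) (hlt : ‖s - s'‖ < 1) : s = s' := by
  have hp : p.Prime := Fact.out
  have hN0 : N ≠ 0 := fun h => hN (h ▸ dvd_zero p)
  have hn' : ‖s'‖ = 1 := by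
    rw [← pow_eq_one_iff_of_nonneg (norm_nonneg _) hN0, ← norm_pow, hs', norm_one]
  have hs'0 : s' ≠ 0 := norm_ne_zero_iff.mp (by rw [hn']; exact one_ne_zero)
  set η := s / s' with hη
  have hη1 : ‖η - 1‖ < 1 := by
    rw [hη, div_sub_one hs'0, norm_div, hn', div_one]; exact hlt
  have hηN : η ^ N = 1 := by rw [hη, div_pow, hs, hs', div_one]
  by_contra hne
  have hη0 : η - 1 ≠ 0 := by
    rw [sub_ne_zero, hη, Ne, div_eq_one_iff_eq hs'0]; exact hne
  have hnη : ‖η‖ = 1 := by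
    rw [← pow_eq_one_iff_of_nonneg (norm_nonneg _) hN0, ← norm_pow, hηN, norm_one]
  have hsum : ∑ i ∈ Finset.range N, η ^ i = 0 := by
    have := geom_sum_mul η N
    rw [hηN, sub_self] at this
    exact (mul_eq_zero.1 this).resolve_right hη0
  have h1 : ‖∑ i ∈ Finset.range N, (η ^ i - 1)‖ < 1 := by
    refine norm_sum_lt_one_of_forall _ _ fun i _ => ?_
    rw [← mul_geom_sum, norm_mul]
    refine (mul_le_of_le_one_right (norm_nonneg _) ?_).trans_lt hη1
    exact IsUltrametricDist.norm_sum_le_of_forall_le_of_nonneg zero_le_one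
      fun j _ => by rw [norm_pow, hnη, one_pow]
  rw [Finset.sum_sub_distrib, hsum, Finset.sum_const, Finset.card_range, zero_sub, norm_neg,
    nsmul_one, norm_natCast_of_padic (p := p)] at h1
  exact h1.ne (Padic.norm_natCast_eq_one_iff.2 ((Nat.Prime.coprime_iff_not_dvd hp).2 hN))

end

section Adjoin

variable {p : ℕ} [Fact p.Prime] {Ω : Type*} [NormedField Ω] [NormedAlgebra ℚ_[p] Ω]
  (M : IntermediateField ℚ_[p] Ω)

/-- The field `M(ξ)` as a subfield of the ambient field. -/
noncomputable def IntermediateField.adjoinElem (ξ : Ω) : IntermediateField ℚ_[p] Ω :=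
  (IntermediateField.adjoin M {ξ}).restrictScalars ℚ_[p]

open IntermediateField

theorem IntermediateField.le_adjoinElem (ξ : Ω) : M ≤ M.adjoinElem ξ := fun x hx =>
  (IntermediateField.adjoin M {ξ}).algebraMap_mem ⟨x, hx⟩

theorem IntermediateField.self_mem_adjoinElem (ξ : Ω) : ξ ∈ M.adjoinElem ξ :=
  IntermediateField.mem_adjoin_simple_self M ξ

theorem IntermediateField.adjoinElem_le {M N : IntermediateField ℚ_[p] Ω} {ξ : Ω} (hM : M ≤ N)
    (hξ : ξ ∈ N) : M.adjoinElem ξ ≤ N := by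
  intro x hx
  refine IntermediateField.adjoin_induction (F := M) (s := {ξ}) (p := fun x _ => x ∈ N)
    ?_ ?_ ?_ ?_ ?_ hx
  · rintro x rfl; exact hξ
  · intro x; exact hM x.2
  · intro x y _ _ hx hy; exact N.add_mem hx hy
  · intro x _ hx; exact N.inv_mem hx
  · intro x y _ _ hx hy; exact N.mul_mem hx hy

variable [Algebra.IsAlgebraic ℚ_[p] Ω]

theorem isAlgebraic_of_padic (a : Ω) : IsAlgebraic M a :=
  (Algebra.IsAlgebraic.isAlgebraic (R := ℚ_[p]) a).tower_top M

theorem isIntegral_of_padic (a : Ω) : IsIntegral M a := (isAlgebraic_of_padic M a).isIntegral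

instance finiteDimensional_adjoinElem [FiniteDimensional ℚ_[p] M] (ξ : Ω) :
    FiniteDimensional ℚ_[p] (M.adjoinElem ξ) := by
  have h1 : FiniteDimensional M (IntermediateField.adjoin M {ξ}) :=
    IntermediateField.adjoin.finiteDimensional (isIntegral_of_padic M ξ)
  exact FiniteDimensional.trans ℚ_[p] M (IntermediateField.adjoin M {ξ})

theorem IntermediateField.exists_eq_sum_of_mem_adjoinElem {ξ a : Ω} (ha : a ∈ M.adjoinElem ξ) :
    ∃ c : ℕ → Ω, (∀ i, c i ∈ M) ∧
      a = ∑ i ∈ Finset.range (minpoly M ξ).natDegree, c i * ξ ^ i := by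
  have hint := isIntegral_of_padic M ξ
  have h1 : a ∈ (IntermediateField.adjoin M {ξ}).toSubalgebra := ha
  rw [IntermediateField.adjoin_simple_toSubalgebra_of_isAlgebraic (isAlgebraic_of_padic M ξ),
    Algebra.adjoin_singleton_eq_range_aeval] at h1
  obtain ⟨f, rfl⟩ := h1
  refine ⟨fun i => ((f %ₘ minpoly M ξ).coeff i : Ω), fun i => Subtype.prop _, ?_⟩
  have h2 := Polynomial.aeval_eq_sum_range' (Polynomial.natDegree_modByMonic_lt f
    (minpoly.monic hint) (minpoly.ne_one M ξ)) ξ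
  rw [Polynomial.aeval_modByMonic_eq_self_of_root (minpoly.aeval M ξ)] at h2
  exact h2

theorem IntermediateField.map_mem_adjoinElem {ξ : Ω} (g : Ω ≃ₐ[ℚ_[p]] Ω)
    {N : IntermediateField ℚ_[p] Ω} (hM : ∀ x ∈ M, g x ∈ N)
    (hξ : g ξ ∈ N) : ∀ x ∈ M.adjoinElem ξ, g x ∈ N := by
  intro x hx
  obtain ⟨c, hc, rfl⟩ := M.exists_eq_sum_of_mem_adjoinElem hx
  rw [_root_.map_sum]
  refine N.sum_mem fun i _ => ?_
  rw [_root_.map_mul, _root_.map_pow]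
  exact N.mul_mem (hM _ (hc i)) (pow_mem hξ i)

theorem IntermediateField.eqOn_adjoinElem {ξ : Ω} (g g' : Ω ≃ₐ[ℚ_[p]] Ω)
    (hM : ∀ x ∈ M, g x = g' x) (hξ : g ξ = g' ξ) : ∀ x ∈ M.adjoinElem ξ, g x = g' x := by
  intro x hx
  obtain ⟨c, hc, rfl⟩ := M.exists_eq_sum_of_mem_adjoinElem hx
  rw [_root_.map_sum, _root_.map_sum]
  refine Finset.sum_congr rfl fun i _ => ?_
  rw [_root_.map_mul, _root_.map_pow, _root_.map_mul, _root_.map_pow, hM _ (hc i), hξ]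

variable [IsAlgClosed Ω]

theorem exists_algEquiv_fixing_map_eq {a b : Ω} (hb : Polynomial.aeval b (minpoly M a) = 0) :
    ∃ g : Ω ≃ₐ[ℚ_[p]] Ω, (∀ x ∈ M, g x = x) ∧ g a = b := by
  have : Algebra.IsAlgebraic M Ω := ⟨isAlgebraic_of_padic M⟩
  have : IsAlgClosure M Ω := ⟨inferInstance, inferInstance⟩
  have : Normal M Ω := IsAlgClosure.normal M Ω
  obtain ⟨σ, hσ⟩ := minpoly.exists_algEquiv_of_root' (isAlgebraic_of_padic M a) hb
  exact ⟨σ.restrictScalars ℚ_[p], fun x hx => σ.commutes ⟨x, hx⟩, hσ⟩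

/-- The conjugates of `a` over `M`. -/
theorem exists_finset_conjugates (a : Ω) : ∃ S : Finset Ω, S.card = (minpoly M a).natDegree ∧
    ∀ s ∈ S, ∃ g : Ω ≃ₐ[ℚ_[p]] Ω, (∀ x ∈ M, g x = x) ∧ g a = s := by
  classical
  have : CharZero M := charZero_of_injective_algebraMap (algebraMap ℚ_[p] M).injective
  refine ⟨((minpoly M a).rootSet Ω).toFinset, ?_, ?_⟩
  · rw [Set.toFinset_card]
    exact Polynomial.card_rootSet_eq_natDegree
      (minpoly.irreducible (isIntegral_of_padic M a)).separable (IsAlgClosed.splits _)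
  · intro s hs
    rw [Set.mem_toFinset, Polynomial.mem_rootSet] at hs
    exact exists_algEquiv_fixing_map_eq M hs.2

end Adjoin

section

open IntermediateField

variable {p : ℕ} [Fact p.Prime] {Ω : Type*} [NormedField Ω] [IsUltrametricDist Ω]
  [NormedAlgebra ℚ_[p] Ω] [Algebra.IsAlgebraic ℚ_[p] Ω] [IsAlgClosed Ω]
  (M : IntermediateField ℚ_[p] Ω) {N : ℕ} {ξ : Ω}

omit [IsUltrametricDist Ω] [Algebra.IsAlgebraic ℚ_[p] Ω] [IsAlgClosed Ω]
  [Fact p.Prime] [NormedAlgebra ℚ_[p] Ω] in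
theorem norm_eq_one_of_pow_eq_one (hN : ¬ p ∣ N) (hξ : ξ ^ N = 1) : ‖ξ‖ = 1 := by
  have hN0 : N ≠ 0 := fun h => hN (h ▸ dvd_zero p)
  rw [← pow_eq_one_iff_of_nonneg (norm_nonneg _) hN0, ← norm_pow, hξ, norm_one]

/-- In an extension generated by a root of unity of order prime to `p`, the powers of the
generator form an orthonormal basis. -/
theorem norm_coeff_le_norm_sum (hN : ¬ p ∣ N) (hξ : ξ ^ N = 1) (a : ℕ → Ω)
    (ha : ∀ i < (minpoly M ξ).natDegree, a i ∈ M) :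
    ∀ i < (minpoly M ξ).natDegree,
      ‖a i‖ ≤ ‖∑ j ∈ Finset.range (minpoly M ξ).natDegree, a j * ξ ^ j‖ := by
  set D := (minpoly M ξ).natDegree with hD
  by_contra! hcon
  obtain ⟨i₁, hi₁, hlt₁⟩ := hcon
  obtain ⟨i₀, hi₀, hmax⟩ := Finset.exists_max_image (Finset.range D) (fun i => ‖a i‖)
    ⟨i₁, Finset.mem_range.2 hi₁⟩
  have hlt : ‖∑ j ∈ Finset.range D, a j * ξ ^ j‖ < ‖a i₀‖ :=
    hlt₁.trans_le (hmax i₁ (Finset.mem_range.2 hi₁))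
  have hpos : 0 < ‖a i₀‖ := (norm_nonneg _).trans_lt hlt
  have ha0 : a i₀ ≠ 0 := norm_pos_iff.1 hpos
  obtain ⟨S, hScard, hS⟩ := exists_finset_conjugates M ξ
  have hSN : ∀ s ∈ S, s ^ N = 1 := by
    intro s hs
    obtain ⟨g, -, rfl⟩ := hS s hs
    rw [← map_pow, hξ, map_one]
  have h1 := norm_lt_one_of_card_roots (D := D) (fun i => a i / a i₀) (fun i hi => by
      rw [norm_div]; exact (div_le_one hpos).2 (hmax i (Finset.mem_range.2 hi))) S
    (fun s hs => (norm_eq_one_of_pow_eq_one hN (hSN s hs)).le) hScard.ge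
    (fun s hs s' hs' hne => by
      by_contra! hc
      exact hne (eq_of_norm_sub_lt_one_of_pow_eq_one p hN (hSN s hs) (hSN s' hs') hc))
    (fun s hs => by
      obtain ⟨g, hg, rfl⟩ := hS s hs
      have h2 : ∑ i ∈ Finset.range D, a i / a i₀ * g ξ ^ i =
          g ((∑ i ∈ Finset.range D, a i * ξ ^ i) / a i₀) := by
        rw [map_div₀, map_sum, Finset.sum_div, hg _ (ha i₀ (Finset.mem_range.1 hi₀))]
        refine Finset.sum_congr rfl fun i hi => ?_
        rw [map_mul, map_pow, hg _ (ha i (Finset.mem_range.1 hi))]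
        ring
      rw [h2, g.norm_map_of_padic, norm_div]
      exact (div_lt_one hpos).2 hlt)
  have h3 := h1 i₀ (Finset.mem_range.1 hi₀)
  rw [div_self ha0, norm_one] at h3
  exact lt_irrefl _ h3

theorem exists_norm_eq_of_mem_adjoinElem (hN : ¬ p ∣ N) (hξ : ξ ^ N = 1) {a : Ω}
    (ha : a ∈ M.adjoinElem ξ) : ∃ b ∈ M, ‖a‖ = ‖b‖ := by
  obtain ⟨c, hc, rfl⟩ := M.exists_eq_sum_of_mem_adjoinElem ha
  have hU := norm_coeff_le_norm_sum M hN hξ c fun i _ => hc i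
  rcases (Finset.range (minpoly M ξ).natDegree).eq_empty_or_nonempty with h0 | hne
  · exact ⟨0, M.zero_mem, by rw [h0]; simp⟩
  · obtain ⟨i, hi, hle⟩ := IsUltrametricDist.exists_norm_finsetSum_le_of_nonempty hne
      fun i => c i * ξ ^ i
    refine ⟨c i, hc i, le_antisymm ?_ (hU i (Finset.mem_range.1 hi))⟩
    refine hle.trans (le_of_eq ?_)
    rw [norm_mul, norm_pow, norm_eq_one_of_pow_eq_one hN hξ, one_pow, mul_one]

/-- The Frobenius automorphism of `M(ξ)` over `M`. -/
theorem exists_frobenius [FiniteDimensional ℚ_[p] M] {q : ℕ} (hq : IsResidueCard M q)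
    (hN : ¬ p ∣ N) (hξ : ξ ^ N = 1) :
    ∃ Φ : Ω ≃ₐ[ℚ_[p]] Ω, (∀ x ∈ M, Φ x = x) ∧ Φ ξ = ξ ^ q ∧
      ∀ a ∈ M.adjoinElem ξ, Φ a = a → a ∈ M := by
  classical
  obtain ⟨f, -, hqf⟩ := hq.eq_pow
  have hint := isIntegral_of_padic M ξ
  have hξ1 := norm_eq_one_of_pow_eq_one hN hξ
  set D := (minpoly M ξ).natDegree with hD
  have hred : ∀ (s : Finset ℕ) (c : ℕ → Ω), (∀ i ∈ s, c i ∈ M) → (∀ i ∈ s, ‖c i‖ ≤ 1) →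
      ‖(∑ i ∈ s, c i * ξ ^ i) ^ q - ∑ i ∈ s, c i * (ξ ^ q) ^ i‖ < 1 := by
    intro s c hcM hc
    refine norm_sub_lt_one_trans (norm_sum_pow_sub_lt_one hqf s (fun i => c i * ξ ^ i) ?_) ?_
    · intro i hi
      rw [norm_mul, norm_pow, hξ1, one_pow, mul_one]; exact hc i hi
    · rw [← Finset.sum_sub_distrib]
      refine norm_sum_lt_one_of_forall _ _ fun i hi => ?_
      have h1 : (c i * ξ ^ i) ^ q - c i * (ξ ^ q) ^ i = (c i ^ q - c i) * (ξ ^ q) ^ i := by ring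
      rw [h1, norm_mul, norm_pow, norm_pow, hξ1, one_pow, one_pow, mul_one]
      exact hq.norm_pow_sub_lt _ (hcM i hi) (hc i hi)
  let b : ℕ → Ω := fun i => ((minpoly M ξ).coeff i : Ω)
  have hbM : ∀ i, b i ∈ M := fun i => Subtype.prop _
  have hbD : b D = 1 := by
    have : (minpoly M ξ).coeff D = 1 := (minpoly.monic hint).coeff_natDegree
    simp only [b, this]; rfl
  have haev : ∀ z : Ω, Polynomial.aeval z (minpoly M ξ) =
      ∑ i ∈ Finset.range (D + 1), b i * z ^ i := fun z =>
    Polynomial.aeval_eq_sum_range z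
  have hb0 : ∑ i ∈ Finset.range (D + 1), b i * ξ ^ i = 0 := by rw [← haev, minpoly.aeval]
  have hb1 : ∀ i < D + 1, ‖b i‖ ≤ 1 := by
    intro i hi
    rcases (Nat.lt_succ_iff.1 hi).eq_or_lt with rfl | hi
    · rw [hbD, norm_one]
    · refine (norm_coeff_le_norm_sum M hN hξ b (fun i _ => hbM i) i hi).trans ?_
      rw [Finset.sum_range_succ, hbD, one_mul] at hb0
      rw [eq_neg_of_add_eq_zero_left hb0, norm_neg, norm_pow, hξ1, one_pow]
  obtain ⟨S, hScard, hS⟩ := exists_finset_conjugates M ξ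
  have hSN : ∀ s ∈ S, s ^ N = 1 := by
    intro s hs
    obtain ⟨g, -, rfl⟩ := hS s hs
    rw [← map_pow, hξ, map_one]
  have hqN : (ξ ^ q) ^ N = 1 := by rw [← pow_mul, mul_comm, pow_mul, hξ, one_pow]
  have hmem : ξ ^ q ∈ S := by
    by_contra hnot
    have hSN' : ∀ s ∈ insert (ξ ^ q) S, s ^ N = 1 := by
      intro s hs
      rcases Finset.mem_insert.1 hs with rfl | hs
      · exact hqN
      · exact hSN s hs
    have h1 := norm_lt_one_of_card_roots (D := D + 1) b hb1 (insert (ξ ^ q) S)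
      (fun s hs => (norm_eq_one_of_pow_eq_one hN (hSN' s hs)).le)
      (by rw [Finset.card_insert_of_notMem hnot, hScard])
      (fun s hs s' hs' hne => by
        by_contra! hc
        exact hne (eq_of_norm_sub_lt_one_of_pow_eq_one p hN (hSN' s hs) (hSN' s' hs') hc))
      (fun s hs => by
        rcases Finset.mem_insert.1 hs with rfl | hs
        · have := hred (Finset.range (D + 1)) b (fun i _ => hbM i)
            fun i hi => hb1 i (Finset.mem_range.1 hi)
          rw [hb0, zero_pow (by rw [hqf]; exact pow_ne_zero _ (Fact.out : p.Prime).ne_zero),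
            zero_sub, norm_neg] at this
          exact this
        · obtain ⟨g, hg, rfl⟩ := hS s hs
          have h2 : ∑ i ∈ Finset.range (D + 1), b i * g ξ ^ i = 0 := by
            rw [← map_zero g, ← hb0, map_sum]
            exact Finset.sum_congr rfl fun i _ => by rw [map_mul, map_pow, hg _ (hbM i)]
          rw [h2, norm_zero]; exact one_pos)
    have h3 := h1 D (Nat.lt_succ_self D)
    rw [hbD, norm_one] at h3
    exact lt_irrefl _ h3
  obtain ⟨Φ, hΦM, hΦξ⟩ := hS _ hmem
  refine ⟨Φ, hΦM, hΦξ, ?_⟩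
  let V : Submodule ℚ_[p] Ω :=
    { carrier := {a | a ∈ M.adjoinElem ξ ∧ Φ a = a}
      zero_mem' := ⟨(M.adjoinElem ξ).zero_mem, map_zero Φ⟩
      add_mem' := fun {a b} ha hb => ⟨(M.adjoinElem ξ).add_mem ha.1 hb.1, by
        rw [map_add, ha.2, hb.2]⟩
      smul_mem' := fun c a ha => ⟨(M.adjoinElem ξ).smul_mem ha.1, by rw [map_smul, ha.2]⟩ }
  have hfd : FiniteDimensional ℚ_[p] (Subalgebra.toSubmodule M.toSubalgebra) :=
    inferInstanceAs (FiniteDimensional ℚ_[p] M)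
  have key := mem_of_forall_exists_norm_sub_lt (Subalgebra.toSubmodule M.toSubalgebra) V
    (fun a ha => ⟨M.le_adjoinElem ξ ha, hΦM a ha⟩) ?_
  · exact fun a ha hfix => key ⟨ha, hfix⟩
  rintro a ⟨ha, hfix⟩ ha0
  obtain ⟨m, hm, hnorm⟩ := exists_norm_eq_of_mem_adjoinElem M hN hξ ha
  have hm0 : m ≠ 0 := by rw [← norm_ne_zero_iff, ← hnorm, norm_ne_zero_iff]; exact ha0
  have ham : a / m ∈ M.adjoinElem ξ := (M.adjoinElem ξ).div_mem ha (M.le_adjoinElem ξ hm)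
  have hn1 : ‖a / m‖ = 1 := by
    rw [norm_div, hnorm, div_self (norm_ne_zero_iff.2 hm0)]
  have hfix' : Φ (a / m) = a / m := by rw [map_div₀, hfix, hΦM m hm]
  obtain ⟨c, hc, hac⟩ := M.exists_eq_sum_of_mem_adjoinElem ham
  have hc1 : ∀ i ∈ Finset.range D, ‖c i‖ ≤ 1 := fun i hi => by
    refine (norm_coeff_le_norm_sum M hN hξ c (fun i _ => hc i) i (Finset.mem_range.1 hi)).trans ?_
    rw [← hac, hn1]
  have h5 := hred (Finset.range D) c (fun i _ => hc i) hc1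
  have h6 : ∑ i ∈ Finset.range D, c i * (ξ ^ q) ^ i = a / m := by
    rw [← hfix', hac, map_sum]
    exact Finset.sum_congr rfl fun i _ => by rw [map_mul, map_pow, hΦM _ (hc i), hΦξ]
  rw [← hac, h6] at h5
  obtain ⟨b', hb', -, hlt⟩ := hq.exists_norm_sub_lt (a / m) hn1.le h5
  refine ⟨m * b', M.mul_mem hm hb', ?_⟩
  have h7 : a - m * b' = m * (a / m - b') := by field_simp
  rw [h7, norm_mul, hnorm]
  exact mul_lt_of_lt_one_right (norm_pos_iff.2 hm0) hlt

end

section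

open IntermediateField

variable {p : ℕ} [Fact p.Prime] {Ω : Type*} [NormedField Ω]
  [NormedAlgebra ℚ_[p] Ω] [Algebra.IsAlgebraic ℚ_[p] Ω] [IsAlgClosed Ω]
  (M : IntermediateField ℚ_[p] Ω)

omit [IsAlgClosed Ω] in
theorem eq_zero_of_sum_pow_eq_zero {a : Ω} (c : ℕ → Ω) (hc : ∀ i, c i ∈ M)
    (h0 : ∑ i ∈ Finset.range (minpoly M a).natDegree, c i * a ^ i = 0) :
    ∀ i < (minpoly M a).natDegree, c i = 0 := by
  set D := (minpoly M a).natDegree with hD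
  let Q : Polynomial M := ∑ i ∈ Finset.range D, Polynomial.monomial i ⟨c i, hc i⟩
  have hQ : Polynomial.aeval a Q = 0 := by
    rw [map_sum, ← h0]
    exact Finset.sum_congr rfl fun i _ => by rw [Polynomial.aeval_monomial]; rfl
  have hQ0 : Q = 0 := by
    by_contra hne
    have h1 := Polynomial.natDegree_le_natDegree (minpoly.degree_le_of_ne_zero M a hne hQ)
    have hDpos : 0 < D := minpoly.natDegree_pos (isIntegral_of_padic M a)
    have h2 : Q.natDegree ≤ D - 1 :=
      Polynomial.natDegree_sum_le_of_forall_le (n := D - 1) _ _ fun i hi =>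
        (Polynomial.natDegree_monomial_le _).trans (by have := Finset.mem_range.1 hi; omega)
    omega
  intro i hi
  have h1 : Q.coeff i = ⟨c i, hc i⟩ := by
    rw [Polynomial.finsetSum_coeff]
    simp [Polynomial.coeff_monomial, hi]
  rw [hQ0, Polynomial.coeff_zero] at h1
  exact (congrArg Subtype.val h1).symm

variable {n : ℕ} {x Y ζ : Ω}

omit [Algebra.IsAlgebraic ℚ_[p] Ω] [IsAlgClosed Ω] in
theorem minpoly_of_pow_eq (hp2 : p ≠ 2) (hx : x ∈ M) (hxp : ∀ w ∈ M, w ^ p ≠ x)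
    (hY : Y ^ p ^ n = x) :
    minpoly M Y = Polynomial.X ^ p ^ n - Polynomial.C ⟨x, hx⟩ := by
  have hirr := X_pow_sub_C_irreducible_of_prime_pow (K := M) Fact.out hp2 n (a := ⟨x, hx⟩)
    (fun b hb => hxp b b.2 (congrArg Subtype.val hb))
  refine (minpoly.eq_of_irreducible_of_monic hirr ?_
    (Polynomial.monic_X_pow_sub_C _ (pow_ne_zero _ (Fact.out : p.Prime).ne_zero))).symm
  rw [map_sub, map_pow, Polynomial.aeval_X, Polynomial.aeval_C, hY]
  exact sub_self x

omit [Algebra.IsAlgebraic ℚ_[p] Ω] [IsAlgClosed Ω] in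
theorem natDegree_minpoly_of_pow_eq (hp2 : p ≠ 2) (hx : x ∈ M) (hxp : ∀ w ∈ M, w ^ p ≠ x)
    (hY : Y ^ p ^ n = x) : (minpoly M Y).natDegree = p ^ n := by
  rw [minpoly_of_pow_eq M hp2 hx hxp hY, Polynomial.natDegree_X_pow_sub_C]

/-- The Kummer automorphism. -/
theorem exists_kummer_algEquiv (hp2 : p ≠ 2) (hx : x ∈ M) (hxp : ∀ w ∈ M, w ^ p ≠ x)
    (hY : Y ^ p ^ n = x) (hζ : ζ ^ p ^ n = 1) :
    ∃ τ : Ω ≃ₐ[ℚ_[p]] Ω, (∀ a ∈ M, τ a = a) ∧ τ Y = ζ * Y := by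
  refine exists_algEquiv_fixing_map_eq M ?_
  rw [minpoly_of_pow_eq M hp2 hx hxp hY, map_sub, map_pow, Polynomial.aeval_X,
    Polynomial.aeval_C, mul_pow, hζ, one_mul, hY]
  exact sub_self x

omit [Algebra.IsAlgebraic ℚ_[p] Ω] [IsAlgClosed Ω] in
theorem pow_map_eq_of_map_eq_mul {τ : Ω ≃ₐ[ℚ_[p]] Ω} (hζM : τ ζ = ζ) (hτ : τ Y = ζ * Y) (i : ℕ) :
    (τ ^ i) Y = ζ ^ i * Y := by
  induction i with
  | zero => simp
  | succ i ih => rw [pow_succ', AlgEquiv.mul_apply, ih, map_mul, map_pow, hζM, hτ]; ring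

omit [IsAlgClosed Ω] in
/-- The elements fixed by a power of the Kummer automorphism. -/
theorem mem_adjoinElem_of_pow_map_eq (hp2 : p ≠ 2) (hx : x ∈ M) (hxp : ∀ w ∈ M, w ^ p ≠ x)
    (hY : Y ^ p ^ n = x) (hζ : IsPrimitiveRoot ζ (p ^ n)) (hζM : ζ ∈ M)
    {τ : Ω ≃ₐ[ℚ_[p]] Ω} (hτM : ∀ a ∈ M, τ a = a) (hτ : τ Y = ζ * Y) {m : ℕ} (hm : m ≤ n)
    {a : Ω} (ha : a ∈ M.adjoinElem Y) (hfix : (τ ^ p ^ m) a = a) :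
    a ∈ M.adjoinElem (Y ^ p ^ (n - m)) := by
  have hp : p.Prime := Fact.out
  obtain ⟨c, hc, hac⟩ := M.exists_eq_sum_of_mem_adjoinElem ha
  have hD := natDegree_minpoly_of_pow_eq M hp2 hx hxp hY
  have hτm : ∀ b ∈ M, (τ ^ p ^ m) b = b := fun b hb =>
    AlgEquiv.pow_apply_eq_self (hτM b hb) _
  have h0 := eq_zero_of_sum_pow_eq_zero M (a := Y) (fun i => c i * ((ζ ^ p ^ m) ^ i - 1))
    (fun i => M.mul_mem (hc i) (M.sub_mem (pow_mem (pow_mem hζM _) _) M.one_mem)) (by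
      have h1 := hfix
      rw [hac, map_sum, ← sub_eq_zero, ← Finset.sum_sub_distrib] at h1
      rw [← h1]
      refine Finset.sum_congr rfl fun i _ => ?_
      rw [map_mul, map_pow, hτm _ (hc i), pow_map_eq_of_map_eq_mul (hτM ζ hζM) hτ]
      ring)
  rw [hac]
  refine (M.adjoinElem _).sum_mem fun i hi => ?_
  have hi' := Finset.mem_range.1 hi
  rcases mul_eq_zero.1 (h0 i hi') with h1 | h1
  · rw [h1, zero_mul]; exact (M.adjoinElem _).zero_mem
  · rw [sub_eq_zero, ← pow_mul] at h1
    have hdvd := hζ.dvd_of_pow_eq_one _ h1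
    have h2 : p ^ n = p ^ m * p ^ (n - m) := by rw [← pow_add, Nat.add_sub_cancel' hm]
    rw [h2] at hdvd
    obtain ⟨l, rfl⟩ := Nat.dvd_of_mul_dvd_mul_left (pow_pos hp.pos m) hdvd
    rw [pow_mul]
    exact (M.adjoinElem _).mul_mem (M.le_adjoinElem _ (hc _))
      (pow_mem (M.self_mem_adjoinElem _) _)

omit [IsAlgClosed Ω] in
theorem mem_of_map_eq_of_mem_adjoinElem (hp2 : p ≠ 2) (hx : x ∈ M) (hxp : ∀ w ∈ M, w ^ p ≠ x)
    (hY : Y ^ p ^ n = x) (hζ : IsPrimitiveRoot ζ (p ^ n)) (hζM : ζ ∈ M)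
    {τ : Ω ≃ₐ[ℚ_[p]] Ω} (hτM : ∀ a ∈ M, τ a = a) (hτ : τ Y = ζ * Y)
    {a : Ω} (ha : a ∈ M.adjoinElem Y) (hfix : τ a = a) : a ∈ M := by
  have h1 := mem_adjoinElem_of_pow_map_eq M hp2 hx hxp hY hζ hζM hτM hτ (Nat.zero_le n) ha
    (by rw [pow_zero, pow_one]; exact hfix)
  rw [Nat.sub_zero, hY] at h1
  exact adjoinElem_le le_rfl hx h1

end

section

variable {p : ℕ} [Fact p.Prime] {Ω : Type*} [NormedField Ω] [IsUltrametricDist Ω]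
  [NormedAlgebra ℚ_[p] Ω]

omit [Fact p.Prime] [NormedAlgebra ℚ_[p] Ω] in
theorem exists_norm_sub_pow_lt_one {q : ℕ} {ξ : Ω} (hq : 1 < q)
    (hξ : IsPrimitiveRoot ξ (q - 1))
    (hsep : ∀ s s' : Ω, s ^ (q - 1) = 1 → s' ^ (q - 1) = 1 → ‖s - s'‖ < 1 → s = s')
    {a : Ω} (ha : ‖a‖ ≤ 1) (haq : ‖a ^ q - a‖ < 1) :
    ‖a‖ < 1 ∨ ∃ i, ‖a - ξ ^ i‖ < 1 := by
  classical
  have hq' : q = q - 1 + 1 := by omega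
  by_contra! hcon
  obtain ⟨h0, h1⟩ := hcon
  set U : Finset Ω := (Finset.range (q - 1)).image fun i => ξ ^ i with hU
  have hUN : ∀ s ∈ U, s ^ (q - 1) = 1 := by
    intro s hs
    obtain ⟨i, -, rfl⟩ := Finset.mem_image.1 hs
    rw [← pow_mul, mul_comm, pow_mul, hξ.pow_eq_one, one_pow]
  have hU1 : ∀ s ∈ U, ‖s‖ = 1 := by
    intro s hs
    rw [← pow_eq_one_iff_of_nonneg (norm_nonneg _) (n := q - 1) (by omega), ← norm_pow,
      hUN s hs, norm_one]
  have hUa : ∀ s ∈ U, 1 ≤ ‖a - s‖ := by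
    intro s hs
    obtain ⟨i, -, rfl⟩ := Finset.mem_image.1 hs
    exact h1 i
  have hUcard : U.card = q - 1 := by
    rw [hU, Finset.card_image_of_injOn, Finset.card_range]
    intro i hi j hj hij
    exact hξ.pow_inj (Finset.mem_range.1 hi) (Finset.mem_range.1 hj) hij
  have h0U : (0 : Ω) ∉ U := fun h => by
    have := hU1 0 h; rw [norm_zero] at this; exact zero_ne_one this
  have haU : a ∉ insert 0 U := by
    rw [Finset.mem_insert]
    rintro (rfl | h)
    · rw [norm_zero] at h0; exact absurd h0 (not_le.2 one_pos)
    · have := hUa a h; rw [sub_self, norm_zero] at this; exact absurd this (not_le.2 one_pos)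
  let b : ℕ → Ω := fun i => if i = q then 1 else if i = 1 then -1 else 0
  have hsum : ∀ s : Ω, ∑ i ∈ Finset.range (q + 1), b i * s ^ i = s ^ q - s := by
    intro s
    have h2 : ∑ i ∈ Finset.range q, b i * s ^ i = -s := by
      rw [Finset.sum_eq_single 1]
      · simp [b, hq.ne]
      · intro i hi hi1
        have : i ≠ q := (Finset.mem_range.1 hi).ne
        simp [b, this, hi1]
      · intro h; exact absurd (Finset.mem_range.2 hq) h
    rw [Finset.sum_range_succ, h2]
    simp [b]; ring
  have key := norm_lt_one_of_card_roots (D := q + 1) b (fun i _ => by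
      simp only [b]; split_ifs <;> simp) (insert a (insert 0 U))
    (fun s hs => by
      rcases Finset.mem_insert.1 hs with rfl | hs
      · exact ha
      rcases Finset.mem_insert.1 hs with rfl | hs
      · simp
      · exact (hU1 s hs).le)
    (by rw [Finset.card_insert_of_notMem haU, Finset.card_insert_of_notMem h0U, hUcard]; omega)
    (by
      have hUU : ∀ s ∈ insert 0 U, ∀ s' ∈ insert 0 U, s ≠ s' → 1 ≤ ‖s - s'‖ := by
        intro s hs s' hs' hne
        rcases Finset.mem_insert.1 hs with rfl | hs
        · rcases Finset.mem_insert.1 hs' with rfl | hs'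
          · exact absurd rfl hne
          · rw [zero_sub, norm_neg, hU1 s' hs']
        · rcases Finset.mem_insert.1 hs' with rfl | hs'
          · rw [sub_zero, hU1 s hs]
          · by_contra! hc
            exact hne (hsep s s' (hUN s hs) (hUN s' hs') hc)
      have haU' : ∀ s ∈ insert 0 U, 1 ≤ ‖a - s‖ := by
        intro s hs
        rcases Finset.mem_insert.1 hs with rfl | hs
        · rw [sub_zero]; exact h0
        · exact hUa s hs
      intro s hs s' hs' hne
      rcases Finset.mem_insert.1 hs with hs1 | hs1
      · rcases Finset.mem_insert.1 hs' with hs2 | hs2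
        · exact absurd (hs1.trans hs2.symm) hne
        · rw [hs1]; exact haU' s' hs2
      · rcases Finset.mem_insert.1 hs' with hs2 | hs2
        · rw [norm_sub_rev, hs2]; exact haU' s hs1
        · exact hUU s hs1 s' hs2 hne)
    (fun s hs => by
      rw [hsum]
      rcases Finset.mem_insert.1 hs with rfl | hs
      · exact haq
      rcases Finset.mem_insert.1 hs with rfl | hs
      · rw [zero_pow (by omega), sub_zero, norm_zero]; exact one_pos
      · rw [hq', pow_succ, hUN s hs, one_mul, sub_self, norm_zero]; exact one_pos)
  have h3 := key q (Nat.lt_succ_self q)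
  simp [b] at h3

end

section

open IntermediateField

variable {p : ℕ} [Fact p.Prime] {Ω : Type*} [NormedField Ω]
  [NormedAlgebra ℚ_[p] Ω]

/-- A Kummer extension of degree `p ^ n`. -/
structure IsKummerDatum (M : IntermediateField ℚ_[p] Ω) (n : ℕ) (ζ x Y : Ω) : Prop where
  ne_two : p ≠ 2
  pos : 1 ≤ n
  root : IsPrimitiveRoot ζ (p ^ n)
  mem_root : ζ ∈ M
  mem : x ∈ M
  not_pow : ∀ w ∈ M, w ^ p ≠ x
  pow_eq : Y ^ p ^ n = x

/-- The automorphism `s` preserves `M` and the Kummer extension, and conjugates the Kummer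
automorphism to its `k`-th power. -/
structure IsKummerCompatible (M : IntermediateField ℚ_[p] Ω) (n : ℕ) (ζ x : Ω)
    (s : Ω ≃ₐ[ℚ_[p]] Ω) (k : ℕ) : Prop where
  map_mem : ∀ a ∈ M, s a ∈ M
  exists_map_eq : ∃ (c j : ℕ) (w : Ω), w ∈ M ∧ s ζ = ζ ^ c ∧ s x = x ^ j * w ^ p ^ n ∧
    k * j ≡ c [MOD p ^ n]

/-- A Kummer automorphism. -/
structure IsKummerAut (M : IntermediateField ℚ_[p] Ω) (ζ Y : Ω) (τ : Ω ≃ₐ[ℚ_[p]] Ω) : Prop where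
  map_eq : ∀ a ∈ M, τ a = a
  map_gen : τ Y = ζ * Y

variable {M : IntermediateField ℚ_[p] Ω} {n : ℕ} {ζ x Y : Ω} {s τ : Ω ≃ₐ[ℚ_[p]] Ω} {k : ℕ}

theorem IsKummerDatum.gen_ne_zero (h : IsKummerDatum M n ζ x Y) : Y ≠ 0 := by
  rintro rfl
  refine h.not_pow 0 M.zero_mem ?_
  rw [← h.pow_eq, zero_pow (Fact.out : p.Prime).ne_zero,
    zero_pow (pow_ne_zero _ (Fact.out : p.Prime).ne_zero)]

theorem IsKummerDatum.pow_map_gen (h : IsKummerDatum M n ζ x Y) (hτ : IsKummerAut M ζ Y τ)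
    (i : ℕ) : (τ ^ i) Y = ζ ^ i * Y :=
  pow_map_eq_of_map_eq_mul (hτ.map_eq ζ h.mem_root) hτ.map_gen i

theorem IsKummerAut.pow_map_eq (hτ : IsKummerAut M ζ Y τ) {a : Ω} (ha : a ∈ M) (i : ℕ) :
    (τ ^ i) a = a := AlgEquiv.pow_apply_eq_self (hτ.map_eq a ha) i

theorem IsKummerCompatible.exists_map_gen (hs : IsKummerCompatible M n ζ x s k)
    (h : IsKummerDatum M n ζ x Y) :
    ∃ j, ∃ w ∈ M, s Y = Y ^ j * w ∧ s ζ = ζ ^ (k * j) := by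
  obtain ⟨c, j, w, hw, hsζ, hsx, hkj⟩ := hs.exists_map_eq
  have hP : 0 < p ^ n := pow_pos (Fact.out : p.Prime).pos n
  have hsY0 : s Y ≠ 0 := (map_ne_zero s).2 h.gen_ne_zero
  have h1 : (s Y) ^ p ^ n = (Y ^ j * w) ^ p ^ n := by
    rw [← map_pow, h.pow_eq, hsx, mul_pow, ← pow_mul, mul_comm j, pow_mul, h.pow_eq]
  have h0 : Y ^ j * w ≠ 0 := by
    intro h0
    rw [h0, zero_pow hP.ne'] at h1
    exact hsY0 (eq_zero_of_pow_eq_zero h1)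
  have h2 : (s Y / (Y ^ j * w)) ^ p ^ n = 1 := by
    rw [div_pow, h1, div_self (pow_ne_zero _ h0)]
  have : NeZero (p ^ n) := ⟨hP.ne'⟩
  obtain ⟨i, -, hi⟩ := h.root.eq_pow_of_pow_eq_one h2
  refine ⟨j, ζ ^ i * w, M.mul_mem (pow_mem h.mem_root i) hw, ?_, ?_⟩
  · rw [eq_div_iff h0] at hi
    rw [← hi]; ring
  · rw [hsζ]
    exact pow_eq_pow_of_modEq hkj.symm h.root.pow_eq_one

variable [Algebra.IsAlgebraic ℚ_[p] Ω]

theorem IsKummerCompatible.map_mem_adjoin (hs : IsKummerCompatible M n ζ x s k)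
    (h : IsKummerDatum M n ζ x Y) : ∀ a ∈ M.adjoinElem Y, s a ∈ M.adjoinElem Y := by
  obtain ⟨j, w, hw, hsY, -⟩ := hs.exists_map_gen h
  refine M.map_mem_adjoinElem s (fun a ha => M.le_adjoinElem Y (hs.map_mem a ha)) ?_
  rw [hsY]
  exact (M.adjoinElem Y).mul_mem (pow_mem (M.self_mem_adjoinElem Y) j) (M.le_adjoinElem Y hw)

theorem IsKummerCompatible.map_comm (hs : IsKummerCompatible M n ζ x s k)
    (h : IsKummerDatum M n ζ x Y) (hτ : IsKummerAut M ζ Y τ) :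
    ∀ a ∈ M.adjoinElem Y, s (τ a) = (τ ^ k) (s a) := by
  obtain ⟨j, w, hw, hsY, hsζ⟩ := hs.exists_map_gen h
  refine M.eqOn_adjoinElem (τ.trans s) (s.trans (τ ^ k)) (fun a ha => ?_) ?_
  · rw [AlgEquiv.trans_apply, AlgEquiv.trans_apply, hτ.map_eq a ha,
      hτ.pow_map_eq (hs.map_mem a ha)]
  · rw [AlgEquiv.trans_apply, AlgEquiv.trans_apply, hτ.map_gen, map_mul, hsY, hsζ, map_mul, map_pow,
      h.pow_map_gen hτ, hτ.pow_map_eq hw]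
    ring

theorem IsKummerDatum.pow_map_self (h : IsKummerDatum M n ζ x Y) (hτ : IsKummerAut M ζ Y τ) :
    ∀ a ∈ M.adjoinElem Y, (τ ^ p ^ n) a = a := by
  refine M.eqOn_adjoinElem (τ ^ p ^ n) 1 (fun a ha => hτ.pow_map_eq ha _) ?_
  rw [h.pow_map_gen hτ, h.root.pow_eq_one, one_mul, AlgEquiv.one_apply]

theorem IsKummerDatum.map_mem_adjoin (h : IsKummerDatum M n ζ x Y) (hτ : IsKummerAut M ζ Y τ) :
    ∀ a ∈ M.adjoinElem Y, τ a ∈ M.adjoinElem Y := by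
  refine M.map_mem_adjoinElem τ
    (fun a ha => M.le_adjoinElem Y (by rw [hτ.map_eq a ha]; exact ha)) ?_
  rw [hτ.map_gen]
  exact (M.adjoinElem Y).mul_mem (M.le_adjoinElem Y h.mem_root) (M.self_mem_adjoinElem Y)

theorem IsKummerDatum.mem_of_map_eq (h : IsKummerDatum M n ζ x Y) (hτ : IsKummerAut M ζ Y τ)
    {a : Ω} (ha : a ∈ M.adjoinElem Y) (hfix : τ a = a) : a ∈ M :=
  mem_of_map_eq_of_mem_adjoinElem M h.ne_two h.mem h.not_pow h.pow_eq h.root h.mem_root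
    hτ.map_eq hτ.map_gen ha hfix

variable [IsAlgClosed Ω]

theorem IsKummerDatum.exists_aut (h : IsKummerDatum M n ζ x Y) :
    ∃ τ : Ω ≃ₐ[ℚ_[p]] Ω, IsKummerAut M ζ Y τ := by
  obtain ⟨τ, h1, h2⟩ := exists_kummer_algEquiv M h.ne_two h.mem h.not_pow h.pow_eq
    h.root.pow_eq_one
  exact ⟨τ, h1, h2⟩

variable [IsUltrametricDist Ω] [FiniteDimensional ℚ_[p] M]

theorem IsKummerDatum.exists_residueCard (h : IsKummerDatum M n ζ x Y)
    (hs : IsKummerCompatible M n ζ x s k) (hk : 1 ≤ k) (hkp : (k - 1).Coprime p) :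
    ∃ q, IsResidueCard (M.adjoinElem Y) q ∧
      ∀ a ∈ M.adjoinElem Y, ‖a‖ ≤ 1 → ∃ b ∈ M, ‖a - b‖ < 1 := by
  have hp : p.Prime := Fact.out
  obtain ⟨τ, hτ⟩ := h.exists_aut
  obtain ⟨q, hq⟩ := exists_isResidueCard (M.adjoinElem Y)
  obtain ⟨f, hf, hqf⟩ := hq.eq_pow
  have hq1 : 1 < q := hqf ▸ Nat.one_lt_pow (by omega) hp.one_lt
  have hN : ¬ p ∣ q - 1 := by
    intro hd
    have h1 : p ∣ q := hqf ▸ dvd_pow_self p (by omega)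
    have h2 := (Nat.dvd_sub h1 hd)
    rw [Nat.sub_sub_self hq1.le] at h2
    exact hp.one_lt.ne' (Nat.dvd_one.1 h2)
  have : CharZero Ω := charZero_of_injective_algebraMap (algebraMap ℚ_[p] Ω).injective
  have hNZ : NeZero (q - 1) := ⟨by omega⟩
  obtain ⟨ξ, hξ⟩ := HasEnoughRootsOfUnity.exists_primitiveRoot Ω (q - 1)
  have hξK : ξ ∈ M.adjoinElem Y := by
    obtain ⟨Φ, -, hΦξ, hΦ⟩ := exists_frobenius (M.adjoinElem Y) hq hN hξ.pow_eq_one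
    refine hΦ ξ ((M.adjoinElem Y).self_mem_adjoinElem ξ) ?_
    rw [hΦξ]
    conv_lhs => rw [show q = q - 1 + 1 by omega, pow_succ, hξ.pow_eq_one, one_mul]
  have hpow : ∀ g : Ω ≃ₐ[ℚ_[p]] Ω, ∃ a, g ξ = ξ ^ a := by
    intro g
    have h1 : (g ξ) ^ (q - 1) = 1 := by rw [← map_pow, hξ.pow_eq_one, map_one]
    obtain ⟨a, -, ha⟩ := hξ.eq_pow_of_pow_eq_one h1
    exact ⟨a, ha.symm⟩
  have hτξ : τ ξ = ξ := by
    obtain ⟨b, hb⟩ := hpow s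
    obtain ⟨a, ha⟩ := hpow (τ ^ k)
    have h1 := hs.map_comm h hτ ξ hξK
    have h2 : τ ξ = (τ ^ k) ξ := by
      refine s.injective ?_
      rw [h1, ha, hb, map_pow, map_pow, hb, ha, ← pow_mul, ← pow_mul, mul_comm]
    have h3 : (τ ^ (k - 1)) ξ = ξ := by
      refine τ.injective ?_
      conv_rhs => rw [h2, show k = k - 1 + 1 by omega, pow_succ', AlgEquiv.mul_apply]
    have h4 : (τ ^ p ^ n) ξ = ξ := h.pow_map_self hτ ξ hξK
    have h5 : Function.IsPeriodicPt τ (k - 1) ξ := by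
      rw [Function.IsPeriodicPt, Function.IsFixedPt, ← AlgEquiv.coe_pow]; exact h3
    have h6 : Function.IsPeriodicPt τ (p ^ n) ξ := by
      rw [Function.IsPeriodicPt, Function.IsFixedPt, ← AlgEquiv.coe_pow]; exact h4
    have h7 := h5.gcd h6
    rw [Nat.Coprime.gcd_eq_one (hkp.pow_right n)] at h7
    exact h7
  have hξM : ξ ∈ M := h.mem_of_map_eq hτ hξK hτξ
  refine ⟨q, hq, fun a ha ha1 => ?_⟩
  rcases exists_norm_sub_pow_lt_one hq1 hξ (fun s s' => eq_of_norm_sub_lt_one_of_pow_eq_one p hN)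
    ha1 (hq.norm_pow_sub_lt a ha ha1) with h1 | ⟨i, h1⟩
  · exact ⟨0, M.zero_mem, by rwa [sub_zero]⟩
  · exact ⟨ξ ^ i, pow_mem hξM i, h1⟩

end

section

open IntermediateField

variable {p : ℕ} [Fact p.Prime] {Ω : Type*} [NormedField Ω]
  [NormedAlgebra ℚ_[p] Ω] [Algebra.IsAlgebraic ℚ_[p] Ω] [IsAlgClosed Ω]
  [IsUltrametricDist Ω] {M : IntermediateField ℚ_[p] Ω} [FiniteDimensional ℚ_[p] M]
  {n : ℕ} {ζ x Y : Ω} {s τ : Ω ≃ₐ[ℚ_[p]] Ω} {k : ℕ}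

/-- The Kummer extension is totally ramified as soon as it has trivial residue extension. -/
theorem IsKummerDatum.norm_uniformizer (h : IsKummerDatum M n ζ x Y)
    (hres : ∀ a ∈ M.adjoinElem Y, ‖a‖ ≤ 1 → ∃ b ∈ M, ‖a - b‖ < 1)
    {ϖ π : Ω} (hϖK : ϖ ∈ M.adjoinElem Y) (hϖ0 : ϖ ≠ 0) (hϖ1 : ‖ϖ‖ < 1)
    (hϖ : ∀ z ∈ M.adjoinElem Y, z ≠ 0 → ∃ i : ℤ, ‖z‖ = ‖ϖ‖ ^ i)
    (hπM : π ∈ M) (hπ0 : π ≠ 0) (hπ1 : ‖π‖ < 1)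
    (hπ : ∀ z ∈ M, z ≠ 0 → ∃ i : ℤ, ‖z‖ = ‖π‖ ^ i) : ‖π‖ = ‖ϖ‖ ^ p ^ n := by
  have hp : p.Prime := Fact.out
  obtain ⟨τ, hτ⟩ := h.exists_aut
  have hϖp : 0 < ‖ϖ‖ := norm_pos_iff.2 hϖ0
  have hinj : ∀ i j : ℤ, ‖ϖ‖ ^ i = ‖ϖ‖ ^ j → i = j := fun i j hij =>
    zpow_right_injective₀ hϖp hϖ1.ne hij
  obtain ⟨e, he⟩ := hϖ π (M.le_adjoinElem Y hπM) hπ0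
  have he0 : 0 < e := by
    by_contra! hc
    rw [he] at hπ1
    exact absurd hπ1 (not_lt.2 (one_le_zpow_of_nonpos₀ hϖp hϖ1.le hc))
  -- the norm of the uniformizer bounds the ramification index from above
  have hdvd : e ∣ (p ^ n : ℕ) := by
    have hfixed : τ (cycNorm τ (p ^ n) ϖ) = cycNorm τ (p ^ n) ϖ :=
      map_self_cycNorm (h.pow_map_self hτ ϖ hϖK)
    have hmemK := cycNorm_mem (M.adjoinElem Y) (h.map_mem_adjoin hτ) hϖK (P := p ^ n)
    have hmem := h.mem_of_map_eq hτ hmemK hfixed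
    have hnorm : ‖cycNorm τ (p ^ n) ϖ‖ = ‖ϖ‖ ^ (p ^ n) := by
      rw [cycNorm, norm_prod, Finset.prod_congr rfl fun i _ => AlgEquiv.norm_map_of_padic (τ ^ i) ϖ,
        Finset.prod_const, Finset.card_range]
    have hne : cycNorm τ (p ^ n) ϖ ≠ 0 := by
      rw [← norm_ne_zero_iff, hnorm]; exact pow_ne_zero _ hϖp.ne'
    obtain ⟨i, hi⟩ := hπ _ hmem hne
    rw [hnorm, he, ← zpow_mul, ← zpow_natCast] at hi
    exact ⟨i, hinj _ _ hi⟩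
  have hle : (p ^ n : ℕ) ≤ e.toNat := by
    let v : Fin e.toNat → Ω := fun i => ϖ ^ (i : ℕ)
    let W : Submodule M Ω := Submodule.span M (Set.range v)
    let K : Submodule M Ω := Subalgebra.toSubmodule (IntermediateField.adjoin M {Y}).toSubalgebra
    have hWfin : Module.Finite M W := Module.Finite.span_of_finite M (Set.finite_range v)
    have hWfin' : Module.Finite ℚ_[p] (W.restrictScalars ℚ_[p]) :=
      Module.Finite.trans (R := ℚ_[p]) M W
    have hWK : W ≤ K := by
      refine Submodule.span_le.2 ?_
      rintro _ ⟨i, rfl⟩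
      have h1 := pow_mem hϖK (i : ℕ)
      exact h1
    have hKW : K.restrictScalars ℚ_[p] ≤ W.restrictScalars ℚ_[p] := by
      refine mem_of_forall_exists_norm_sub_lt _ _ hWK ?_
      intro a ha ha0
      have haK : a ∈ M.adjoinElem Y := ha
      obtain ⟨i, hi⟩ := hϖ a haK ha0
      set c : Ω := ϖ ^ (i % e).toNat * π ^ (i / e) with hc
      have hmod := Int.emod_nonneg i he0.ne'
      have hcn : ‖a‖ = ‖c‖ := by
        rw [hc, norm_mul, norm_pow, norm_zpow, he, ← zpow_natCast, Int.toNat_of_nonneg hmod,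
          ← zpow_mul, ← zpow_add₀ hϖp.ne', hi, Int.emod_add_mul_ediv]
      have hc0 : c ≠ 0 := by rw [← norm_ne_zero_iff, ← hcn, norm_ne_zero_iff]; exact ha0
      have hcK : c ∈ M.adjoinElem Y :=
        (M.adjoinElem Y).mul_mem (pow_mem hϖK _) (zpow_mem (M.le_adjoinElem Y hπM) _)
      obtain ⟨b, hb, hab⟩ := hres (a / c) ((M.adjoinElem Y).div_mem haK hcK) (by
        rw [norm_div, hcn, div_self (norm_ne_zero_iff.2 hc0)])
      refine ⟨b * c, ?_, ?_⟩
      · have hlt : (i % e).toNat < e.toNat := by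
          have := Int.emod_lt_of_pos i he0; omega
        have h1 : v ⟨(i % e).toNat, hlt⟩ ∈ W := Submodule.subset_span ⟨_, rfl⟩
        have h2 := W.smul_mem (⟨b * π ^ (i / e), M.mul_mem hb (zpow_mem hπM _)⟩ : M) h1
        have h3 : (⟨b * π ^ (i / e), M.mul_mem hb (zpow_mem hπM _)⟩ : M) •
            v ⟨(i % e).toNat, hlt⟩ = b * c := by
          rw [hc]
          change b * π ^ (i / e) * ϖ ^ (i % e).toNat = _
          ring
        rw [h3] at h2
        exact h2
      · have h4 : a - b * c = (a / c - b) * c := by field_simp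
        rw [h4, norm_mul, hcn]
        exact mul_lt_of_lt_one_left (norm_pos_iff.2 hc0) hab
    have h1 : Module.finrank M K ≤ Module.finrank M W :=
      Submodule.finrank_mono (t := W) fun a ha => hKW ha
    have h2 : Module.finrank M W ≤ e.toNat := by
      have := finrank_range_le_card (R := M) v
      rw [Fintype.card_fin] at this
      exact this
    have h3 : Module.finrank M K = p ^ n := by
      have := IntermediateField.adjoin.finrank (isIntegral_of_padic M Y)
      rw [natDegree_minpoly_of_pow_eq M h.ne_two h.mem h.not_pow h.pow_eq] at this
      exact this
    omega
  have heq : e = (p ^ n : ℕ) := by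
    have := Int.le_of_dvd (by exact_mod_cast pow_pos hp.pos n) hdvd
    omega
  rw [he, heq, zpow_natCast]

/-- A Kummer extension with trivial residue extension stays of full degree after an unramified
base change. -/
theorem IsKummerDatum.not_pow_adjoin (h : IsKummerDatum M n ζ x Y)
    (hres : ∀ a ∈ M.adjoinElem Y, ‖a‖ ≤ 1 → ∃ b ∈ M, ‖a - b‖ < 1)
    {N : ℕ} {ξ : Ω} (hN : ¬ p ∣ N) (hξ : ξ ^ N = 1) : ∀ w ∈ M.adjoinElem ξ, w ^ p ≠ x := by
  intro w hw hwx
  have hp : p.Prime := Fact.out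
  have hn := h.pos
  have hY0 := h.gen_ne_zero
  have hpn : p ^ n = p ^ (n - 1) * p := by rw [← pow_succ, Nat.sub_add_cancel hn]
  have hwK : w ∈ M.adjoinElem Y := by
    have h1 : (w / Y ^ p ^ (n - 1)) ^ p = 1 := by
      rw [div_pow, ← pow_mul, ← hpn, h.pow_eq, hwx, ← hwx,
        div_self (by rw [hwx, ← h.pow_eq]; exact pow_ne_zero _ hY0)]
    have h2 : (w / Y ^ p ^ (n - 1)) ^ p ^ n = 1 := by
      rw [hpn, mul_comm, pow_mul, h1, one_pow]
    have : NeZero (p ^ n) := ⟨(pow_pos hp.pos n).ne'⟩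
    obtain ⟨i, -, hi⟩ := h.root.eq_pow_of_pow_eq_one h2
    rw [eq_div_iff (pow_ne_zero _ hY0)] at hi
    rw [← hi]
    exact (M.adjoinElem Y).mul_mem (M.le_adjoinElem Y (pow_mem h.mem_root i))
      (pow_mem (M.self_mem_adjoinElem Y) _)
  have hfd : FiniteDimensional ℚ_[p] (Subalgebra.toSubmodule M.toSubalgebra) :=
    inferInstanceAs (FiniteDimensional ℚ_[p] M)
  have key := mem_of_forall_exists_norm_sub_lt (Subalgebra.toSubmodule M.toSubalgebra)
    (Subalgebra.toSubmodule (M.adjoinElem w).toSubalgebra) (M.le_adjoinElem w) ?_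
  · exact h.not_pow w (key (M.self_mem_adjoinElem w)) hwx
  intro a ha ha0
  have haK : a ∈ M.adjoinElem Y := adjoinElem_le (M.le_adjoinElem Y) hwK ha
  have haξ : a ∈ M.adjoinElem ξ := adjoinElem_le (M.le_adjoinElem ξ) hw ha
  obtain ⟨c, hcM, hcn⟩ := exists_norm_eq_of_mem_adjoinElem M hN hξ haξ
  have hc0 : c ≠ 0 := by rw [← norm_ne_zero_iff, ← hcn, norm_ne_zero_iff]; exact ha0
  obtain ⟨b, hb, hab⟩ := hres (a / c)
    ((M.adjoinElem Y).div_mem haK (M.le_adjoinElem Y hcM)) (by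
        rw [norm_div, hcn, div_self (norm_ne_zero_iff.2 hc0)])
  refine ⟨b * c, M.mul_mem hb hcM, ?_⟩
  have h4 : a - b * c = (a / c - b) * c := by field_simp
  rw [h4, norm_mul, hcn]
  exact mul_lt_of_lt_one_left (norm_pos_iff.2 hc0) hab

/-- The reciprocity character of a Kummer extension admitting a suitable semilinear
automorphism. -/
theorem IsKummerDatum.exists_character (h : IsKummerDatum M n ζ x Y)
    (hs : IsKummerCompatible M n ζ x s k) (hk : 1 ≤ k) (hkp : (k - 1).Coprime p) :
    ∃ τ : Ω ≃ₐ[ℚ_[p]] Ω, IsKummerAut M ζ Y τ ∧ ∃ R : Ω → ZMod (p ^ n),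
      (∀ a ∈ M, ∀ b ∈ M, ‖a‖ = 1 → ‖b‖ = 1 → R (a * b) = R a + R b) ∧
      (∀ u ∈ M, ‖u‖ = 1 → (R u = 0 ↔ ∃ z ∈ M.adjoinElem Y, cycNorm τ (p ^ n) z = u)) ∧
      (∃ c ∈ M, ‖c‖ = 1 ∧ R c = 1) ∧
      (∀ (g : Ω ≃ₐ[ℚ_[p]] Ω) (l : ℕ), IsKummerCompatible M n ζ x g l → l.Coprime p →
        ∀ u ∈ M, ‖u‖ = 1 → R (g u) = l * R u) := by
  have hp : p.Prime := Fact.out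
  set P := p ^ n with hP
  have hPpos : 0 < P := pow_pos hp.pos n
  obtain ⟨q, hq, hres⟩ := h.exists_residueCard hs hk hkp
  obtain ⟨f, hf, hqf⟩ := hq.eq_pow
  have hq1 : 1 < q := hqf ▸ Nat.one_lt_pow (by omega) hp.one_lt
  set N := q ^ P - 1 with hNdef
  have hqP : 1 < q ^ P := Nat.one_lt_pow hPpos.ne' hq1
  have hN : ¬ p ∣ N := by
    intro hd
    have h1 : p ∣ q ^ P := dvd_pow (hqf ▸ dvd_pow_self p (by omega)) hPpos.ne'
    have h2 := (Nat.dvd_sub h1 hd)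
    rw [hNdef, Nat.sub_sub_self hqP.le] at h2
    exact hp.one_lt.ne' (Nat.dvd_one.1 h2)
  have : CharZero Ω := charZero_of_injective_algebraMap (algebraMap ℚ_[p] Ω).injective
  have hNZ : NeZero N := ⟨by omega⟩
  obtain ⟨ξ, hξ⟩ := HasEnoughRootsOfUnity.exists_primitiveRoot Ω N
  set K := M.adjoinElem Y with hK
  obtain ⟨φ, hφK, hφξ, hφfix⟩ := exists_frobenius K hq hN hξ.pow_eq_one
  set L := K.adjoinElem ξ with hL
  have hMK : M ≤ K := M.le_adjoinElem Y
  have hKL : K ≤ L := K.le_adjoinElem ξ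
  have hξL : ξ ∈ L := K.self_mem_adjoinElem ξ
  have hYK : Y ∈ K := M.self_mem_adjoinElem Y
  set M' := M.adjoinElem ξ with hM'
  have hMM' : M ≤ M' := M.le_adjoinElem ξ
  have h' : IsKummerDatum M' n ζ x Y :=
    { ne_two := h.ne_two
      pos := h.pos
      root := h.root
      mem_root := hMM' h.mem_root
      mem := hMM' h.mem
      not_pow := h.not_pow_adjoin hres hN hξ.pow_eq_one
      pow_eq := h.pow_eq }
  obtain ⟨τ, hτ'⟩ := h'.exists_aut
  have hτ : IsKummerAut M ζ Y τ := ⟨fun a ha => hτ'.map_eq a (hMM' ha), hτ'.map_gen⟩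
  have hτξ : τ ξ = ξ := hτ'.map_eq ξ (M.self_mem_adjoinElem ξ)
  have hLM' : L ≤ M'.adjoinElem Y :=
    adjoinElem_le (adjoinElem_le (hMM'.trans (M'.le_adjoinElem Y)) (M'.self_mem_adjoinElem Y))
      (M'.le_adjoinElem Y (M.self_mem_adjoinElem ξ))
  have hτfix : ∀ z ∈ L, τ z = z → z ∈ M' := fun z hz hz' => h'.mem_of_map_eq hτ' (hLM' hz) hz'
  obtain ⟨ϖ, hϖK, hϖ0, hϖ1, hϖ⟩ := exists_uniformizer_of_finiteDimensional K
  obtain ⟨π, hπM, hπ0, hπ1, hπ⟩ := exists_uniformizer_of_finiteDimensional M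
  have hπϖ := h.norm_uniformizer hres hϖK hϖ0 hϖ1 hϖ hπM hπ0 hπ1 hπ
  have hφpow : ∀ i : ℕ, (φ ^ i) ξ = ξ ^ q ^ i := by
    intro i
    induction i with
    | zero => simp
    | succ i ih => rw [pow_succ', AlgEquiv.mul_apply, ih, map_pow, hφξ, ← pow_mul]; ring_nf
  have hτK := h.map_mem_adjoin hτ
  have hB : BicyclicExtension L τ φ P ϖ π :=
    { pos := hPpos
      norm_map := fun s x => s.norm_map_of_padic x
      comm := by
        refine K.eqOn_adjoinElem (τ.trans φ) (φ.trans τ) (fun a ha => ?_) ?_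
        · rw [AlgEquiv.trans_apply, AlgEquiv.trans_apply, hφK a ha, hφK _ (hτK a ha)]
        · rw [AlgEquiv.trans_apply, AlgEquiv.trans_apply, hτξ, hφξ, map_pow, hτξ]
      map_τ := K.map_mem_adjoinElem τ (fun a ha => hKL (hτK a ha)) (by rw [hτξ]; exact hξL)
      map_φ := K.map_mem_adjoinElem φ (fun a ha => by rw [hφK a ha]; exact hKL ha)
        (by rw [hφξ]; exact pow_mem hξL q)
      pow_τ := K.eqOn_adjoinElem (τ ^ P) 1 (h.pow_map_self hτ)
        (by rw [AlgEquiv.pow_apply_eq_self hτξ, AlgEquiv.one_apply])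
      pow_φ := K.eqOn_adjoinElem (φ ^ P) 1
        (fun a ha => by rw [AlgEquiv.pow_apply_eq_self (hφK a ha), AlgEquiv.one_apply])
        (by rw [hφpow, AlgEquiv.one_apply, show q ^ P = N + 1 by omega, pow_succ, hξ.pow_eq_one,
              one_mul])
      exists_τ := fun i hi0 hiP => ⟨Y, hKL hYK, hφK Y hYK, fun hc => by
        rw [h.pow_map_gen hτ] at hc
        have h1 : ζ ^ i = 1 := mul_right_cancel₀ h.gen_ne_zero (hc.trans (one_mul Y).symm)
        exact absurd (Nat.le_of_dvd hi0 (h.root.dvd_of_pow_eq_one i h1)) (not_le.2 hiP)⟩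
      exists_φ := fun i hi0 hiP => ⟨ξ, hξL, hτξ, fun hc => by
        rw [hφpow] at hc
        have hξ0 : ξ ≠ 0 := hξ.ne_zero hNZ.out
        have hlt : q ^ i < q ^ P := Nat.pow_lt_pow_right hq1 hiP
        have hgt : 1 < q ^ i := Nat.one_lt_pow hi0.ne' hq1
        have h1 : ξ ^ (q ^ i - 1) = 1 := mul_right_cancel₀ hξ0 (by
          rw [← pow_succ, Nat.sub_add_cancel hgt.le, hc, one_mul])
        have := Nat.le_of_dvd (by omega) (hξ.dvd_of_pow_eq_one _ h1)
        omega⟩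
      mem_ϖ := hKL hϖK
      fixed_ϖ := hφK ϖ hϖK
      ne_zero := hϖ0
      norm_lt := hϖ1
      norm_eq := fun z hz hz0 => by
        obtain ⟨b, hb, hzb⟩ := exists_norm_eq_of_mem_adjoinElem K hN hξ.pow_eq_one hz
        rw [hzb]
        exact hϖ b hb (by rw [← norm_ne_zero_iff, ← hzb, norm_ne_zero_iff]; exact hz0)
      norm_eq_of_fixed := fun z hz hfix hz0 => by
        obtain ⟨b, hb, hzb⟩ :=
          exists_norm_eq_of_mem_adjoinElem M hN hξ.pow_eq_one (hτfix z hz hfix)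
        obtain ⟨i, hi⟩ := hπ b hb (by rw [← norm_ne_zero_iff, ← hzb, norm_ne_zero_iff]; exact hz0)
        refine ⟨i, ?_⟩
        rw [hzb, hi, hπϖ, zpow_mul, zpow_natCast]
      mem_π := hKL (hMK hπM)
      τ_π := hτ.map_eq π hπM
      φ_π := hφK π (hMK hπM)
      norm_π := hπϖ }
  have hbase : ∀ u ∈ M, ‖u‖ = 1 → hB.IsBaseUnit u := fun u hu hu1 =>
    ⟨hKL (hMK hu), hτ.map_eq u hu, hφK u (hMK hu), hu1⟩
  obtain ⟨R, hRmul, hRker, ⟨c, hc, hRc⟩, hRs⟩ := hB.exists_reciprocity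
  refine ⟨τ, hτ, R, fun a ha b hb ha1 hb1 => hRmul a b (hbase a ha ha1) (hbase b hb hb1), ?_,
    ⟨c, h.mem_of_map_eq hτ (hφfix c hc.1 hc.2.2.1) hc.2.1, hc.2.2.2, hRc⟩, ?_⟩
  · intro u hu hu1
    rw [hRker u (hbase u hu hu1)]
    exact ⟨fun ⟨y, hy, hφy, hN⟩ => ⟨y, hφfix y hy hφy, hN⟩,
      fun ⟨y, hy, hN⟩ => ⟨y, hKL hy, hφK y hy, hN⟩⟩
  · intro g l hg hl u hu hu1
    have hgK := hg.map_mem_adjoin h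
    have hgN : (g ξ) ^ N = 1 := by rw [← map_pow, hξ.pow_eq_one, map_one]
    obtain ⟨a, -, ha⟩ := hξ.eq_pow_of_pow_eq_one hgN
    refine hRs g l (hl.pow_right n) ?_ ?_ ?_ u (hbase u hu hu1)
    · exact K.map_mem_adjoinElem g (fun a ha => hKL (hgK a ha)) (by rw [← ha]; exact pow_mem hξL a)
    · refine K.eqOn_adjoinElem (φ.trans g) (g.trans φ) (fun b hb => ?_) ?_
      · rw [AlgEquiv.trans_apply, AlgEquiv.trans_apply, hφK b hb, hφK _ (hgK b hb)]
      · rw [AlgEquiv.trans_apply, AlgEquiv.trans_apply, hφξ, map_pow, ← ha, map_pow, hφξ]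
        ring
    · refine K.eqOn_adjoinElem (τ.trans g) (g.trans (τ ^ l)) (hg.map_comm h hτ) ?_
      rw [AlgEquiv.trans_apply, AlgEquiv.trans_apply, hτξ, ← ha, map_pow,
        AlgEquiv.pow_apply_eq_self hτξ]

end

section

open IntermediateField

variable {p : ℕ} [Fact p.Prime] {Ω : Type*} [NormedField Ω]
  [NormedAlgebra ℚ_[p] Ω] [Algebra.IsAlgebraic ℚ_[p] Ω] [IsAlgClosed Ω]
  [IsUltrametricDist Ω] {M : IntermediateField ℚ_[p] Ω} [FiniteDimensional ℚ_[p] M]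
  {n : ℕ} {ζ x Y : Ω} {s τ : Ω ≃ₐ[ℚ_[p]] Ω} {k : ℕ}

/-- Grouping the factors of the norm along a subgroup. -/
theorem cycNorm_mul_left (τ : Ω ≃ₐ[ℚ_[p]] Ω) (a b : ℕ) (z : Ω) :
    cycNorm τ (a * b) z = cycNorm τ a (cycNorm (τ ^ a) b z) := by
  induction b with
  | zero => simp [cycNorm]
  | succ b ih =>
    have h1 : cycNorm (τ ^ a) (b + 1) z = cycNorm (τ ^ a) b z * ((τ ^ a) ^ b) z := by
      simp only [cycNorm, Finset.prod_range_succ]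
    rw [h1, cycNorm_mul, ← ih, mul_add, mul_one]
    simp only [cycNorm, Finset.prod_range_add]
    congr 1
    refine Finset.prod_congr rfl fun i _ => ?_
    rw [← pow_mul, ← AlgEquiv.mul_apply, ← pow_add, add_comm]

/-- Norms from the intermediate fields of a Kummer extension are detected by multiples of the
reciprocity character. -/
theorem IsKummerDatum.exists_cycNorm_eq_iff (h : IsKummerDatum M n ζ x Y)
    (hτ : IsKummerAut M ζ Y τ) {R : Ω → ZMod (p ^ n)}
    (hmul : ∀ a ∈ M, ∀ b ∈ M, ‖a‖ = 1 → ‖b‖ = 1 → R (a * b) = R a + R b)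
    (hker : ∀ u ∈ M, ‖u‖ = 1 → (R u = 0 ↔ ∃ z ∈ M.adjoinElem Y, cycNorm τ (p ^ n) z = u))
    (hone : ∃ c ∈ M, ‖c‖ = 1 ∧ R c = 1) {m : ℕ} (hmn : m ≤ n) {u : Ω} (hu : u ∈ M)
    (hu1 : ‖u‖ = 1) :
    (∃ z ∈ M.adjoinElem (Y ^ p ^ (n - m)), cycNorm τ (p ^ m) z = u) ↔
      (p : ZMod (p ^ n)) ^ (n - m) * R u = 0 := by
  have hp : p.Prime := Fact.out
  have hpn : p ^ n = p ^ m * p ^ (n - m) := by rw [← pow_add, Nat.add_sub_cancel' hmn]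
  have hR1 : R 1 = 0 := by
    have := hmul 1 M.one_mem 1 M.one_mem norm_one norm_one
    rw [mul_one] at this
    exact (left_eq_add.1 this)
  have hpow : ∀ a ∈ M, ‖a‖ = 1 → ∀ i : ℕ, R (a ^ i) = i * R a := by
    intro a ha ha1 i
    induction i with
    | zero => simp [hR1]
    | succ i ih =>
      rw [pow_succ, hmul _ (pow_mem ha i) a ha (by rw [norm_pow, ha1, one_pow]) ha1, ih]
      push_cast; ring
  have hYK : Y ^ p ^ (n - m) ∈ M.adjoinElem Y := pow_mem (M.self_mem_adjoinElem Y) _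
  constructor
  · rintro ⟨z, hz, hzu⟩
    have hfix : (τ ^ p ^ m) z = z := by
      refine M.eqOn_adjoinElem (τ ^ p ^ m) 1 (fun a ha => ?_) ?_ z hz
      · rw [hτ.pow_map_eq ha, AlgEquiv.one_apply]
      · rw [map_pow, h.pow_map_gen hτ, mul_pow, ← pow_mul, ← hpn, h.root.pow_eq_one, one_mul,
          AlgEquiv.one_apply]
    have h1 := (hker (u ^ p ^ (n - m)) (pow_mem hu _) (by rw [norm_pow, hu1, one_pow])).2
      ⟨z, adjoinElem_le (M.le_adjoinElem Y) hYK hz, by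
        rw [hpn, cycNorm_mul_left, cycNorm_of_fixed hfix, cycNorm_pow, hzu]⟩
    rw [hpow u hu hu1] at h1
    exact_mod_cast h1
  · intro hRu
    obtain ⟨c, hc, hc1, hRc⟩ := hone
    have hNZ : NeZero (p ^ n) := ⟨(pow_pos hp.pos n).ne'⟩
    obtain ⟨j, hj⟩ : p ^ m ∣ (R u).val := by
      have h1 : ((p ^ (n - m) * (R u).val : ℕ) : ZMod (p ^ n)) = 0 := by
        push_cast; rw [ZMod.natCast_zmod_val]; exact hRu
      rw [ZMod.natCast_eq_zero_iff] at h1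
      generalize (R u).val = b at h1
      rw [hpn, mul_comm] at h1
      exact Nat.dvd_of_mul_dvd_mul_left (pow_pos hp.pos _) h1
    have hRu' : R u = ((p ^ m * j : ℕ) : ZMod (p ^ n)) := by
      rw [← hj, ZMod.natCast_zmod_val]
    have hc0 : c ≠ 0 := by rw [← norm_ne_zero_iff, hc1]; exact one_ne_zero
    have hcj1 : ‖c ^ (p ^ m * j)‖ = 1 := by rw [norm_pow, hc1, one_pow]
    have hw1 : ‖u * (c ^ (p ^ m * j))⁻¹‖ = 1 := by rw [norm_mul, norm_inv, hcj1, hu1]; norm_num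
    have hwM : u * (c ^ (p ^ m * j))⁻¹ ∈ M := M.mul_mem hu (M.inv_mem (pow_mem hc _))
    have hwR : R (u * (c ^ (p ^ m * j))⁻¹) = 0 := by
      have h1 := hmul _ hwM _ (pow_mem hc (p ^ m * j)) hw1 hcj1
      rw [inv_mul_cancel_right₀ (pow_ne_zero _ hc0), hpow c hc hc1, hRc, mul_one, hRu'] at h1
      exact (right_eq_add.1 h1)
    obtain ⟨z, hz, hzw⟩ := (hker _ hwM hw1).1 hwR
    rw [hpn, cycNorm_mul_left] at hzw
    have hcY := M.le_adjoinElem (Y ^ p ^ (n - m)) (pow_mem hc j)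
    refine ⟨cycNorm (τ ^ p ^ m) (p ^ (n - m)) z * c ^ j, ?_, ?_⟩
    · refine mul_mem ?_ hcY
      refine mem_adjoinElem_of_pow_map_eq M h.ne_two h.mem h.not_pow h.pow_eq h.root h.mem_root
        hτ.map_eq hτ.map_gen hmn ?_ ?_
      · refine cycNorm_mem (M.adjoinElem Y) (fun a ha => ?_) hz
        induction p ^ m with
        | zero => simpa using ha
        | succ i ih => rw [pow_succ', AlgEquiv.mul_apply]; exact h.map_mem_adjoin hτ _ ih
      · refine map_self_cycNorm ?_
        rw [← pow_mul, ← hpn]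
        exact h.pow_map_self hτ z hz
    · rw [cycNorm_mul, hzw, cycNorm_of_fixed (hτ.map_eq _ (pow_mem hc j)), ← pow_mul,
        mul_comm j, inv_mul_cancel_right₀ (pow_ne_zero _ hc0)]

end

section

open IntermediateField

variable {p : ℕ} [Fact p.Prime] {F Ω : Type*} [Field F] [NormedField Ω]
  [NormedAlgebra ℚ_[p] Ω] [Algebra.IsAlgebraic ℚ_[p] Ω] [IsAlgClosed Ω]
  [Algebra ℚ_[p] F] [Algebra F Ω] [IsScalarTower ℚ_[p] F Ω]

variable (p F Ω) in
/-- The image of a field in a field extension. -/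
noncomputable def embeddedField : IntermediateField ℚ_[p] Ω :=
  (IsScalarTower.toAlgHom ℚ_[p] F Ω).fieldRange

omit [Algebra.IsAlgebraic ℚ_[p] Ω] [IsAlgClosed Ω] in
theorem algebraMap_mem_embeddedField (b : F) : algebraMap F Ω b ∈ embeddedField p F Ω := ⟨b, rfl⟩

omit [Algebra.IsAlgebraic ℚ_[p] Ω] [IsAlgClosed Ω] in
theorem mem_adjoinElem_embeddedField {y z : Ω} :
    z ∈ (embeddedField p F Ω).adjoinElem y ↔ z ∈ adjoin F {y} := by
  constructor
  · intro hz
    refine adjoinElem_le (N := (adjoin F {y}).restrictScalars ℚ_[p]) ?_ ?_ hz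
    · rintro _ ⟨b, rfl⟩
      exact (adjoin F {y}).algebraMap_mem b
    · exact mem_adjoin_simple_self F y
  · intro hz
    let N : IntermediateField F Ω :=
      { ((embeddedField p F Ω).adjoinElem y).toSubfield with
        algebraMap_mem' := fun b =>
          (embeddedField p F Ω).le_adjoinElem y (algebraMap_mem_embeddedField b) }
    have hN : adjoin F {y} ≤ N := adjoin_le_iff.2 (Set.singleton_subset_iff.2
      ((embeddedField p F Ω).self_mem_adjoinElem y))
    exact hN hz

/-- The norm of a Kummer extension as a product of conjugates. -/
theorem algebraMap_norm_eq_cycNorm {P : ℕ} (hP : 0 < P) {y η : Ω} {a : F}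
    (hirr : Irreducible (Polynomial.X ^ P - Polynomial.C a)) (hy : y ^ P = algebraMap F Ω a)
    (hy0 : y ≠ 0)
    (hη : IsPrimitiveRoot η P) (hηF : η ∈ embeddedField p F Ω) {τ : Ω ≃ₐ[ℚ_[p]] Ω}
    (hτ : ∀ b ∈ embeddedField p F Ω, τ b = b) (hτy : τ y = η * y) (z : adjoin F {y}) :
    algebraMap F Ω (Algebra.norm F z) = cycNorm τ P (z : Ω) := by
  have : CharZero F := charZero_of_injective_algebraMap (algebraMap ℚ_[p] F).injective
  have hmin : minpoly F y = Polynomial.X ^ P - Polynomial.C a := by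
    refine (minpoly.eq_of_irreducible_of_monic hirr ?_
      (Polynomial.monic_X_pow_sub_C _ hP.ne')).symm
    rw [map_sub, map_pow, Polynomial.aeval_X, Polynomial.aeval_C, hy, sub_self]
  have hint : IsIntegral F y := by
    by_contra hc
    have h0 := minpoly.eq_zero hc
    rw [hmin] at h0
    exact hirr.ne_zero h0
  have hfin : FiniteDimensional F (adjoin F {y}) := adjoin.finiteDimensional hint
  have hfr : Module.finrank F (adjoin F {y}) = P := by
    rw [adjoin.finrank hint, hmin, Polynomial.natDegree_X_pow_sub_C]
  have hpow : ∀ i : ℕ, (τ ^ i) y = η ^ i * y := by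
    intro i
    induction i with
    | zero => simp
    | succ i ih =>
      rw [pow_succ', AlgEquiv.mul_apply, ih, map_mul, map_pow, hτ η hηF, hτy]; ring
  let e : Fin P → (adjoin F {y} →ₐ[F] Ω) := fun i =>
    { ((τ ^ (i : ℕ) : Ω ≃ₐ[ℚ_[p]] Ω) : Ω →+* Ω).comp (adjoin F {y}).val.toRingHom with
      commutes' := fun b =>
        AlgEquiv.pow_apply_eq_self (hτ _ (algebraMap_mem_embeddedField b)) _ }
  have he : ∀ i (w : adjoin F {y}), e i w = (τ ^ (i : ℕ)) (w : Ω) := fun _ _ => rfl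
  have hinj : Function.Injective e := by
    intro i j hij
    have h1 := DFunLike.congr_fun hij ⟨y, mem_adjoin_simple_self F y⟩
    rw [he, he, hpow, hpow] at h1
    exact Fin.ext (hη.pow_inj i.2 j.2 (mul_right_cancel₀ hy0 h1))
  have hbij : Function.Bijective e := by
    rw [Fintype.bijective_iff_injective_and_card]
    refine ⟨hinj, ?_⟩
    rw [Fintype.card_fin, AlgHom.card, hfr]
  rw [Algebra.norm_eq_prod_embeddings F Ω, ← Function.Bijective.prod_comp hbij (fun s => s z),
    cycNorm, Finset.prod_range]
  exact Finset.prod_congr rfl fun i _ => he i z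

theorem exists_norm_eq_iff {P : ℕ} (hP : 0 < P) {y η : Ω} {a : F}
    (hirr : Irreducible (Polynomial.X ^ P - Polynomial.C a)) (hy : y ^ P = algebraMap F Ω a)
    (hy0 : y ≠ 0)
    (hη : IsPrimitiveRoot η P) (hηF : η ∈ embeddedField p F Ω) {τ : Ω ≃ₐ[ℚ_[p]] Ω}
    (hτ : ∀ b ∈ embeddedField p F Ω, τ b = b) (hτy : τ y = η * y) (b : F) :
    (∃ z : adjoin F {y}, Algebra.norm F z = b) ↔
      ∃ z ∈ (embeddedField p F Ω).adjoinElem y, cycNorm τ P z = algebraMap F Ω b := by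
  have key := algebraMap_norm_eq_cycNorm hP hirr hy hy0 hη hηF hτ hτy
  constructor
  · rintro ⟨z, rfl⟩
    exact ⟨z, mem_adjoinElem_embeddedField.2 z.2, (key z).symm⟩
  · rintro ⟨z, hz, hzb⟩
    refine ⟨⟨z, mem_adjoinElem_embeddedField.1 hz⟩, (algebraMap F Ω).injective ?_⟩
    rw [key, hzb]

end

section

open IntermediateField

theorem Nat.val_modEq_of_units_zpow {N : ℕ} (u : (ZMod N)ˣ) (r : ℤ) [NeZero N] :
    ((u ^ (1 - r) : (ZMod N)ˣ) : ZMod N).val * ((u ^ r : (ZMod N)ˣ) : ZMod N).val ≡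
      (u : ZMod N).val [MOD N] := by
  rw [← ZMod.natCast_eq_natCast_iff]
  push_cast
  rw [ZMod.natCast_zmod_val, ZMod.natCast_zmod_val, ZMod.natCast_zmod_val, ← Units.val_mul,
    ← zpow_add, sub_add_cancel, zpow_one]

variable {p : ℕ} [Fact p.Prime] {E F : Type} {Ω : Type*} [Field E] [Field F] [NormedField Ω]
  [NormedAlgebra ℚ_[p] Ω] [Algebra.IsAlgebraic ℚ_[p] Ω] [IsAlgClosed Ω] [Algebra ℚ_[p] E]
  [Algebra E F] [Algebra ℚ_[p] F] [IsScalarTower ℚ_[p] E F] [Algebra F Ω]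
  [IsScalarTower ℚ_[p] F Ω]

variable (p Ω) in
/-- Automorphisms extend to an algebraic closure. -/
theorem AlgEquiv.exists_extend (σ : F ≃ₐ[E] F) :
    ∃ g : Ω ≃ₐ[ℚ_[p]] Ω, ∀ a : F, g (algebraMap F Ω a) = algebraMap F Ω (σ a) := by
  have : IsAlgClosure ℚ_[p] Ω := ⟨inferInstance, inferInstance⟩
  have : Normal ℚ_[p] Ω := IsAlgClosure.normal ℚ_[p] Ω
  exact ⟨(σ.restrictScalars ℚ_[p]).liftNormal Ω, fun a => AlgEquiv.liftNormal_commutes _ _ _⟩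

theorem memFr.isKummerCompatible {n : ℕ} {ζ x : F} {r : ℤ} (hx : memFr p n E ζ r x)
    (σ : F ≃ₐ[E] F) (u : (ZMod (p ^ n))ˣ) (hσ : σ ζ = ζ ^ (u : ZMod (p ^ n)).val)
    {g : Ω ≃ₐ[ℚ_[p]] Ω} (hg : ∀ a : F, g (algebraMap F Ω a) = algebraMap F Ω (σ a)) :
    IsKummerCompatible (embeddedField p F Ω) n (algebraMap F Ω ζ) (algebraMap F Ω x) g
      ((u ^ (1 - r) : (ZMod (p ^ n))ˣ) : ZMod (p ^ n)).val where
  map_mem := by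
    rintro _ ⟨b, rfl⟩
    exact ⟨σ b, (hg b).symm⟩
  exists_map_eq := by
    have : NeZero (p ^ n) := ⟨(pow_pos (Fact.out : p.Prime).pos n).ne'⟩
    obtain ⟨w, hw⟩ := hx.2 σ u hσ
    refine ⟨(u : ZMod (p ^ n)).val, ((u ^ r : (ZMod (p ^ n))ˣ) : ZMod (p ^ n)).val,
      algebraMap F Ω w, algebraMap_mem_embeddedField w, ?_, ?_, Nat.val_modEq_of_units_zpow u r⟩
    · rw [hg, hσ, map_pow]
    · rw [mul_inv_eq_iff_eq_mul₀ (pow_ne_zero _ hx.1)] at hw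
      rw [hg, hw, map_mul, map_pow, map_pow, mul_comm]

end

section

namespace PadicInt

/-- Principal units are highly divisible. -/
theorem exists_pow_eq {p : ℕ} [Fact p.Prime] {l : ℕ} (hl : ¬ p ∣ l) {y : ℤ_[p]} (hy : ‖1 - y‖ < 1) :
    ∃ z : ℤ_[p], z ^ l = y := by
  have hl1 : ‖(l : ℤ_[p])‖ = 1 := by
    have h1 : ¬ ‖(l : ℤ_[p])‖ < 1 := by
      have := PadicInt.norm_int_lt_one_iff_dvd (p := p) (l : ℤ)
      rw [Int.cast_natCast] at this
      rw [this]
      exact_mod_cast hl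
    exact le_antisymm (PadicInt.norm_le_one _) (not_lt.1 h1)
  have key := hensels_lemma (p := p) (R := ℤ_[p]) (F := Polynomial.X ^ l - Polynomial.C y)
    (a := 1) (by
    simp only [map_sub, map_pow, Polynomial.aeval_X, Polynomial.aeval_C, one_pow,
      Polynomial.derivative_X_pow, Polynomial.derivative_C, sub_zero, map_mul, map_natCast,
      mul_one, hl1]
    exact hy)
  obtain ⟨z, hz, -⟩ := key
  refine ⟨z, ?_⟩
  rw [map_sub, map_pow, Polynomial.aeval_X, Polynomial.aeval_C, sub_eq_zero] at hz
  exact hz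

end PadicInt

open AddValuation in
/-- A discrete valuation in which `p` has positive value is nonnegative on `p`-adic integers. -/
theorem AddValuation.map_padicInt_mem_lev_zero {p : ℕ} [Fact p.Prime] {F : Type*} [Field F]
    (f : ℤ_[p] →+* F) (v : AddValuation F (WithTop ℤ)) {e : ℤ} (he : 0 < e) (hvp : v (p : F) = e)
    (z : ℤ_[p]) : f z ∈ v.lev 0 := by
  by_cases hz : f z = 0
  · rw [hz]; exact (v.lev 0).zero_mem
  obtain ⟨i, hi⟩ := exists_eq_int (v := v) hz
  rw [mem_lev_iff_of_eq hi]
  by_contra! hlt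
  obtain ⟨N, hN⟩ : ∃ N : ℕ, e + N * i < 0 := ⟨e.toNat + 1, by
    push_cast; rw [Int.toNat_of_nonneg he.le]; nlinarith⟩
  set y : ℤ_[p] := 1 + p * z ^ N with hy
  have hvpz : v ((p : F) * f z ^ N) = ((e + N * i : ℤ) : WithTop ℤ) :=
    map_eq_mul hvp (map_eq_pow hi N)
  have hvy : v (f y) = ((e + N * i : ℤ) : WithTop ℤ) := by
    have h1 : f y = (p : F) * f z ^ N + 1 := by
      rw [hy]; simp only [_root_.map_add, _root_.map_mul, _root_.map_pow, _root_.map_one, map_natCast]; ring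
    rw [h1]
    refine map_add_eq hvpz (lev_mono (j := 0) (by omega) one_mem_lev)
  set s := e + N * i
  obtain ⟨w, hw⟩ := PadicInt.exists_pow_eq (p := p) (l := p * s.natAbs + 1) (y := y)
    (fun hd => (Fact.out : p.Prime).one_lt.ne' (Nat.dvd_one.1
      ((Nat.dvd_add_right (dvd_mul_right _ _)).1 hd))) (by
      rw [hy, sub_add_cancel_left, norm_neg, norm_mul]
      calc _ ≤ ‖(p : ℤ_[p])‖ * 1 := by gcongr; exact PadicInt.norm_le_one _
        _ < 1 := by rw [mul_one]; rw [PadicInt.norm_p]; exact inv_lt_one_of_one_lt₀ (by exact_mod_cast (Fact.out : p.Prime).one_lt))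
  have hw0 : f w ≠ 0 := by
    intro h0
    have h1 : f y = 0 := by
      rw [← hw, _root_.map_pow, h0, zero_pow (by omega)]
    exact ne_zero_of_eq_int hvy h1
  obtain ⟨j, hj⟩ := exists_eq_int (v := v) hw0
  have h1 := map_eq_pow hj (p * s.natAbs + 1)
  rw [← _root_.map_pow, hw, hvy] at h1
  have h2 : s = ((p * s.natAbs + 1 : ℕ) : ℤ) * j := by exact_mod_cast h1
  have h3 : s.natAbs = (p * s.natAbs + 1) * j.natAbs := by
    conv_lhs => rw [h2]
    rw [Int.natAbs_mul, Int.natAbs_natCast]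
  have hj0 : j.natAbs ≠ 0 := by intro h0; rw [h0] at h3; omega
  have h4 : 1 ≤ j.natAbs := by omega
  have h5 := (Fact.out : p.Prime).one_lt
  have h6 : p * s.natAbs + 1 ≤ s.natAbs := by
    conv_rhs => rw [h3]
    exact Nat.le_mul_of_pos_right _ h4
  have h7 : s.natAbs ≤ p * s.natAbs := Nat.le_mul_of_pos_left _ (by omega)
  omega

variable {p : ℕ} [Fact p.Prime] {F Ω : Type*} [Field F] [NormedField Ω]
  [NormedAlgebra ℚ_[p] Ω] [Algebra.IsAlgebraic ℚ_[p] Ω]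
  [Algebra ℚ_[p] F] [Algebra F Ω] [IsScalarTower ℚ_[p] F Ω]
  {v : AddValuation F (WithTop ℤ)} {e : ℤ}

open AddValuation in
variable (p) in
theorem AddValuation.mem_lev_zero_of_norm_le_one (he : 0 < e) (hvp : v (p : F) = e) {a : F}
    (ha : ‖algebraMap F Ω a‖ ≤ 1) : a ∈ v.lev 0 := by
  by_cases ha0 : a = 0
  · rw [ha0]; exact (v.lev 0).zero_mem
  obtain ⟨i, hi⟩ := exists_eq_int (v := v) ha0
  rw [mem_lev_iff_of_eq hi]
  by_contra! hlt
  have hint : IsIntegral ℚ_[p] (algebraMap F Ω a) := Algebra.IsIntegral.isIntegral _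
  set P := minpoly ℚ_[p] (algebraMap F Ω a) with hP
  have hmonic : P.Monic := minpoly.monic hint
  rw [NormedAlgebra.norm_eq_spectralNorm ℚ_[p], spectralNorm,
    spectralValue_le_one_iff hmonic] at ha
  have h0 : Polynomial.aeval a P = 0 := by
    refine (algebraMap F Ω).injective ?_
    rw [_root_.map_zero, ← Polynomial.aeval_algebraMap_apply]
    exact minpoly.aeval _ _
  rw [Polynomial.aeval_eq_sum_range, Finset.sum_range_succ, hmonic.coeff_natDegree, one_smul,
    add_comm, add_eq_zero_iff_eq_neg] at h0
  have hd : 0 < P.natDegree := minpoly.natDegree_pos hint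
  have h1 : a ^ P.natDegree ∈ v.lev ((P.natDegree - 1 : ℕ) * i) := by
    rw [h0]
    refine (v.lev _).neg_mem ((v.lev _).sum_mem fun k hk => ?_)
    rw [Algebra.smul_def]
    have h2 : algebraMap ℚ_[p] F (P.coeff k) ∈ v.lev 0 :=
      v.map_padicInt_mem_lev_zero ((algebraMap ℚ_[p] F).comp PadicInt.Coe.ringHom) he hvp
        ⟨P.coeff k, ha k⟩
    refine mul_mem_lev_zero h2 ?_
    rw [mem_lev_iff_of_eq (map_eq_pow hi k)]
    have hk' : k ≤ P.natDegree - 1 := by have := Finset.mem_range.1 hk; omega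
    have : (k : ℤ) ≤ ((P.natDegree - 1 : ℕ) : ℤ) := by exact_mod_cast hk'
    nlinarith
  rw [mem_lev_iff_of_eq (map_eq_pow hi _)] at h1
  have : ((P.natDegree - 1 : ℕ) : ℤ) = P.natDegree - 1 := by omega
  rw [this] at h1
  nlinarith

open AddValuation in
variable (p) in
theorem AddValuation.mem_lev_one_of_norm_lt_one (he : 0 < e) (hvp : v (p : F) = e) {a : F}
    (ha : ‖algebraMap F Ω a‖ < 1) : a ∈ v.lev 1 := by
  by_cases ha0 : a = 0
  · rw [ha0]; exact (v.lev 1).zero_mem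
  obtain ⟨i, hi⟩ := exists_eq_int (v := v) ha0
  rw [mem_lev_iff_of_eq hi]
  have hpos : 0 < ‖(p : Ω)‖ := by
    rw [norm_prime_of_padic (p := p)]
    exact inv_pos.2 (by exact_mod_cast (Fact.out : p.Prime).pos)
  obtain ⟨N, hN⟩ := exists_pow_lt_of_lt_one hpos ha
  have h1 := mem_lev_zero_of_norm_le_one (Ω := Ω) p (a := a ^ N / p) he hvp (by
    rw [map_div₀, _root_.map_pow, map_natCast, norm_div, norm_pow]
    exact (div_le_one hpos).2 hN.le)
  rw [mem_lev_iff_of_eq (map_eq_div (map_eq_pow hi N) hvp)] at h1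
  by_contra! hlt
  have : (N : ℤ) * i ≤ 0 := mul_nonpos_of_nonneg_of_nonpos (by positivity) (by omega)
  omega

open AddValuation in
variable (p) in
theorem AddValuation.norm_eq_one_iff (he : 0 < e) (hvp : v (p : F) = e) {a : F} :
    ‖algebraMap F Ω a‖ = 1 ↔ v a = (0 : ℤ) := by
  by_cases ha0 : a = 0
  · subst ha0
    simp
  obtain ⟨i, hi⟩ := exists_eq_int (v := v) ha0
  have hinv := map_eq_inv hi
  have hpos : 0 < ‖algebraMap F Ω a‖ := norm_pos_iff.2 ((map_ne_zero _).2 ha0)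
  have ninv : ‖algebraMap F Ω a⁻¹‖ = ‖algebraMap F Ω a‖⁻¹ := by rw [map_inv₀, norm_inv]
  constructor
  · intro h1
    have h2 := mem_lev_zero_of_norm_le_one p he hvp h1.le
    have h3 := mem_lev_zero_of_norm_le_one (Ω := Ω) p (a := a⁻¹) he hvp (by rw [ninv, h1, inv_one])
    rw [mem_lev_iff_of_eq hi] at h2
    rw [mem_lev_iff_of_eq hinv] at h3
    rw [hi]
    exact_mod_cast (by omega : i = 0)
  · intro h0
    rw [h0] at hi
    have hi0 : (0 : ℤ) = i := by exact_mod_cast hi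
    rcases lt_trichotomy ‖algebraMap F Ω a‖ 1 with h1 | h1 | h1
    · have h2 := mem_lev_one_of_norm_lt_one p he hvp h1
      rw [mem_lev_iff_of_eq h0] at h2
      omega
    · exact h1
    · have h2 := mem_lev_one_of_norm_lt_one (Ω := Ω) p (a := a⁻¹) he hvp (by
        rw [ninv]; exact inv_lt_one_of_one_lt₀ h1)
      rw [mem_lev_iff_of_eq hinv] at h2
      omega

open AddValuation in
variable (p) in
theorem AddValuation.norm_lt_one (he : 0 < e) (hvp : v (p : F) = e) {π : F}
    (hπ : v π = (1 : ℤ)) : ‖algebraMap F Ω π‖ < 1 := by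
  by_contra! h1
  have hπ0 := ne_zero_of_eq_int hπ
  have h2 := mem_lev_zero_of_norm_le_one (Ω := Ω) p (a := π⁻¹) he hvp (by
    rw [map_inv₀, norm_inv]; exact inv_le_one_of_one_le₀ h1)
  rw [mem_lev_iff_of_eq (map_eq_inv hπ)] at h2
  omega

open AddValuation in
variable (p) in
theorem AddValuation.norm_eq_zpow (he : 0 < e) (hvp : v (p : F) = e) {π : F}
    (hπ : v π = (1 : ℤ)) {a : F} {i : ℤ} (ha : v a = i) :
    ‖algebraMap F Ω a‖ = ‖algebraMap F Ω π‖ ^ i := by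
  have hπ0 := ne_zero_of_eq_int hπ
  have hpos : 0 < ‖algebraMap F Ω π‖ := norm_pos_iff.2 ((map_ne_zero _).2 hπ0)
  have hzpow : v (π ^ i) = i := by
    rcases le_or_gt 0 i with h | h
    · lift i to ℕ using h
      rw [zpow_natCast, map_eq_pow hπ]; simp
    · obtain ⟨k, rfl⟩ : ∃ k : ℕ, i = -k := ⟨i.natAbs, by omega⟩
      rw [zpow_neg, zpow_natCast, map_eq_inv (map_eq_pow hπ k)]; simp
  have h1 := (norm_eq_one_iff (Ω := Ω) p he hvp (a := a / π ^ i)).2 (by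
    rw [map_eq_div ha hzpow, sub_self])
  rw [map_div₀, map_zpow₀, norm_div, norm_zpow, div_eq_one_iff_eq (zpow_pos hpos _).ne'] at h1
  exact h1

open AddValuation in
variable (p) in
theorem AddValuation.mem_lev_iff_norm_le (he : 0 < e) (hvp : v (p : F) = e) {π : F}
    (hπ : v π = (1 : ℤ)) {a : F} {i : ℤ} :
    a ∈ v.lev i ↔ ‖algebraMap F Ω a‖ ≤ ‖algebraMap F Ω π‖ ^ i := by
  have hπ0 := ne_zero_of_eq_int hπ
  have hpos : 0 < ‖algebraMap F Ω π‖ := norm_pos_iff.2 ((map_ne_zero _).2 hπ0)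
  by_cases ha0 : a = 0
  · subst ha0
    simp only [_root_.map_zero, norm_zero, (v.lev i).zero_mem, true_iff]
    exact zpow_nonneg hpos.le _
  obtain ⟨j, hj⟩ := exists_eq_int (v := v) ha0
  rw [mem_lev_iff_of_eq hj, norm_eq_zpow p he hvp hπ hj,
    zpow_le_zpow_iff_right_of_lt_one₀ hpos (norm_lt_one p he hvp hπ)]

end

section

variable {p : ℕ} [Fact p.Prime] {Ω : Type*} [NormedField Ω]
  [NormedAlgebra ℚ_[p] Ω] [IsUltrametricDist Ω]

theorem norm_one_add_pow_sub_lt {ρ : ℝ} (hρ : ρ ^ (p - 1) < ‖(p : Ω)‖) {T : Ω} (hT0 : T ≠ 0)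
    (hT : ‖T‖ ≤ ρ) : ‖(1 + T) ^ p - 1 - p * T‖ < ‖(p : Ω) * T‖ := by
  have hp : p.Prime := Fact.out
  have hp2 := hp.two_le
  have hTpos : 0 < ‖T‖ := norm_pos_iff.2 hT0
  have hpn : ‖(p : Ω)‖ = (p : ℝ)⁻¹ := norm_prime_of_padic
  have hppos : 0 < ‖(p : Ω)‖ := by rw [hpn]; exact inv_pos.2 (by exact_mod_cast hp.pos)
  have hplt : ‖(p : Ω)‖ < 1 := by
    rw [hpn]; exact inv_lt_one_of_one_lt₀ (by exact_mod_cast hp.one_lt)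
  have hTp : ‖T‖ ^ (p - 1) < ‖(p : Ω)‖ := lt_of_le_of_lt (by gcongr) hρ
  have hT1 : ‖T‖ < 1 := by
    by_contra! hc
    exact absurd (hTp.trans hplt) (not_lt.2 (one_le_pow₀ hc))
  have hexp : (1 + T) ^ p - 1 - p * T =
      ∑ i ∈ Finset.range (p - 1), T ^ (i + 2) * (p.choose (i + 2) : Ω) := by
    rw [add_comm, add_pow, show p + 1 = (p - 1) + 1 + 1 by omega, Finset.sum_range_succ',
      Finset.sum_range_succ']
    simp only [one_pow, mul_one, zero_add, pow_one, pow_zero, Nat.choose_zero_right,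
      Nat.choose_one_right, Nat.cast_one, add_assoc, one_add_one_eq_two]
    ring
  rw [hexp]
  obtain ⟨i, hi, hle⟩ := IsUltrametricDist.exists_norm_finsetSum_le (Finset.range (p - 1))
    (fun i => T ^ (i + 2) * (p.choose (i + 2) : Ω))
  have hi' := Finset.mem_range.1 (hi ⟨0, Finset.mem_range.2 (by omega)⟩)
  refine lt_of_le_of_lt hle ?_
  rw [norm_mul, norm_mul, norm_pow]
  by_cases h : i + 2 = p
  · rw [h, Nat.choose_self, Nat.cast_one, norm_one, mul_one,
      show ‖T‖ ^ p = ‖T‖ ^ (p - 1) * ‖T‖ by rw [← pow_succ, Nat.sub_add_cancel hp.pos]]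
    exact mul_lt_mul_of_pos_right hTp hTpos
  · obtain ⟨c, hc⟩ := hp.dvd_choose_self (k := i + 2) (by omega) (by omega)
    rw [hc, Nat.cast_mul, norm_mul]
    have h1 : ‖(c : Ω)‖ ≤ 1 := by
      rw [norm_natCast_of_padic (p := p)]
      exact_mod_cast Padic.norm_int_le_one (p := p) (c : ℤ)
    have h2 : ‖T‖ ^ (i + 2) < ‖T‖ := by
      conv_rhs => rw [← pow_one ‖T‖]
      exact pow_lt_pow_right_of_lt_one₀ hTpos hT1 (by omega)
    calc ‖T‖ ^ (i + 2) * (‖(p : Ω)‖ * ‖(c : Ω)‖) ≤ ‖T‖ ^ (i + 2) * (‖(p : Ω)‖ * 1) := by gcongr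
      _ < ‖T‖ * (‖(p : Ω)‖ * 1) := by gcongr
      _ = _ := by ring

theorem norm_one_add_pow_sub_one_le {ρ : ℝ} (hρ : ρ ^ (p - 1) < ‖(p : Ω)‖) {T : Ω}
    (hT : ‖T‖ ≤ ρ) : ‖(1 + T) ^ p - 1‖ ≤ ‖(p : Ω)‖ * ‖T‖ := by
  by_cases hT0 : T = 0
  · simp [hT0]
  · have h1 := norm_one_add_pow_sub_lt hρ hT0 hT
    rw [← norm_mul, show (1 + T) ^ p - 1 = ((1 + T) ^ p - 1 - p * T) + p * T by ring]
    exact (IsUltrametricDist.norm_add_le_max _ _).trans (max_le h1.le le_rfl)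

/-- Units close to `1` are `p`-th powers. -/
theorem exists_pow_eq_one_add (M : IntermediateField ℚ_[p] Ω) [FiniteDimensional ℚ_[p] M]
    {ρ : ℝ} (hρ0 : 0 ≤ ρ) (hρ : ρ ^ (p - 1) < ‖(p : Ω)‖) {β : Ω} (hβ : β ∈ M)
    (hβρ : ‖β‖ ≤ ‖(p : Ω)‖ * ρ) : ∃ w ∈ M, w ^ p = 1 + β ∧ ‖w - 1‖ ≤ ρ := by
  have hp : p.Prime := Fact.out
  have hpn : ‖(p : Ω)‖ = (p : ℝ)⁻¹ := norm_prime_of_padic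
  have hppos : 0 < ‖(p : Ω)‖ := by rw [hpn]; exact inv_pos.2 (by exact_mod_cast hp.pos)
  have hplt : ‖(p : Ω)‖ < 1 := by
    rw [hpn]; exact inv_lt_one_of_one_lt₀ (by exact_mod_cast hp.one_lt)
  have hp0 : (p : Ω) ≠ 0 := norm_pos_iff.1 hppos
  have hρ1 : ρ < 1 := by
    by_contra! hc
    exact absurd (hρ.trans hplt) (not_lt.2 (one_le_pow₀ hc))
  have hclose : ∀ a : Ω, ‖a - 1‖ < 1 → ‖a‖ = 1 := fun a ha => by
    have h1 := IsUltrametricDist.norm_add_eq_max_of_norm_ne_norm (x := a - 1) (y := 1)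
      (by rw [norm_one]; exact ha.ne)
    rw [sub_add_cancel, norm_one, max_eq_right ha.le] at h1
    exact h1
  have : ProperSpace M := FiniteDimensional.proper ℚ_[p] M
  obtain ⟨w₀, hw₀, hmin⟩ := (isCompact_closedBall (1 : M) ρ).exists_isMinOn
    ⟨1, Metric.mem_closedBall_self hρ0⟩
    (f := fun w : M => ‖(w : Ω) ^ p - (1 + β)‖) (by fun_prop)
  have hw : ‖(w₀ : Ω) - 1‖ ≤ ρ := by
    rw [mem_closedBall_iff_norm] at hw₀
    exact hw₀
  refine ⟨w₀, w₀.2, ?_, hw⟩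
  by_contra hne
  have hwn : ‖(w₀ : Ω)‖ = 1 := hclose _ (hw.trans_lt hρ1)
  have hw0 : (w₀ : Ω) ≠ 0 := norm_pos_iff.1 (by rw [hwn]; exact one_pos)
  have hwp : ‖(w₀ : Ω) ^ p - 1‖ ≤ ‖(p : Ω)‖ * ρ := by
    have h1 := norm_one_add_pow_sub_one_le hρ hw
    rw [add_sub_cancel] at h1
    exact h1.trans (by gcongr)
  set T : Ω := ((1 + β) / (w₀ : Ω) ^ p - 1) / p with hT
  have hT0 : T ≠ 0 := by
    rw [hT]
    refine div_ne_zero (fun h0 => hne ?_) hp0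
    rw [sub_eq_zero, div_eq_one_iff_eq (pow_ne_zero _ hw0)] at h0
    exact h0.symm
  have hTM : T ∈ M := M.div_mem (M.sub_mem (M.div_mem (M.add_mem M.one_mem hβ)
    (pow_mem w₀.2 p)) M.one_mem) (natCast_mem M p)
  have hTn : ‖T‖ ≤ ρ := by
    rw [hT, norm_div, div_le_iff₀ hppos, mul_comm]
    have h1 : (1 + β) / (w₀ : Ω) ^ p - 1 = (β - ((w₀ : Ω) ^ p - 1)) / (w₀ : Ω) ^ p := by
      field_simp; ring
    rw [h1, norm_div, norm_pow, hwn, one_pow, div_one]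
    rw [sub_eq_add_neg]
    exact (IsUltrametricDist.norm_add_le_max _ _).trans (max_le hβρ (by rw [norm_neg]; exact hwp))
  have hmem : w₀ * (1 + ⟨T, hTM⟩) ∈ Metric.closedBall (1 : M) ρ := by
    rw [mem_closedBall_iff_norm]
    change ‖(w₀ : Ω) * (1 + T) - 1‖ ≤ ρ
    rw [show (w₀ : Ω) * (1 + T) - 1 = ((w₀ : Ω) - 1) + w₀ * T by ring]
    refine (IsUltrametricDist.norm_add_le_max _ _).trans (max_le hw ?_)
    rw [norm_mul, hwn, one_mul]
    exact hTn
  have h2 : ‖(w₀ : Ω) ^ p - (1 + β)‖ ≤ ‖((w₀ : Ω) * (1 + T)) ^ p - (1 + β)‖ := hmin hmem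
  have h3 : ((w₀ : Ω) * (1 + T)) ^ p - (1 + β) =
      (w₀ : Ω) ^ p * ((1 + T) ^ p - 1 - p * T) := by
    have : (p : Ω) * T = (1 + β) / (w₀ : Ω) ^ p - 1 := by rw [hT]; field_simp
    rw [this, mul_pow]; field_simp; ring
  have h4 : (w₀ : Ω) ^ p - (1 + β) = -((w₀ : Ω) ^ p * (p * T)) := by
    have : (p : Ω) * T = (1 + β) / (w₀ : Ω) ^ p - 1 := by rw [hT]; field_simp
    rw [this]; field_simp; ring
  rw [h3, h4, norm_neg, norm_mul, norm_mul ((w₀ : Ω) ^ p), norm_pow, hwn, one_pow, one_mul,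
    one_mul] at h2
  exact absurd (norm_one_add_pow_sub_lt hρ hT0 hTn) (not_lt.2 h2)

end

section

open IntermediateField AddValuation

variable {p n : ℕ} {E F : Type*} [Field E] [Field F] [Algebra E F]
  {v : AddValuation F (WithTop ℤ)} {ζ : F}

/-- Powers of a uniformizer are linearly independent over an unramified subfield. -/
theorem linearIndependent_pow_of_map_base {e : ℕ} {π : F} (hπ : v π = (1 : ℤ))
    (hbase : ∀ x : E, x ≠ 0 → ∃ k : ℤ, v (algebraMap E F x) = ((e * k : ℤ) : WithTop ℤ)) :
    LinearIndependent E (fun i : Fin e => π ^ (i : ℕ)) := by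
  rw [Fintype.linearIndependent_iff]
  intro c hc
  have hval : ∀ i, c i ≠ 0 → ∃ k : ℤ, v (c i • π ^ (i : ℕ)) = ((e * k + i : ℤ) : WithTop ℤ) := by
    intro i hi
    obtain ⟨k, hk⟩ := hbase (c i) hi
    refine ⟨k, ?_⟩
    rw [Algebra.smul_def]
    have h1 := map_eq_mul hk (map_eq_pow hπ (i : ℕ))
    rwa [mul_one] at h1
  have hne : ∀ i, c i • π ^ (i : ℕ) ≠ 0 → c i ≠ 0 := fun i hi h0 => hi (by rw [h0, zero_smul])
  have hinj : ∀ i ∈ Finset.univ, ∀ i' ∈ Finset.univ, c i • π ^ (i : ℕ) ≠ 0 →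
      v (c i • π ^ (i : ℕ)) = v (c i' • π ^ (i' : ℕ)) → i = i' := by
    intro i _ i' _ hi hii
    obtain ⟨k, hk⟩ := hval i (hne i hi)
    have hi' : c i' • π ^ (i' : ℕ) ≠ 0 := ne_zero_of_eq_int (hii.symm.trans hk)
    obtain ⟨k', hk'⟩ := hval i' (hne i' hi')
    rw [hk, hk'] at hii
    have h1 : (e * k + i : ℤ) = e * k' + i' := by exact_mod_cast hii
    have h2 := congrArg (· % (e : ℤ)) h1
    simp only [Int.mul_add_emod_self_left] at h2
    rw [Int.emod_eq_of_lt (by positivity) (by exact_mod_cast i.2),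
      Int.emod_eq_of_lt (by positivity) (by exact_mod_cast i'.2)] at h2
    exact Fin.ext (by exact_mod_cast h2)
  intro i
  by_contra hi
  obtain ⟨k, hk⟩ := hval i hi
  have h1 := mem_lev_of_sum_mem (j := e * k + i + 1) hinj
    (by rw [hc]; exact (v.lev _).zero_mem) i (Finset.mem_univ i)
  rw [mem_lev_iff_of_eq hk] at h1
  omega

/-- A cyclotomic extension of an unramified base has full Galois group. -/
theorem exists_algEquiv_map_eq_pow (hp : p.Prime) (hn : 1 ≤ n) (hζ : IsPrimitiveRoot ζ (p ^ n))
    (hF : adjoin E {ζ} = ⊤) (hv1 : v (1 - ζ) = (1 : ℤ))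
    (hbase : ∀ x : E, x ≠ 0 →
      ∃ k : ℤ, v (algebraMap E F x) = ((p ^ (n - 1) * (p - 1) * k : ℤ) : WithTop ℤ))
    {c : ℕ} (hc : c.Coprime p) : ∃ σ : F ≃ₐ[E] F, σ ζ = ζ ^ c := by
  have hpn : 0 < p ^ n := pow_pos hp.pos n
  have hint : IsIntegral E ζ := (hζ.isIntegral hpn).tower_top
  have hcyc : Polynomial.aeval ζ (Polynomial.cyclotomic (p ^ n) E) = 0 := by
    rw [Polynomial.aeval_def, ← Polynomial.eval_map, Polynomial.map_cyclotomic]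
    exact hζ.isRoot_cyclotomic hpn
  have hfr : Module.finrank E F = (minpoly E ζ).natDegree := by
    rw [← adjoin.finrank hint, hF, finrank_top']
  have hfin : FiniteDimensional E F := by
    have := adjoin.finiteDimensional hint
    rw [hF] at this
    exact Module.Finite.equiv (topEquiv (F := E) (E := F)).toLinearEquiv
  have hli := linearIndependent_pow_of_map_base (e := (p ^ n).totient) (E := E) hv1 (fun x hx => by
    obtain ⟨k, hk⟩ := hbase x hx
    refine ⟨k, ?_⟩
    rw [hk, Nat.totient_prime_pow hp hn]
    push_cast [hp.one_lt.le]
    rfl)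
  have hle := hli.fintype_card_le_finrank
  rw [Fintype.card_fin, hfr] at hle
  have hmin : Polynomial.cyclotomic (p ^ n) E = minpoly E ζ := by
    refine Polynomial.eq_of_monic_of_dvd_of_natDegree_le (minpoly.monic hint)
      (Polynomial.cyclotomic.monic _ _) (minpoly.dvd E ζ hcyc) ?_
    rwa [Polynomial.natDegree_cyclotomic]
  have htop : Algebra.adjoin E {ζ} = ⊤ := by
    rw [← adjoin_simple_toSubalgebra_of_isAlgebraic hint.isAlgebraic, hF, top_toSubalgebra]
  let pb := PowerBasis.ofAdjoinEqTop hint htop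
  have hgen : pb.gen = ζ := PowerBasis.ofAdjoinEqTop_gen hint htop
  have hroot : Polynomial.aeval (ζ ^ c) (minpoly E pb.gen) = 0 := by
    rw [hgen, ← hmin, Polynomial.aeval_def, ← Polynomial.eval_map, Polynomial.map_cyclotomic]
    exact (hζ.pow_of_coprime c (hc.pow_right n)).isRoot_cyclotomic hpn
  refine ⟨AlgEquiv.ofBijective (pb.lift (ζ ^ c) hroot) (AlgHom.bijective _), ?_⟩
  rw [AlgEquiv.ofBijective_apply]
  exact (congrArg (pb.lift (ζ ^ c) hroot) hgen.symm).trans (pb.lift_gen _ _)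

end

section

open AddValuation

variable {p n : ℕ} [Fact p.Prime] {E F : Type} [Field E] [Field F] [Algebra ℚ_[p] E]
  [Algebra E F] [Algebra ℚ_[p] F] [IsScalarTower ℚ_[p] E F] [FiniteDimensional ℚ_[p] F]
  {v : AddValuation F (WithTop ℤ)} {ζ : F}

theorem finiteDimensional_embeddedField {F Ω : Type*} [Field F] [NormedField Ω]
    [NormedAlgebra ℚ_[p] Ω]
    [Algebra ℚ_[p] F] [FiniteDimensional ℚ_[p] F] [Algebra F Ω] [IsScalarTower ℚ_[p] F Ω] :
    FiniteDimensional ℚ_[p] (embeddedField p F Ω) :=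
  Module.Finite.of_surjective (IsScalarTower.toAlgHom ℚ_[p] F Ω).rangeRestrict.toLinearMap
    (IsScalarTower.toAlgHom ℚ_[p] F Ω).rangeRestrict_surjective

theorem exists_isCyclotomicTower (Ω : Type*) [NormedField Ω] [NormedAlgebra ℚ_[p] Ω]
    [Algebra.IsAlgebraic ℚ_[p] Ω] [IsAlgClosed Ω] [Algebra F Ω] [IsScalarTower ℚ_[p] F Ω]
    [IsUltrametricDist Ω] (hp2 : 2 < p) (hn : 1 ≤ n) (hζ : IsPrimitiveRoot ζ (p ^ n))
    (hF : IntermediateField.adjoin E {ζ} = ⊤) (hv1 : v (1 - ζ) = (1 : ℤ))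
    (hvp : v (p : F) = ((p ^ (n - 1) * (p - 1) : ℤ) : WithTop ℤ))
    (hbase : ∀ x : E, x ≠ 0 →
      ∃ k : ℤ, v (algebraMap E F x) = ((p ^ (n - 1) * (p - 1) * k : ℤ) : WithTop ℤ)) :
    ∃ σ : ℕ → F ≃ₐ[E] F, IsCyclotomicTower p n v ζ σ := by
  have hp : p.Prime := Fact.out
  have he : (0 : ℤ) < p ^ (n - 1) * (p - 1) :=
    mul_pos (by exact_mod_cast pow_pos hp.pos _) (by omega)
  have hfd : FiniteDimensional ℚ_[p] (embeddedField p F Ω) := finiteDimensional_embeddedField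
  have hσ : ∀ c : ℕ, ∃ σ : F ≃ₐ[E] F, c.Coprime p → σ ζ = ζ ^ c := fun c => by
    by_cases hc : c.Coprime p
    · obtain ⟨σ, h⟩ := exists_algEquiv_map_eq_pow hp hn hζ hF hv1 hbase hc
      exact ⟨σ, fun _ => h⟩
    · exact ⟨1, fun h => absurd h hc⟩
  choose σ hσ using hσ
  have hlev : ∀ {a : F} {i : ℤ},
      a ∈ v.lev i ↔ ‖algebraMap F Ω a‖ ≤ ‖algebraMap F Ω (1 - ζ)‖ ^ i := fun {a i} =>
    mem_lev_iff_norm_le p he hvp hv1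
  have hπ1 : ‖algebraMap F Ω (1 - ζ)‖ < 1 := norm_lt_one p he hvp hv1
  have hπ0 : 0 < ‖algebraMap F Ω (1 - ζ)‖ :=
    norm_pos_iff.2 ((map_ne_zero _).2 (ne_zero_of_eq_int hv1))
  have hpπ : ‖(p : Ω)‖ = ‖algebraMap F Ω (1 - ζ)‖ ^ ((p ^ (n - 1) * (p - 1) : ℤ)) := by
    have := norm_eq_zpow (Ω := Ω) p he hvp hv1 hvp
    rwa [map_natCast] at this
  refine ⟨σ,
    { prime := hp
      two_lt := hp2
      pos := hn
      root := hζ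
      adjoin_eq_top := hF
      map_one_sub := hv1
      map_p := hvp
      map_base := hbase
      map_aut := fun s a => ?_
      σ_root := hσ
      hensel := fun β s hs hβ => ?_
      residue := ?_ }⟩
  · obtain ⟨g, hg⟩ := s.exists_extend p Ω
    by_cases ha : a = 0
    · rw [ha, _root_.map_zero]
    have hsa : s a ≠ 0 := (map_ne_zero s).2 ha
    obtain ⟨i, hi⟩ := exists_eq_int (v := v) ha
    obtain ⟨j, hj⟩ := exists_eq_int (v := v) hsa
    have h1 := norm_eq_zpow (Ω := Ω) p he hvp hv1 hi
    have h2 := norm_eq_zpow (Ω := Ω) p he hvp hv1 hj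
    rw [← hg, AlgEquiv.norm_map_of_padic, h1] at h2
    rw [hi, hj, zpow_right_injective₀ hπ0 hπ1.ne h2]
  · rw [hlev] at hβ
    obtain ⟨_, ⟨w, rfl⟩, hw, hws⟩ := exists_pow_eq_one_add (embeddedField p F Ω)
      (ρ := ‖algebraMap F Ω (1 - ζ)‖ ^ s) (zpow_nonneg hπ0.le _) (by
        rw [hpπ, ← zpow_natCast, ← zpow_mul, Nat.cast_sub hp.pos, Nat.cast_one]
        refine zpow_lt_zpow_right_of_lt_one₀ hπ0 hπ1 ?_
        exact mul_lt_mul_of_pos_right hs (by omega))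
      (algebraMap_mem_embeddedField β) (by
        rw [hpπ, ← zpow_add₀ hπ0.ne']
        exact hβ)
    refine ⟨w, (algebraMap F Ω).injective ?_, ?_⟩
    · rw [_root_.map_pow, _root_.map_add, _root_.map_one]
      exact hw
    · rw [hlev, _root_.map_sub, _root_.map_one]
      exact hws
  · obtain ⟨q, hq⟩ := exists_isResidueCard (embeddedField p F Ω)
    obtain ⟨f, hf, hqf⟩ := hq.eq_pow
    refine ⟨f - 1, fun a ha => ?_⟩
    rw [Nat.sub_add_cancel hf, ← hqf]
    refine mem_lev_one_of_norm_lt_one (Ω := Ω) p he hvp ?_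
    rw [_root_.map_sub, _root_.map_pow]
    refine hq.norm_pow_sub_lt _ (algebraMap_mem_embeddedField a) ?_
    rw [hlev, zpow_zero] at ha
    exact ha

end

section

theorem ZMod.exists_eq_add_of_castHom_eq {p n k : ℕ} [NeZero p] (hk : k ≤ n) {a b : ZMod (p ^ n)}
    (h : ZMod.castHom (pow_dvd_pow p hk) (ZMod (p ^ k)) a =
      ZMod.castHom (pow_dvd_pow p hk) (ZMod (p ^ k)) b) :
    ∃ y : ZMod (p ^ n), a = b + (p : ZMod (p ^ n)) ^ k * y := by
  have : NeZero (p ^ n) := ⟨pow_ne_zero _ (NeZero.ne p)⟩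
  have h0 : ZMod.castHom (pow_dvd_pow p hk) (ZMod (p ^ k)) (a - b) = 0 := by
    rw [map_sub, h, sub_self]
  rw [← ZMod.natCast_zmod_val (a - b), map_natCast, ZMod.natCast_eq_zero_iff] at h0
  obtain ⟨y, hy⟩ := h0
  refine ⟨y, ?_⟩
  rw [← sub_eq_iff_eq_add', ← ZMod.natCast_zmod_val (a - b), hy]
  push_cast
  rfl

theorem ZMod.castHom_units_zpow {N M : ℕ} (h : M ∣ N) (u : (ZMod N)ˣ) (j : ℤ) :
    ZMod.castHom h (ZMod M) ((u ^ j : (ZMod N)ˣ) : ZMod N) =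
      ((ZMod.unitsMap h u ^ j : (ZMod M)ˣ) : ZMod M) := by
  rw [← map_zpow, ZMod.unitsMap_def, Units.coe_map]
  rfl

/-- The powers of units of `ZMod p` depend only on the exponent modulo `p - 1`. -/
theorem ZMod.units_zpow_eq_of_modEq {p : ℕ} [Fact p.Prime] (u : (ZMod p)ˣ) {i j : ℤ}
    (h : i ≡ j [ZMOD ((p : ℤ) - 1)]) : u ^ i = u ^ j := by
  obtain ⟨c, hc⟩ := h.symm.dvd
  have hp : (((p - 1 : ℕ)) : ℤ) = (p : ℤ) - 1 := by
    have := (Fact.out : p.Prime).one_lt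
    omega
  rw [← sub_add_cancel i j, zpow_add, hc, ← hp, zpow_mul, zpow_natCast,
    ZMod.units_pow_card_sub_one_eq_one, one_zpow, one_mul]

theorem ZMod.exists_unit_zpow_ne_one {p : ℕ} [Fact p.Prime] {j : ℤ}
    (h : ¬ j ≡ 0 [ZMOD ((p : ℤ) - 1)]) : ∃ u : (ZMod p)ˣ, u ^ j ≠ 1 := by
  obtain ⟨u, hu⟩ := IsCyclic.exists_generator (α := (ZMod p)ˣ)
  refine ⟨u, fun h1 => h ?_⟩
  have h2 := orderOf_dvd_iff_zpow_eq_one.2 h1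
  rw [orderOf_eq_card_of_forall_mem_zpowers hu, Nat.card_eq_fintype_card, ZMod.card_units,
    Nat.cast_sub (Fact.out : p.Prime).one_lt.le, Nat.cast_one] at h2
  exact (Int.modEq_zero_iff_dvd.2 h2)

theorem IsPrimitiveRoot.pow_val_natCast {G : Type*} [CommMonoid G] {ζ : G} {N : ℕ}
    (hζ : IsPrimitiveRoot ζ N) (c : ℕ) : ζ ^ (c : ZMod N).val = ζ ^ c := by
  rw [ZMod.val_natCast, hζ.eq_orderOf, pow_mod_orderOf]

end

section

open AddValuation

variable {p n : ℕ} [Fact p.Prime] {E F : Type} [Field E] [Field F] [Algebra ℚ_[p] E]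
  [Algebra E F] [Algebra ℚ_[p] F] [IsScalarTower ℚ_[p] E F] [FiniteDimensional ℚ_[p] F]
  {v : AddValuation F (WithTop ℤ)} {ζ : F}

/-- The reciprocity character of the Kummer extension generated by a root of an element
of `F^r`. -/
theorem IsCyclotomicTower.exists_isTwistedCharacter (Ω : Type*) [NormedField Ω]
    [NormedAlgebra ℚ_[p] Ω] [Algebra.IsAlgebraic ℚ_[p] Ω] [IsAlgClosed Ω] [Algebra F Ω]
    [IsScalarTower ℚ_[p] F Ω] [IsUltrametricDist Ω] {σ : ℕ → F ≃ₐ[E] F}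
    (h : IsCyclotomicTower p n v ζ σ) {r : ℤ} (hr1 : ¬ r ≡ 1 [ZMOD ((p : ℤ) - 1)]) {t : ℕ}
    (ht : 0 < t) (htr : (t : ℤ) ≡ 2 - r [ZMOD ((p : ℤ) - 1)]) {x : F} (hx : memFr p n E ζ r x)
    (hxp : ¬ ∃ w : F, x = w ^ p) {m : ℕ} (hmn : m ≤ n) {y : Ω}
    (hy : y ^ p ^ m = algebraMap F Ω x) :
    ∃ R : F → ZMod (p ^ n), IsTwistedCharacter v σ t R ∧ ∀ u : F, v u = (0 : ℤ) →
      ((∃ z : IntermediateField.adjoin F {y}, Algebra.norm F z = u) ↔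
        (p : ZMod (p ^ n)) ^ (n - m) * R u = 0) := by
  have hp : p.Prime := Fact.out
  have hp2 := h.two_lt
  have hn := h.pos
  have he : (0 : ℤ) < p ^ (n - 1) * (p - 1) :=
    mul_pos (by exact_mod_cast pow_pos hp.pos _) (by omega)
  have hNZ : NeZero (p ^ n) := ⟨pow_ne_zero _ hp.ne_zero⟩
  have hfd : FiniteDimensional ℚ_[p] (embeddedField p F Ω) := finiteDimensional_embeddedField
  have hone : ∀ {a : F}, ‖algebraMap F Ω a‖ = 1 ↔ v a = (0 : ℤ) := fun {a} =>
    norm_eq_one_iff p he h.map_p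
  have hroot : IsPrimitiveRoot (algebraMap F Ω ζ) (p ^ n) :=
    h.root.map_of_injective (algebraMap F Ω).injective
  obtain ⟨Y, hY⟩ := IsAlgClosed.exists_pow_nat_eq y (pow_pos hp.pos (n - m))
  have hdat : IsKummerDatum (embeddedField p F Ω) n (algebraMap F Ω ζ) (algebraMap F Ω x) Y :=
    { ne_two := by omega
      pos := hn
      root := hroot
      mem_root := algebraMap_mem_embeddedField ζ
      mem := algebraMap_mem_embeddedField x
      not_pow := by
        rintro _ ⟨w, rfl⟩ hw
        refine hxp ⟨w, (algebraMap F Ω).injective ?_⟩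
        rw [_root_.map_pow]
        exact hw.symm
      pow_eq := by rw [← hy, ← hY, ← pow_mul, ← pow_add, Nat.sub_add_cancel hmn] }
  have hcomp : ∀ (u : (ZMod (p ^ n))ˣ) (s : F ≃ₐ[E] F),
      s ζ = ζ ^ (u : ZMod (p ^ n)).val → ∃ g : Ω ≃ₐ[ℚ_[p]] Ω,
        (∀ a : F, g (algebraMap F Ω a) = algebraMap F Ω (s a)) ∧
        IsKummerCompatible (embeddedField p F Ω) n (algebraMap F Ω ζ) (algebraMap F Ω x) g
          ((u ^ (1 - r) : (ZMod (p ^ n))ˣ) : ZMod (p ^ n)).val := fun u s hs => by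
    obtain ⟨g, hg⟩ := s.exists_extend p Ω
    exact ⟨g, hg, hx.isKummerCompatible s u hs hg⟩
  have hcop : ∀ u : (ZMod (p ^ n))ˣ, (u : ZMod (p ^ n)).val.Coprime p := fun u =>
    (ZMod.val_coe_unit_coprime u).coprime_dvd_right (dvd_pow_self p (by omega))
  have hσu : ∀ c : ℕ, c.Coprime p → ∃ u : (ZMod (p ^ n))ˣ, (u : ZMod (p ^ n)) = c ∧
      σ c ζ = ζ ^ (u : ZMod (p ^ n)).val := fun c hc => by
    refine ⟨ZMod.unitOfCoprime c (hc.pow_right n), ZMod.coe_unitOfCoprime _ _, ?_⟩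
    rw [ZMod.coe_unitOfCoprime, h.root.pow_val_natCast, h.σ_root c hc]
  have hdvd : p ^ 1 ∣ p ^ n := pow_dvd_pow p hn
  have hdvd1 : p ∣ p ^ n := dvd_pow_self p (by omega)
  obtain ⟨w, hw⟩ := ZMod.exists_unit_zpow_ne_one (p := p) (j := 1 - r) (fun hc =>
    hr1 (by
      have := hc.neg.add_right 1
      simpa using this))
  have hwc : (w : ZMod p).val.Coprime p := ZMod.val_coe_unit_coprime w
  obtain ⟨u, hu, hσu1⟩ := hσu _ hwc
  have huw : ZMod.unitsMap hdvd1 u = w := by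
    ext
    rw [ZMod.unitsMap_def, Units.coe_map]
    change ZMod.castHom hdvd1 (ZMod p) (u : ZMod (p ^ n)) = w
    rw [hu, _root_.map_natCast, ZMod.natCast_zmod_val]
  obtain ⟨s, -, hs⟩ := hcomp u _ hσu1
  have hk : 1 ≤ ((u ^ (1 - r) : (ZMod (p ^ n))ˣ) : ZMod (p ^ n)).val := by
    rw [Nat.one_le_iff_ne_zero]
    intro h0
    have := hcop (u ^ (1 - r))
    rw [h0, Nat.coprime_zero_left] at this
    omega
  have hkp : (((u ^ (1 - r) : (ZMod (p ^ n))ˣ) : ZMod (p ^ n)).val - 1).Coprime p := by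
    refine Nat.Coprime.symm ((Nat.Prime.coprime_iff_not_dvd hp).2 fun hd => hw ?_)
    rw [← ZMod.natCast_eq_zero_iff, Nat.cast_sub hk, Nat.cast_one, sub_eq_zero] at hd
    ext
    rw [Units.val_one, ← hd, ← huw, ← ZMod.castHom_units_zpow,
      ← _root_.map_natCast (ZMod.castHom hdvd1 (ZMod p)), ZMod.natCast_zmod_val]
  obtain ⟨τ, hτ, R, hmul, hker, hc, hequiv⟩ := hdat.exists_character hs hk hkp
  have hmulσ : ∀ c : ℕ, c.Coprime p → ∃ u : (ZMod (p ^ n))ˣ, (u : ZMod (p ^ n)) = c ∧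
      ∀ a : F, v a = (0 : ℤ) → R (algebraMap F Ω (σ c a)) =
        ((u ^ (1 - r) : (ZMod (p ^ n))ˣ) : ZMod (p ^ n)) * R (algebraMap F Ω a) :=
    fun c hc => by
      obtain ⟨u, hu, hσc⟩ := hσu c hc
      obtain ⟨g, hg, hgc⟩ := hcomp u _ hσc
      refine ⟨u, hu, fun a ha => ?_⟩
      rw [← hg, hequiv g _ hgc (hcop _) _ (algebraMap_mem_embeddedField a) (hone.2 ha),
        ZMod.natCast_zmod_val]
  refine ⟨fun a => R (algebraMap F Ω a),
    { map_mul := fun a b ha hb => ?_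
      exists_one := ?_
      s_apply := fun k hk1 hkn => ?_
      σ_apply := fun g hg => ?_ }, fun u hu => ?_⟩
  · rw [_root_.map_mul, hmul _ (algebraMap_mem_embeddedField a) _ (algebraMap_mem_embeddedField b)
      (hone.2 ha) (hone.2 hb)]
  · obtain ⟨_, ⟨c, rfl⟩, hc1, hRc⟩ := hc
    exact ⟨c, hone.1 hc1, hRc⟩
  · have hck : (1 + p ^ k).Coprime p := by
      obtain ⟨k, rfl⟩ := Nat.exists_eq_add_of_le' hk1
      rw [pow_succ]
      simp
    obtain ⟨u, hu, hRu⟩ := hmulσ _ hck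
    have hu1 : ZMod.unitsMap (pow_dvd_pow p hkn) u = 1 := by
      ext
      rw [ZMod.unitsMap_def, Units.coe_map]
      change ZMod.castHom (pow_dvd_pow p hkn) (ZMod (p ^ k)) (u : ZMod (p ^ n)) = 1
      rw [hu, _root_.map_natCast, Nat.cast_add, ZMod.natCast_self, Nat.cast_one, add_zero]
    obtain ⟨z, hz⟩ := ZMod.exists_eq_add_of_castHom_eq (p := p) hkn
      (a := ((u ^ (1 - r) : (ZMod (p ^ n))ˣ) : ZMod (p ^ n))) (b := 1) (by
        rw [ZMod.castHom_units_zpow, hu1, one_zpow, Units.val_one, _root_.map_one])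
    exact ⟨z, fun a ha => by rw [← hz]; exact hRu a ha⟩
  · obtain ⟨u, hu, hRu⟩ := hmulσ _ hg
    have hexp : 1 - r ≡ ((t - 1 : ℕ) : ℤ) [ZMOD ((p : ℤ) - 1)] := by
      have := htr.symm.sub_right 1
      rw [Nat.cast_sub ht]
      have h2 : (2 - r - 1 : ℤ) = 1 - r := by ring
      rwa [h2] at this
    obtain ⟨z, hz⟩ := ZMod.exists_eq_add_of_castHom_eq (p := p) hn
      (a := ((u ^ (1 - r) : (ZMod (p ^ n))ˣ) : ZMod (p ^ n)))
      (b := ((g : ZMod (p ^ n)) ^ (t - 1))) (by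
        have hb : (g : ZMod (p ^ n)) ^ (t - 1) =
            ((u ^ ((t - 1 : ℕ) : ℤ) : (ZMod (p ^ n))ˣ) : ZMod (p ^ n)) := by
          rw [zpow_natCast, Units.val_pow_eq_pow_val, hu]
        rw [hb, ZMod.castHom_units_zpow, ZMod.castHom_units_zpow]
        have hpf : Fact (p ^ 1).Prime := ⟨by rwa [pow_one]⟩
        have hz := ZMod.units_zpow_eq_of_modEq (p := p ^ 1) (ZMod.unitsMap (pow_dvd_pow p hn) u)
          (i := 1 - r) (j := ((t - 1 : ℕ) : ℤ)) (by rw [pow_one]; exact hexp)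
        rw [hz])
    rw [pow_one] at hz
    exact ⟨z, fun a ha => by rw [← hz]; exact hRu a ha⟩
  · beta_reduce
    rw [← hdat.exists_cycNorm_eq_iff hτ hmul hker hc hmn (algebraMap_mem_embeddedField u)
      (hone.2 hu), hY]
    have hpm : p ^ n = p ^ (n - m) * p ^ m := by rw [← pow_add, Nat.sub_add_cancel hmn]
    refine exists_norm_eq_iff (pow_pos hp.pos m)
      (X_pow_sub_C_irreducible_of_prime_pow hp (by omega) m fun b hb => hxp ⟨b, hb.symm⟩) hy ?_
      (hroot.pow (pow_pos hp.pos n) hpm)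
      (_root_.pow_mem (algebraMap_mem_embeddedField ζ) _) hτ.map_eq ?_ u
    · rw [← hY]
      exact pow_ne_zero _ hdat.gen_ne_zero
    · rw [← hY, _root_.map_pow, hτ.map_gen, mul_pow]

/-- The conductor of the Kummer extension generated by a root of an element of `F^r`. -/
theorem isLeast_conductor_of_memFr (Ω : Type*) [NormedField Ω]
    [NormedAlgebra ℚ_[p] Ω] [Algebra.IsAlgebraic ℚ_[p] Ω] [IsAlgClosed Ω] [Algebra F Ω]
    [IsScalarTower ℚ_[p] F Ω] [IsUltrametricDist Ω] (hp2 : 2 < p) (hn : 1 ≤ n)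
    (hζ : IsPrimitiveRoot ζ (p ^ n)) (hF : IntermediateField.adjoin E {ζ} = ⊤)
    (hv1 : v (1 - ζ) = (1 : ℤ))
    (hvp : v (p : F) = ((p ^ (n - 1) * (p - 1) : ℤ) : WithTop ℤ))
    (hbase : ∀ x : E, x ≠ 0 →
      ∃ k : ℤ, v (algebraMap E F x) = ((p ^ (n - 1) * (p - 1) * k : ℤ) : WithTop ℤ))
    {r : ℤ} (hr1 : ¬ r ≡ 1 [ZMOD ((p : ℤ) - 1)]) {t : ℕ} (ht : 3 ≤ t) (htp : t + 1 ≤ p)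
    (htr : (t : ℤ) ≡ 2 - r [ZMOD ((p : ℤ) - 1)]) {x : F} (hx : memFr p n E ζ r x)
    (hxp : ¬ ∃ w : F, x = w ^ p) {m : ℕ} (hm : 1 ≤ m) (hmn : m ≤ n) {y : Ω}
    (hy : y ^ p ^ m = algebraMap F Ω x) :
    IsLeast {f : ℕ | ∀ u : F, v u = (0 : ℤ) → ((f : ℤ) : WithTop ℤ) ≤ v (u - 1) →
      ∃ z : IntermediateField.adjoin F {y}, Algebra.norm F z = u} (p ^ (m - 1) * t) := by
  obtain ⟨σ, h⟩ := exists_isCyclotomicTower Ω hp2 hn hζ hF hv1 hvp hbase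
  obtain ⟨R, hR, hiff⟩ := h.exists_isTwistedCharacter Ω hr1 (by omega) htr hx hxp hmn hy
  have hpos : 0 < p ^ (m - 1) := pow_pos h.prime.pos _
  constructor
  · intro u hu hl
    rw [hiff u hu]
    refine hR.pow_mul_eq_zero h ht htp hm hmn hu (mem_lev.2 ?_)
    exact_mod_cast hl
  · intro f hf
    by_contra hlt
    rw [not_le] at hlt
    obtain ⟨d, hd, hRd⟩ := hR.exists_pow_mul_ne_zero h ht htp hm hmn
    have hge : 3 ≤ p ^ (m - 1) * t := by nlinarith
    have hd0 : v d = (0 : ℤ) := by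
      refine map_eq_zero_of_sub_one_mem ?_ hd
      have : (3 : ℤ) ≤ p ^ (m - 1) * t := by exact_mod_cast hge
      omega
    refine hRd ((hiff d hd0).1 (hf d hd0 ?_))
    refine le_trans ?_ (mem_lev.1 hd)
    have : (f : ℤ) + 1 ≤ p ^ (m - 1) * t := by exact_mod_cast hlt
    exact_mod_cast (by omega : (f : ℤ) ≤ p ^ (m - 1) * t - 1)

end

/-- Let `r ≢ 0, 1 (mod p-1)` and let `t` be the smallest positive integer
with `t ≡ 2 - r (mod p-1)`.  If `x ∈ F^r` and `x ∉ F^{×p}`, then for every `1 ≤ m ≤ n`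
the conductor of `F(x^{1/p^m})/F` equals `p^{m-1}·t`. -/
theorem conductor_eq_of_not_cong_zero_one (p n : ℕ) [Fact p.Prime] (hp : Odd p) (hn : 1 ≤ n)
    (E F : Type) [Field E] [Field F] [Algebra ℚ_[p] E] [Algebra E F]
    [Algebra ℚ_[p] F] [IsScalarTower ℚ_[p] E F] [FiniteDimensional ℚ_[p] E]
    (ζ : F) (hζ : IsPrimitiveRoot ζ (p ^ n))
    (hF : IntermediateField.adjoin E {ζ} = ⊤)
    (v : AddValuation F (WithTop ℤ))
    (hv1 : v (1 - ζ) = (1 : WithTop ℤ))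
    (hvp : v ((p : F)) = (((p : ℤ) ^ (n - 1) * ((p : ℤ) - 1) : ℤ) : WithTop ℤ))
    (hunram : ∀ x : E, x ≠ 0 →
      ∃ k : ℤ, v (algebraMap E F x) = ((((p : ℤ) ^ (n - 1) * ((p : ℤ) - 1)) * k : ℤ) : WithTop ℤ))
    (r : ℤ) (hr0 : ¬ r ≡ 0 [ZMOD ((p : ℤ) - 1)]) (hr1 : ¬ r ≡ 1 [ZMOD ((p : ℤ) - 1)])
    (t : ℕ) (ht : 0 < t) (htr : (t : ℤ) ≡ 2 - r [ZMOD ((p : ℤ) - 1)])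
    (htmin : ∀ t' : ℕ, 0 < t' → (t' : ℤ) ≡ 2 - r [ZMOD ((p : ℤ) - 1)] → t ≤ t')
    (x : F) (hx : memFr p n E ζ r x) (hxp : ¬ ∃ w : F, x = w ^ p)
    (m : ℕ) (hm1 : 1 ≤ m) (hmn : m ≤ n)
    (y : AlgebraicClosure F) (hy : y ^ (p ^ m) = algebraMap F (AlgebraicClosure F) x) :
    IsLeast (condSet v y) (p ^ (m - 1) * t) := by
  have hpp : p.Prime := Fact.out
  have hp2 : 2 < p := by
    rcases hpp.eq_two_or_odd' with rfl | _
    · exact absurd hp (by decide)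
    · have := hpp.two_le
      have : p ≠ 2 := by rintro rfl; exact absurd hp (by decide)
      omega
  obtain ⟨c, hc⟩ := htr.dvd
  have ht3 : 3 ≤ t := by
    by_contra hlt
    have h12 : t = 1 ∨ t = 2 := by omega
    rcases h12 with rfl | rfl
    · exact hr1 (Int.modEq_iff_dvd.2 ⟨c, by push_cast at hc; linarith⟩)
    · exact hr0 (Int.modEq_iff_dvd.2 ⟨c, by push_cast at hc; linarith⟩)
  have htp : t + 1 ≤ p := by
    by_contra hlt
    have hsub := htmin (t - (p - 1)) (by omega) ?_
    · omega
    · rw [Nat.cast_sub (by omega), Nat.cast_sub hpp.one_lt.le, Nat.cast_one]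
      exact Int.modEq_iff_dvd.2 ⟨c + 1, by linarith⟩
  have hEF : FiniteDimensional E F := by
    have h1 := IntermediateField.adjoin.finiteDimensional (K := E)
      ((hζ.isIntegral (pow_pos hpp.pos n)).tower_top (A := E))
    rw [hF] at h1
    exact Module.Finite.equiv (IntermediateField.topEquiv (F := E) (E := F)).toLinearEquiv
  have hfd : FiniteDimensional ℚ_[p] F := Module.Finite.trans E F
  have halg : Algebra.IsAlgebraic ℚ_[p] (AlgebraicClosure F) := Algebra.IsAlgebraic.trans _ F _
  let hnf : NormedField (AlgebraicClosure F) := spectralNorm.normedField ℚ_[p] _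
  let hna : NormedAlgebra ℚ_[p] (AlgebraicClosure F) := spectralNorm.normedAlgebra ℚ_[p] _
  have hum : IsUltrametricDist (AlgebraicClosure F) :=
    IsUltrametricDist.isUltrametricDist_of_isNonarchimedean_norm isNonarchimedean_spectralNorm
  exact isLeast_conductor_of_memFr (AlgebraicClosure F) hp2 hn hζ hF hv1 hvp hunram hr1 ht3 htp
    htr hx hxp hm1 hmn hy
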